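/- arXiv:0804.1388 — 4 statements merged into one kernel-verified Lean document; each statement's English description precedes it below -/
import Mathlib

section
/- Let (N_k)_{k≥0} give a nest 𝒩 of order type ω with finite-rank atoms on an infinite-dimensional separable complex Hilbert space H. Let k : ℕ → ℕ be strictly increasing with k(0) = 0, and suppose there is an integer l with k(i+1) − k(i) ≤ l for all i ≥ 0 (so the subnest 𝓜 = {N_{k(i)} : i ≥ 0} ∪ {H} has finite index in 𝒩). Let T(𝓜) = {T ∈ B(H) : T(N_{k(i)}) ⊆ N_{k(i)} for all i ≥ 0}. Then for every n ≥ 1, Rg_n(T(𝓜)) is dense in T(𝓜)^n if and only if Rg_n(T(𝒩)) is dense in T(𝒩)^n; hence rtsr(T(𝓜)) = rtsr(T(𝒩)). -/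
/-- A nest of order type `ω` with finite-rank atoms on `H`, given by a strictly
increasing sequence of finite-dimensional subspaces starting at `{0}` with
dense union. -/
structure IsOmegaNest {H : Type*} [NormedAddCommGroup H] [InnerProductSpace ℂ H]
    (N : ℕ → Submodule ℂ H) : Prop where
  strictMono : StrictMono N
  bot : N 0 = ⊥
  finiteDim : ∀ k, FiniteDimensional ℂ ↥(N k)
  dense : Dense (⋃ k, (N k : Set H))

/-- The nest algebra of the nest determined by the sequence `N`. -/
def seqNestAlg {H : Type*} [NormedAddCommGroup H] [InnerProductSpace ℂ H]
    (N : ℕ → Submodule ℂ H) : Set (H →L[ℂ] H) :=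
  {T | ∀ k, ∀ x ∈ N k, T x ∈ N k}

/-- Density of the right-invertible `n`-tuples `Rg_n(S)` in `S^n`. -/
def RgDenseIn {A : Type*} [NormedRing A] (S : Set A) (n : ℕ) : Prop :=
  ∀ a : Fin n → A, (∀ i, a i ∈ S) → ∀ ε : ℝ, 0 < ε →
    ∃ b c : Fin n → A, (∀ i, b i ∈ S) ∧ (∀ i, c i ∈ S) ∧
      (∀ i, ‖a i - b i‖ < ε) ∧ ∑ i, b i * c i = 1

/-- Density of right-invertible tuples may be tested inside a larger subring. -/
theorem rgDenseIn_comap_subtype_iff {A : Type*} [NormedRing A] {S T : Subring A} (hTS : T ≤ S)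
    (n : ℕ) : RgDenseIn (T.comap S.subtype : Set S) n ↔ RgDenseIn (T : Set A) n := by
  constructor
  · intro h a ha ε hε
    obtain ⟨b, c, hb, hc, hab, hbc⟩ := h (fun i => ⟨a i, hTS (ha i)⟩) ha ε hε
    refine ⟨fun i => b i, fun i => c i, hb, hc, hab, ?_⟩
    simpa using congrArg S.subtype hbc
  · intro h a ha ε hε
    obtain ⟨b, c, hb, hc, hab, hbc⟩ := h (fun i => a i) ha ε hε
    refine ⟨fun i => ⟨b i, hTS (hb i)⟩, fun i => ⟨c i, hTS (hc i)⟩, hb, hc, hab, ?_⟩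
    apply Subtype.ext
    simpa using hbc

section ConditionalExpectation

variable {S : Type*} [NormedRing S] (Δ : S →+* S)

/-- Every element of `X` can be perturbed within `X` to one whose image under `Δ` is invertible,
with inverse in `X` fixed by `Δ`. -/
def HasInvertiblePerturbations (X : Set S) : Prop :=
  ∀ a ∈ X, ∀ ε : ℝ, 0 < ε → ∃ a' ∈ X, ‖a - a'‖ < ε ∧
    ∃ g ∈ X, Δ g = g ∧ Δ a' * g = 1 ∧ g * Δ a' = 1

variable {Δ} {T : Subring S}

theorem RgDenseIn.univ_of_subring (hT : ∀ x, x ∈ T ↔ Δ x ∈ T) (hΔΔ : ∀ x, Δ (Δ x) = Δ x)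
    (hpert : HasInvertiblePerturbations Δ Set.univ) {n : ℕ} (hn : 1 ≤ n)
    (h : RgDenseIn (T : Set S) n) : RgDenseIn (Set.univ : Set S) n := by
  obtain ⟨m, rfl⟩ := Nat.exists_eq_add_of_le' hn
  intro a _ ε hε
  obtain ⟨a₀, -, haa₀, g, -, hg, hag, hga⟩ := hpert (a 0) trivial (ε / 2) (half_pos hε)
  obtain ⟨K, hK⟩ : ∃ K : ℝ, ∀ i : Fin m, ‖Δ (a i.succ)‖ ≤ K :=
    ⟨∑ i : Fin m, ‖Δ (a i.succ)‖, fun i =>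
      Finset.single_le_sum (f := fun i : Fin m => ‖Δ (a i.succ)‖) (fun _ _ => norm_nonneg _)
        (Finset.mem_univ i)⟩
  set R : ℝ := 1 + |K| + ‖Δ a₀‖ with hR
  have hRpos : 0 < R := by positivity
  have hη : 0 < ε / 2 / R := by positivity
  obtain ⟨b, c, -, -, hab, hbc⟩ := h (Fin.cons (a₀ * g) fun i : Fin m => a i.succ - a₀ * g * Δ (a i.succ))
    (by
      refine Fin.cases ?_ fun i => ?_
      · simp only [Fin.cons_zero, SetLike.mem_coe]
        rw [hT, map_mul, hg, hag]
        exact T.one_mem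
      · simp only [Fin.cons_succ, SetLike.mem_coe]
        rw [hT, map_sub, map_mul, map_mul, hg, hag, hΔΔ, one_mul, sub_self]
        exact T.zero_mem)
    (ε / 2 / R) hη
  have hab₀ : ‖a₀ * g - b 0‖ < ε / 2 / R := by simpa using hab 0
  have hηR : ε / 2 / R * R = ε / 2 := by field_simp
  refine ⟨Fin.cons (b 0 * Δ a₀) fun i : Fin m => b i.succ + b 0 * Δ (a i.succ),
    Fin.cons (g * (c 0 - ∑ i, Δ (a (Fin.succ i)) * c i.succ)) fun i : Fin m => c i.succ,
    fun _ => trivial, fun _ => trivial, ?_, ?_⟩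
  · refine Fin.cases ?_ fun i => ?_
    · have h1 : a 0 - b 0 * Δ a₀ = (a 0 - a₀) + (a₀ * g - b 0) * Δ a₀ := by
        rw [sub_mul, mul_assoc a₀, hga, mul_one]; abel
      have h2 : ‖(a₀ * g - b 0) * Δ a₀‖ ≤ ε / 2 :=
        calc ‖(a₀ * g - b 0) * Δ a₀‖ ≤ ‖a₀ * g - b 0‖ * ‖Δ a₀‖ := norm_mul_le _ _
          _ ≤ ε / 2 / R * R := by
            gcongr
            rw [hR]
            linarith [abs_nonneg K]
          _ = ε / 2 := hηR
      simp only [Fin.cons_zero]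
      rw [h1]
      linarith [norm_add_le (a 0 - a₀) ((a₀ * g - b 0) * Δ a₀)]
    · have h0 : ‖a i.succ - a₀ * g * Δ (a i.succ) - b i.succ‖ < ε / 2 / R := by
        simpa using hab i.succ
      have h1 : a i.succ - (b i.succ + b 0 * Δ (a i.succ)) =
          (a i.succ - a₀ * g * Δ (a i.succ) - b i.succ) + (a₀ * g - b 0) * Δ (a i.succ) := by
        noncomm_ring
      have h2 : ‖(a₀ * g - b 0) * Δ (a i.succ)‖ ≤ ε / 2 / R * |K| :=
        (norm_mul_le _ _).trans
          (mul_le_mul hab₀.le ((hK i).trans (le_abs_self K)) (norm_nonneg _) hη.le)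
      have h3 : ε / 2 / R + ε / 2 / R * |K| ≤ ε / 2 / R * R := by
        rw [hR, mul_add, mul_add, mul_one]
        have := mul_nonneg hη.le (norm_nonneg (Δ a₀))
        linarith
      simp only [Fin.cons_succ]
      rw [h1]
      linarith [norm_add_le (a i.succ - a₀ * g * Δ (a i.succ) - b i.succ)
        ((a₀ * g - b 0) * Δ (a i.succ))]
  · rw [Fin.sum_univ_succ] at hbc ⊢
    simp only [Fin.cons_zero, Fin.cons_succ, add_mul, Finset.sum_add_distrib]
    rw [← mul_assoc, mul_assoc (b 0), hag, mul_one, mul_sub, Finset.mul_sum, ← hbc]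
    simp only [mul_assoc]
    abel

theorem RgDenseIn.subring_of_univ [CompleteSpace S] (hT : ∀ x, x ∈ T ↔ Δ x ∈ T)
    (hΔΔ : ∀ x, Δ (Δ x) = Δ x) (hΔ : ∀ x, ‖Δ x‖ ≤ ‖x‖)
    (hpert : HasInvertiblePerturbations Δ (T : Set S)) {n : ℕ} (hn : 1 ≤ n)
    (h : RgDenseIn (Set.univ : Set S) n) : RgDenseIn (T : Set S) n := by
  obtain ⟨m, rfl⟩ := Nat.exists_eq_add_of_le' hn
  intro a ha ε hε
  obtain ⟨a₀, ha₀, haa₀, g, hgT, hg, hag, hga⟩ := hpert (a 0) (ha 0) (ε / 2) (half_pos hε)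
  set a' : Fin (m + 1) → S := Fin.cons a₀ fun i => a i.succ with ha'
  have ha'0 : a' 0 = a₀ := rfl
  have haa' : ∀ i, ‖a i - a' i‖ < ε / 2 := by
    refine Fin.cases haa₀ fun i => ?_
    simp only [ha', Fin.cons_succ, sub_self, norm_zero]
    exact half_pos hε
  have ha'T : ∀ i, a' i ∈ T := Fin.cases ha₀ fun i => ha i.succ
  set R : ℝ := 1 + (‖a₀‖ + 1) * (2 * ‖(1 : S)‖ * ‖g‖) with hR
  have hRpos : 0 < R := by positivity
  set η : ℝ := min 1 (min (1 / (2 * (‖g‖ + 1))) (ε / 2 / R)) with hη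
  have hηpos : 0 < η := by positivity
  have hη1 : η ≤ 1 := min_le_left _ _
  have hηg : ‖g‖ * η ≤ 1 / 2 := by
    have h1 : η ≤ 1 / (2 * (‖g‖ + 1)) := (min_le_right _ _).trans (min_le_left _ _)
    have h2 : η * (2 * (‖g‖ + 1)) ≤ 1 := by rwa [le_div_iff₀ (by positivity)] at h1
    nlinarith
  have hηR : η * R ≤ ε / 2 := by
    have h1 : η ≤ ε / 2 / R := (min_le_right _ _).trans (min_le_right _ _)
    rwa [le_div_iff₀ hRpos] at h1
  obtain ⟨b, c, -, -, hab, hbc⟩ := h a' (fun _ => trivial) η hηpos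
  set d : Fin (m + 1) → S := fun i => Δ (b i - a' i) with hd
  have hdη : ∀ i, ‖d i‖ ≤ η := fun i =>
    (hΔ _).trans (by rw [norm_sub_rev]; exact (hab i).le)
  have hΔd : ∀ i, Δ (d i) = d i := fun i => hΔΔ _
  have hb : ∀ i, Δ (b i) = Δ (a' i) + d i := fun i => by simp [hd]
  have hu : ‖g * d 0‖ ≤ 1 / 2 :=
    (norm_mul_le _ _).trans
      ((mul_le_mul_of_nonneg_left (hdη 0) (norm_nonneg _)).trans hηg)
  obtain ⟨x, hx⟩ : IsUnit (1 + g * d 0) := by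
    have := isUnit_one_sub_of_norm_lt_one (x := -(g * d 0)) (by rw [norm_neg]; linarith)
    rwa [sub_neg_eq_add] at this
  set k : S := ↑x⁻¹ with hk
  have hk1 : (1 + g * d 0) * k = 1 := by rw [← hx]; exact x.mul_inv
  have hk2 : k * (1 + g * d 0) = 1 := by rw [← hx]; exact x.inv_mul
  have hΔk : Δ k = k := by
    have h1 : Δ k * (1 + g * d 0) = 1 := by
      have := congrArg Δ hk2
      rwa [map_mul, map_add, map_one, map_mul, hg, hΔd] at this
    exact left_inv_eq_right_inv h1 hk1
  have hkn : ‖k‖ ≤ 2 * ‖(1 : S)‖ := by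
    have h1 : k = 1 - g * d 0 * k := by rw [← hk1]; noncomm_ring
    have h2 : ‖k‖ ≤ ‖(1 : S)‖ + ‖g * d 0‖ * ‖k‖ := by
      calc ‖k‖ = ‖1 - g * d 0 * k‖ := by rw [← h1]
        _ ≤ ‖(1 : S)‖ + ‖g * d 0 * k‖ := norm_sub_le _ _
        _ ≤ _ := by gcongr; exact norm_mul_le _ _
    nlinarith [norm_nonneg k]
  have hbk : Δ (b 0) * (k * g) = 1 := by
    have h1 : Δ (b 0) = Δ a₀ * (1 + g * d 0) := by
      rw [hb, ha'0, mul_add, mul_one, ← mul_assoc, hag, one_mul]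
    rw [h1, mul_assoc, ← mul_assoc _ k, hk1, one_mul, hag]
  have hkg : g - k * g * d 0 * g = k * g := by
    have : k = 1 - k * (g * d 0) := by rw [← hk2]; noncomm_ring
    nth_rewrite 2 [this]
    noncomm_ring
  set b' : Fin (m + 1) → S := fun i => b i - b 0 * (k * g) * d i with hb'
  have hΔb' : ∀ i, Δ (b' i) = Δ (a' i) := fun i => by
    simp only [hb', map_sub, map_mul, hΔk, hg, hΔd]
    rw [hbk, one_mul, hb, add_sub_cancel_right]
  set s : S := ∑ i, d i * c i with hs
  set c' : Fin (m + 1) → S := c + Pi.single 0 (g * s) with hc'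
  have hbc' : ∑ i, b' i * c' i = 1 := by
    have h1 : ∑ i, b' i * c i = 1 - b 0 * (k * g) * s := by
      simp only [hb', sub_mul, Finset.sum_sub_distrib, hbc, hs, Finset.mul_sum, mul_assoc]
    have h2 : ∑ i, b' i * (Pi.single 0 (g * s) : Fin (m + 1) → S) i = b' 0 * (g * s) := by
      rw [Finset.sum_eq_single 0] <;> simp +contextual
    simp only [hc', Pi.add_apply, mul_add, Finset.sum_add_distrib]
    rw [h1, h2]
    have h3 : b' 0 * (g * s) = b 0 * (k * g) * s := by
      rw [← hkg]
      simp only [hb']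
      noncomm_ring
    rw [h3, sub_add_cancel]
  refine ⟨b', c' + Pi.single 0 g - fun i => c' i * b' 0 * g, fun i => ?_, fun i => ?_,
    fun i => ?_, ?_⟩
  · rw [SetLike.mem_coe, hT, hΔb', ← hT]
    exact ha'T i
  · have h1 : Δ ((c' + Pi.single 0 g - fun i => c' i * b' 0 * g : Fin (m + 1) → S) i) =
        (Pi.single 0 g : Fin (m + 1) → S) i := by
      have h2 : Δ ((Pi.single 0 g : Fin (m + 1) → S) i) = (Pi.single 0 g : Fin (m + 1) → S) i := by
        by_cases hi : i = 0
        · subst hi; simpa using hg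
        · simp [hi]
      simp only [Pi.sub_apply, Pi.add_apply, map_sub, map_add, map_mul, h2, hΔb', ha'0, hg]
      rw [mul_assoc, hag, mul_one, add_sub_cancel_left]
    rw [SetLike.mem_coe, hT, h1]
    by_cases hi : i = 0
    · subst hi; simpa using hgT
    · simp [hi]
  · have hb0 : ‖b 0‖ ≤ ‖a₀‖ + 1 := by
      have := norm_le_norm_add_norm_sub (a' 0) (b 0)
      rw [ha'0] at this
      linarith [hab 0, ha'0 ▸ hab 0]
    have h1 : a i - b' i = (a i - a' i) + ((a' i - b i) + b 0 * (k * g) * d i) := by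
      simp only [hb']; abel
    have h2 : ‖b 0 * (k * g) * d i‖ ≤ (‖a₀‖ + 1) * (2 * ‖(1 : S)‖ * ‖g‖) * η :=
      calc ‖b 0 * (k * g) * d i‖ ≤ ‖b 0‖ * (‖k‖ * ‖g‖) * ‖d i‖ := by
            refine (norm_mul_le _ _).trans ?_
            gcongr
            refine (norm_mul_le _ _).trans ?_
            gcongr
            exact norm_mul_le _ _
        _ ≤ _ := by gcongr; exact hdη i
    have h3 := norm_add_le (a i - a' i) ((a' i - b i) + b 0 * (k * g) * d i)
    have h4 := norm_add_le (a' i - b i) (b 0 * (k * g) * d i)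
    have h5 : η + (‖a₀‖ + 1) * (2 * ‖(1 : S)‖ * ‖g‖) * η = η * R := by rw [hR]; ring
    rw [h1]
    linarith [haa' i, hab i]
  · have h2 : ∑ i, b' i * (Pi.single 0 g : Fin (m + 1) → S) i = b' 0 * g := by
      rw [Finset.sum_eq_single 0] <;> simp +contextual
    simp only [Pi.sub_apply, Pi.add_apply, mul_add, mul_sub, Finset.sum_add_distrib,
      Finset.sum_sub_distrib]
    rw [h2, hbc']
    simp only [← mul_assoc]
    rw [← Finset.sum_mul, ← Finset.sum_mul, hbc', one_mul, add_sub_cancel_right]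

end ConditionalExpectation

theorem Submodule.norm_sub_starProjection_le {E : Type*} [NormedAddCommGroup E]
    [InnerProductSpace ℂ E] (U : Submodule ℂ E) [U.HasOrthogonalProjection] (x : E) {y : E}
    (hy : y ∈ U) : ‖x - U.starProjection x‖ ≤ ‖x - y‖ := by
  rw [U.starProjection_minimal]
  exact ciInf_le ⟨0, by rintro _ ⟨z, rfl⟩; exact norm_nonneg _⟩ (⟨y, hy⟩ : U)

/-- Every endomorphism of a finite-dimensional inner product space is a unitary times a positive
operator, expressed through the quadratic form. -/
theorem LinearMap.exists_linearIsometry_re_inner_nonneg {V : Type*} [NormedAddCommGroup V]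
    [InnerProductSpace ℂ V] [FiniteDimensional ℂ V] (f : V →ₗ[ℂ] V) :
    ∃ u : V →ₗᵢ[ℂ] V, ∀ x, 0 ≤ (inner ℂ (u x) (f x)).re := by
  have hs : (f.adjoint ∘ₗ f).IsSymmetric := fun x y => by
    simp [LinearMap.adjoint_inner_left, LinearMap.adjoint_inner_right]
  set e := hs.eigenvectorBasis rfl with he
  have horth : ∀ i j, i ≠ j → inner ℂ (f (e i)) (f (e j)) = 0 := fun i j hij => by
    have h1 : inner ℂ (f (e i)) (f (e j)) = inner ℂ (e i) ((f.adjoint ∘ₗ f) (e j)) := by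
      rw [LinearMap.comp_apply, LinearMap.adjoint_inner_right]
    rw [h1, he, hs.apply_eigenvectorBasis, inner_smul_right, ← he,
      e.orthonormal.inner_eq_zero hij, mul_zero]
  set v : Fin (Module.finrank ℂ V) → V := fun i => ((‖f (e i)‖ : ℂ)⁻¹) • f (e i) with hv
  have hvo : Orthonormal ℂ (Set.domRestrict {i | f (e i) ≠ 0} v) := by
    constructor
    · rintro ⟨i, hi⟩
      exact norm_smul_inv_norm hi
    · rintro ⟨i, hi⟩ ⟨j, hj⟩ hij
      change inner ℂ (v i) (v j) = 0
      rw [inner_smul_left, inner_smul_right, horth i j (fun h => hij (Subtype.ext h))]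
      simp
  obtain ⟨b, hb⟩ := hvo.exists_orthonormalBasis_extension_of_card_eq (by simp)
  have hfe : ∀ i, f (e i) = (‖f (e i)‖ : ℂ) • b i := fun i => by
    by_cases hi : f (e i) = 0
    · simp [hi]
    · rw [hb i hi]
      simp only [hv]
      rw [smul_smul, mul_inv_cancel₀ (by simpa using hi), one_smul]
  refine ⟨(e.equiv b (Equiv.refl _)).toLinearIsometry, fun x => ?_⟩
  have hu : (e.equiv b (Equiv.refl _)).toLinearIsometry x = ∑ i, e.repr x i • b i := by
    conv_lhs => rw [← e.sum_repr x]
    simp [map_sum]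
  have hf : f x = ∑ i, (e.repr x i * ‖f (e i)‖) • b i := by
    conv_lhs => rw [← e.sum_repr x]
    rw [map_sum]
    refine Finset.sum_congr rfl fun i _ => ?_
    rw [map_smul, hfe i, smul_smul]
    congr 3
    simp [norm_smul]
  rw [hu, hf, b.orthonormal.inner_sum, Complex.re_sum]
  refine Finset.sum_nonneg fun i _ => ?_
  rw [← mul_assoc, mul_comm ((starRingEnd ℂ) _), Complex.mul_conj, ← Complex.ofReal_mul,
    Complex.ofReal_re]
  exact mul_nonneg (Complex.normSq_nonneg _) (norm_nonneg _)

section NestAlgebra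

variable {H : Type*} [NormedAddCommGroup H] [InnerProductSpace ℂ H]

/-- The nest algebra as a subring of the bounded operators. -/
def nestSubring (N : ℕ → Submodule ℂ H) : Subring (H →L[ℂ] H) where
  carrier := seqNestAlg N
  mul_mem' ha hb m x hx := ha m _ (hb m x hx)
  one_mem' _ _ hx := hx
  add_mem' ha hb m x hx := (N m).add_mem (ha m x hx) (hb m x hx)
  zero_mem' m _ _ := (N m).zero_mem
  neg_mem' ha m x hx := (N m).neg_mem (ha m x hx)

/-- The `i`-th atom `N (i + 1) ⊖ N i`. -/
noncomputable def nestAtom (N : ℕ → Submodule ℂ H) (i : ℕ) : Submodule ℂ H := N (i + 1) ⊓ (N i)ᗮ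

variable {N : ℕ → Submodule ℂ H}

theorem IsOmegaNest.comp (hN : IsOmegaNest N) {k : ℕ → ℕ} (hk : StrictMono k) (hk0 : k 0 = 0) :
    IsOmegaNest fun i => N (k i) where
  strictMono := hN.strictMono.comp hk
  bot := by rw [hk0, hN.bot]
  finiteDim i := hN.finiteDim (k i)
  dense := hN.dense.mono <| Set.iUnion_subset fun i x hx =>
    Set.mem_iUnion.2 ⟨i, hN.strictMono.monotone (hk.id_le i) hx⟩

theorem nestSubring_le_comp (k : ℕ → ℕ) : nestSubring N ≤ nestSubring fun i => N (k i) :=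
  fun _ hx i => hx (k i)

variable [hfd : ∀ i, FiniteDimensional ℂ (N i)]

theorem isClosed_nestSubring : IsClosed (nestSubring N : Set (H →L[ℂ] H)) := by
  have : (nestSubring N : Set (H →L[ℂ] H)) = ⋂ m, ⋂ x ∈ N m, {T | T x ∈ N m} := by
    ext T
    simp only [Set.mem_iInter, Set.mem_ofPred_eq]
    rfl
  rw [this]
  refine isClosed_iInter fun m => isClosed_iInter fun x => isClosed_iInter fun _ => ?_
  exact (N m).closed_of_finiteDimensional.preimage (by fun_prop)

theorem mem_seqNestAlg_of_mul_eq_one {x y : H →L[ℂ] H} (hx : x ∈ seqNestAlg N) (hyx : y * x = 1) :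
    y ∈ seqNestAlg N := by
  have hyx' : ∀ v, y (x v) = v := fun v => congrArg (fun T : H →L[ℂ] H => T v) hyx
  intro m v hv
  have hinj : Function.Injective ((x : H →ₗ[ℂ] H).restrict (hx m)) := fun a b hab => by
    have h1 : x a = x b := congrArg Subtype.val hab
    exact Subtype.ext (by rw [← hyx' a, h1, hyx'])
  obtain ⟨w, hw⟩ := LinearMap.injective_iff_surjective.1 hinj ⟨v, hv⟩
  have hw' : x w = v := congrArg Subtype.val hw
  rw [← hw', hyx']
  exact w.2

instance (i : ℕ) : FiniteDimensional ℂ (nestAtom N i) :=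
  Submodule.finiteDimensional_inf_left _ _

namespace IsOmegaNest

variable (hN : IsOmegaNest N)
include hN

omit hfd in
theorem atom_le {i m : ℕ} (him : i < m) : nestAtom N i ≤ N m :=
  inf_le_left.trans (hN.strictMono.monotone him)

theorem starProjection_succ (i : ℕ) (x : H) :
    (N (i + 1)).starProjection x = (N i).starProjection x + (nestAtom N i).starProjection x := by
  have hle : N i ≤ N (i + 1) := hN.strictMono.monotone i.le_succ
  rw [← sub_eq_iff_eq_add', eq_comm]
  apply Submodule.eq_starProjection_of_mem_orthogonal
  · refine ⟨Submodule.sub_mem _ (Submodule.starProjection_apply_mem _ _)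
      (hle (Submodule.starProjection_apply_mem _ _)), ?_⟩
    have h1 := (N i).sub_starProjection_mem_orthogonal x
    have h2 := Submodule.orthogonal_le hle ((N (i + 1)).sub_starProjection_mem_orthogonal x)
    have := Submodule.sub_mem _ h1 h2
    rwa [sub_sub_sub_cancel_left] at this
  · have h1 : x - (N (i + 1)).starProjection x ∈ (nestAtom N i)ᗮ :=
      Submodule.orthogonal_le inf_le_left ((N (i + 1)).sub_starProjection_mem_orthogonal x)
    have h2 : (N i).starProjection x ∈ (nestAtom N i)ᗮ :=
      (Submodule.le_orthogonal_iff_le_orthogonal.1 inf_le_right)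
        (Submodule.starProjection_apply_mem _ _)
    have := Submodule.add_mem _ h1 h2
    rwa [sub_add] at this

theorem atom_starProjection_eq {i : ℕ} {x : H} (hx : x ∈ N (i + 1)) :
    (nestAtom N i).starProjection x = x - (N i).starProjection x := by
  have := hN.starProjection_succ i x
  rw [Submodule.starProjection_eq_self_iff.2 hx] at this
  exact eq_sub_of_add_eq' this.symm

omit hN in
theorem starProjection_atom {i : ℕ} {x : H} (hx : x ∈ nestAtom N i) :
    (N i).starProjection x = 0 :=
  (Submodule.starProjection_apply_eq_zero_iff _).2 hx.2

omit hN in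
theorem atom_starProjection_eq_zero {i : ℕ} {x : H} (hx : x ∈ N i) :
    (nestAtom N i).starProjection x = 0 :=
  (Submodule.starProjection_apply_eq_zero_iff _).2
    ((Submodule.le_orthogonal_iff_le_orthogonal.1 inf_le_right) hx)

theorem sum_starProjection (m : ℕ) (x : H) :
    ∑ i ∈ Finset.range m, (nestAtom N i).starProjection x = (N m).starProjection x := by
  induction m with
  | zero =>
    have : (N 0).starProjection x = 0 := by
      have h := Submodule.starProjection_apply_mem (N 0) x
      exact (Submodule.mem_bot ℂ).1 (hN.bot.le h)
    simp [this]
  | succ m ih => rw [Finset.sum_range_succ, ih, hN.starProjection_succ]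

omit hfd in
theorem orthogonalFamily :
    OrthogonalFamily ℂ (fun i => nestAtom N i) fun i => (nestAtom N i).subtypeₗᵢ := by
  have key : ∀ i j, i < j → ∀ v ∈ nestAtom N i, ∀ w ∈ nestAtom N j, inner ℂ v w = 0 :=
    fun i j hij v hv w hw => hw.2 v (hN.atom_le hij hv)
  intro i j hij v w
  rcases lt_or_gt_of_ne hij with h | h
  · exact key i j h v v.2 w w.2
  · exact inner_eq_zero_symm.1 (key j i h w w.2 v v.2)

theorem induction_atom {p : H → Prop} (hzero : p 0) (hadd : ∀ x y, p x → p y → p (x + y))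
    {m : ℕ} (hp : ∀ i < m, ∀ x ∈ nestAtom N i, p x) {x : H} (hx : x ∈ N m) : p x := by
  rw [← Submodule.starProjection_eq_self_iff.2 hx, ← hN.sum_starProjection]
  exact Finset.sum_induction _ p hadd hzero fun i hi =>
    hp i (Finset.mem_range.1 hi) _ (Submodule.starProjection_apply_mem _ _)

theorem ext_atom {D D' : H →L[ℂ] H} (h : ∀ i, ∀ x ∈ nestAtom N i, D x = D' x) : D = D' := by
  refine DFunLike.coe_injective (Continuous.ext_on hN.dense D.continuous D'.continuous ?_)
  intro x hx
  obtain ⟨m, hm⟩ := Set.mem_iUnion.1 hx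
  exact hN.induction_atom (p := fun x => D x = D' x) (by simp) (fun x y hx hy => by simp [hx, hy])
    (fun i _ => h i) hm

theorem sum_norm_sq_le (s : Finset ℕ) (x : H) :
    ∑ i ∈ s, ‖(nestAtom N i).starProjection x‖ ^ 2 ≤ ‖x‖ ^ 2 := by
  obtain ⟨m, hm⟩ := s.exists_nat_subset_range
  calc ∑ i ∈ s, ‖(nestAtom N i).starProjection x‖ ^ 2
      ≤ ∑ i ∈ Finset.range m, ‖(nestAtom N i).starProjection x‖ ^ 2 :=
        Finset.sum_le_sum_of_subset_of_nonneg hm fun _ _ _ => by positivity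
    _ = ‖(N m).starProjection x‖ ^ 2 := by
        rw [← hN.sum_starProjection]
        exact (hN.orthogonalFamily.norm_sum
          (fun i => (nestAtom N i).orthogonalProjectionOnto x) (Finset.range m)).symm
    _ ≤ ‖x‖ ^ 2 := by
        gcongr
        exact Submodule.norm_starProjection_apply_le _ _

/-- A uniformly bounded sequence of operators has a bounded block diagonal part. -/
theorem exists_blockDiagonal [CompleteSpace H] (T : ℕ → H →L[ℂ] H) {K : ℝ} (hK : 0 ≤ K)
    (hT : ∀ i x, ‖T i x‖ ≤ K * ‖x‖) :
    ∃ D : H →L[ℂ] H, ‖D‖ ≤ K ∧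
      ∀ i, ∀ x ∈ nestAtom N i, D x = (nestAtom N i).starProjection (T i x) := by
  set f : ∀ i, H →L[ℂ] nestAtom N i := fun i =>
    (nestAtom N i).orthogonalProjectionOnto ∘L T i ∘L (nestAtom N i).starProjection with hf
  have hfle : ∀ i x, ‖f i x‖ ^ 2 ≤ K ^ 2 * ‖(nestAtom N i).starProjection x‖ ^ 2 := fun i x => by
    rw [← mul_pow]
    gcongr
    exact ((nestAtom N i).norm_orthogonalProjectionOnto_apply_le _).trans (hT _ _)
  have hsum : ∀ x (s : Finset ℕ), ∑ i ∈ s, ‖f i x‖ ^ 2 ≤ (K * ‖x‖) ^ 2 := fun x s =>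
    calc ∑ i ∈ s, ‖f i x‖ ^ 2 ≤ ∑ i ∈ s, K ^ 2 * ‖(nestAtom N i).starProjection x‖ ^ 2 :=
          Finset.sum_le_sum fun i _ => hfle i x
      _ ≤ (K * ‖x‖) ^ 2 := by
          rw [← Finset.mul_sum, mul_pow]
          gcongr
          exact hN.sum_norm_sq_le s x
  have hsummable : ∀ x, Summable fun i => (f i x : H) := fun x =>
    (hN.orthogonalFamily.summable_iff_norm_sq_summable fun i => f i x).2
      (summable_of_sum_le (fun _ => by positivity) (hsum x))
  set L : H →ₗ[ℂ] H :=
    { toFun := fun x => ∑' i, (f i x : H)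
      map_add' := fun x y => by
        rw [← (hsummable x).tsum_add (hsummable y)]
        simp
      map_smul' := fun c x => by
        rw [RingHom.id_apply, ← (hsummable x).tsum_const_smul c]
        simp } with hL
  have hLle : ∀ x, ‖L x‖ ≤ K * ‖x‖ := fun x => by
    refine le_of_tendsto (hsummable x).hasSum.norm (Filter.Eventually.of_forall fun s => ?_)
    refine abs_le_of_sq_le_sq' ?_ (by positivity) |>.2
    exact (hN.orthogonalFamily.norm_sum (fun i => f i x) s).trans_le (hsum x s)
  refine ⟨L.mkContinuous K hLle, L.mkContinuous_norm_le hK hLle, fun i x hx => ?_⟩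
  have h0 : ∀ j, j ≠ i → (f j x : H) = 0 := fun j hj => by
    have : (nestAtom N j).starProjection x = 0 := by
      rw [Submodule.starProjection_apply_eq_zero_iff]
      exact fun w hw => hN.orthogonalFamily hj ⟨w, hw⟩ ⟨x, hx⟩
    simp [hf, this]
  have h1 : L x = f i x := tsum_eq_single i h0
  rw [LinearMap.mkContinuous_apply, h1]
  simp [hf, Submodule.starProjection_eq_self_iff.2 hx]

variable [CompleteSpace H]

theorem exists_diagPart (T : H →L[ℂ] H) : ∃ D : H →L[ℂ] H, ‖D‖ ≤ ‖T‖ ∧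
    ∀ i, ∀ x ∈ nestAtom N i, D x = (nestAtom N i).starProjection (T x) :=
  hN.exists_blockDiagonal (fun _ => T) (norm_nonneg T) fun _ => T.le_opNorm

/-- The block diagonal part of an operator. -/
noncomputable def diagPart (T : H →L[ℂ] H) : H →L[ℂ] H := (hN.exists_diagPart T).choose

theorem norm_diagPart_le (T : H →L[ℂ] H) : ‖hN.diagPart T‖ ≤ ‖T‖ :=
  (hN.exists_diagPart T).choose_spec.1

theorem diagPart_apply (T : H →L[ℂ] H) {i : ℕ} {x : H} (hx : x ∈ nestAtom N i) :
    hN.diagPart T x = (nestAtom N i).starProjection (T x) :=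
  (hN.exists_diagPart T).choose_spec.2 i x hx

theorem diagPart_apply_mem (T : H →L[ℂ] H) {i : ℕ} {x : H} (hx : x ∈ nestAtom N i) :
    hN.diagPart T x ∈ nestAtom N i := by
  rw [hN.diagPart_apply T hx]
  exact Submodule.starProjection_apply_mem _ _

omit [CompleteSpace H] in
theorem mem_seqNestAlg_of_atom {D : H →L[ℂ] H}
    (hD : ∀ i, ∀ x ∈ nestAtom N i, D x ∈ nestAtom N i) : D ∈ seqNestAlg N := fun m _ hx =>
  hN.induction_atom (p := fun x => D x ∈ N m) (by simp)
    (fun x y hx hy => by rw [map_add]; exact (N m).add_mem hx hy)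
    (fun i hi x hx => hN.atom_le hi (hD i x hx)) hx

/-- The block diagonal part is multiplicative on the nest algebra. -/
noncomputable def diagHom : nestSubring N →+* nestSubring N where
  toFun T := ⟨hN.diagPart T, hN.mem_seqNestAlg_of_atom fun _ _ => hN.diagPart_apply_mem T.1⟩
  map_one' := Subtype.ext <| hN.ext_atom fun i x hx => by
    simp [hN.diagPart_apply _ hx, Submodule.starProjection_eq_self_iff.2 hx]
  map_zero' := Subtype.ext <| hN.ext_atom fun i x hx => by
    simp [hN.diagPart_apply _ hx]
  map_add' T S := Subtype.ext <| hN.ext_atom fun i x hx => by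
    simp [hN.diagPart_apply _ hx]
  map_mul' T S := Subtype.ext <| hN.ext_atom fun i x hx => by
    have hSx : S.1 x ∈ N (i + 1) := S.2 _ x (hN.atom_le i.lt_succ_self hx)
    have h1 : S.1 x = (N i).starProjection (S.1 x) + (nestAtom N i).starProjection (S.1 x) := by
      rw [← hN.starProjection_succ, Submodule.starProjection_eq_self_iff.2 hSx]
    have h2 : (nestAtom N i).starProjection (T.1 ((N i).starProjection (S.1 x))) = 0 :=
      atom_starProjection_eq_zero (T.2 i _ (Submodule.starProjection_apply_mem _ _))
    have h3 : hN.diagPart (T.1 * S.1) x = hN.diagPart T.1 (hN.diagPart S.1 x) := by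
      rw [hN.diagPart_apply _ hx, hN.diagPart_apply _ (hN.diagPart_apply_mem _ hx),
        hN.diagPart_apply _ hx, mul_apply_eq_comp]
      nth_rewrite 1 [h1]
      rw [map_add, map_add, h2, zero_add]
    exact h3

theorem diagHom_diagHom (T : nestSubring N) : hN.diagHom (hN.diagHom T) = hN.diagHom T :=
  Subtype.ext <| hN.ext_atom fun i x hx => by
    have h1 : hN.diagPart (hN.diagPart T.1) x = hN.diagPart T.1 x := by
      rw [hN.diagPart_apply _ hx, Submodule.starProjection_eq_self_iff]
      exact hN.diagPart_apply_mem _ hx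
    exact h1

/-- A block diagonal part is bounded below as soon as the blocks are uniformly bounded below. -/
theorem le_norm_diagPart {a : H →L[ℂ] H} (ha : a ∈ seqNestAlg N) {c : ℝ} (hc : 0 < c)
    (hac : ∀ i, ∀ x ∈ N (i + 1),
      c * ‖x - (N i).starProjection x‖ ≤ ‖a x - (N i).starProjection (a x)‖) (x : H) :
    c * ‖x‖ ≤ ‖hN.diagPart a x‖ := by
  have hmem := hN.mem_seqNestAlg_of_atom fun _ _ => hN.diagPart_apply_mem a
  have hatom : ∀ i, ∀ x ∈ nestAtom N i, c * ‖x‖ ≤ ‖hN.diagPart a x‖ := fun i x hx => by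
    have hx' := hN.atom_le i.lt_succ_self hx
    have := hac i x hx'
    rwa [starProjection_atom hx, sub_zero, ← hN.atom_starProjection_eq (ha _ x hx'),
      ← hN.diagPart_apply a hx] at this
  have hpyth : ∀ i, ∀ y ∈ N i, ∀ z ∈ nestAtom N i, ‖y + z‖ ^ 2 = ‖y‖ ^ 2 + ‖z‖ ^ 2 :=
    fun i y hy z hz => by
      simpa [pow_two] using norm_add_sq_eq_norm_sq_add_norm_sq_of_inner_eq_zero y z (hz.2 y hy)
  have hm : ∀ m, ∀ x ∈ N m, c * ‖x‖ ≤ ‖hN.diagPart a x‖ := fun m => by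
    induction m with
    | zero =>
      intro x hx
      rw [hN.bot, Submodule.mem_bot] at hx
      simp [hx]
    | succ m ih =>
      intro x hx
      have hy : (N m).starProjection x ∈ N m := Submodule.starProjection_apply_mem _ _
      have hz : (nestAtom N m).starProjection x ∈ nestAtom N m :=
        Submodule.starProjection_apply_mem _ _
      rw [← Submodule.starProjection_eq_self_iff.2 hx, hN.starProjection_succ]
      refine abs_le_of_sq_le_sq' ?_ (norm_nonneg _) |>.2
      rw [map_add, mul_pow, hpyth m _ hy _ hz, hpyth m _ (hmem m _ hy) _
        (hN.diagPart_apply_mem a hz), mul_add, ← mul_pow, ← mul_pow]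
      gcongr
      · exact ih _ hy
      · exact hatom m _ hz
  have hcl : IsClosed {x : H | c * ‖x‖ ≤ ‖hN.diagPart a x‖} :=
    isClosed_le (by fun_prop) (by fun_prop)
  refine hcl.closure_subset_iff.2 (fun x hx => ?_) (hN.dense x)
  obtain ⟨m, hxm⟩ := Set.mem_iUnion.1 hx
  exact hm m x hxm

theorem exists_inverse_of_bounded_below {d : H →L[ℂ] H} (hd : d ∈ seqNestAlg N) {c : ℝ}
    (hc : 0 < c) (hdc : ∀ x, c * ‖x‖ ≤ ‖d x‖) : ∃ g : H →L[ℂ] H, d * g = 1 ∧ g * d = 1 := by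
  have hanti : AntilipschitzWith (Real.toNNReal c⁻¹) d :=
    d.antilipschitz_of_bound fun x => by
      rw [Real.coe_toNNReal _ (by positivity), inv_mul_eq_div, le_div_iff₀ hc, mul_comm]
      exact hdc x
  have hinj : Function.Injective d := hanti.injective
  have hclosed : IsClosed (Set.range d) := hanti.isClosed_range d.uniformContinuous
  have hsub : (⋃ m, (N m : Set H)) ⊆ Set.range d := by
    refine Set.iUnion_subset fun m v hv => ?_
    have hinj' : Function.Injective ((d : H →ₗ[ℂ] H).restrict (hd m)) := fun a b hab =>
      Subtype.ext (hinj (congrArg Subtype.val hab))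
    obtain ⟨w, hw⟩ := LinearMap.injective_iff_surjective.1 hinj' ⟨v, hv⟩
    exact ⟨w, congrArg Subtype.val hw⟩
  have hsurj : Function.Surjective d := fun x =>
    hclosed.closure_subset_iff.2 hsub (hN.dense x)
  set e := ContinuousLinearEquiv.ofBijective d (LinearMap.ker_eq_bot.2 hinj)
    (LinearMap.range_eq_top.2 hsurj) with he
  refine ⟨e.symm, ?_, ?_⟩
  · ext x
    exact e.apply_symm_apply x
  · ext x
    exact e.symm_apply_apply x

/-- Operators in the nest algebra can be perturbed so that their atomic diagonal blocks are
uniformly bounded below. -/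
theorem exists_perturbation {a : H →L[ℂ] H} (ha : a ∈ seqNestAlg N) {δ : ℝ} (hδ : 0 < δ) :
    ∃ a' ∈ seqNestAlg N, ‖a - a'‖ ≤ δ ∧ ∀ i, ∀ x ∈ N (i + 1),
      δ * ‖x - (N i).starProjection x‖ ≤ ‖a' x - (N i).starProjection (a' x)‖ := by
  choose u hu using fun i => LinearMap.exists_linearIsometry_re_inner_nonneg
    (((nestAtom N i).orthogonalProjectionOnto ∘L a ∘L (nestAtom N i).subtypeL :
      nestAtom N i →L[ℂ] nestAtom N i) : nestAtom N i →ₗ[ℂ] nestAtom N i)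
  obtain ⟨D, hD1, hD⟩ := hN.exists_blockDiagonal
    (fun i => (nestAtom N i).subtypeL ∘L (u i).toContinuousLinearMap ∘L
      (nestAtom N i).orthogonalProjectionOnto) zero_le_one fun i x => by
        rw [one_mul]
        exact ((u i).norm_map _).trans_le ((nestAtom N i).norm_orthogonalProjectionOnto_apply_le x)
  have hDu : ∀ i (y : nestAtom N i), D y = u i y := fun i y => by
    rw [hD i y y.2]
    simp
  have hDmem : D ∈ seqNestAlg N := hN.mem_seqNestAlg_of_atom fun i x hx => by
    rw [hDu i ⟨x, hx⟩]
    exact Subtype.property _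
  have ha' : a + (δ : ℂ) • D ∈ seqNestAlg N := fun m x hx =>
    (N m).add_mem (ha m x hx) ((N m).smul_mem _ (hDmem m x hx))
  refine ⟨a + (δ : ℂ) • D, ha', ?_, fun i x hx => ?_⟩
  · rw [sub_add_cancel_left, norm_neg, norm_smul, Complex.norm_real, Real.norm_of_nonneg hδ.le]
    nlinarith
  set a' := a + (δ : ℂ) • D with ha'def
  rw [← hN.atom_starProjection_eq hx, ← hN.atom_starProjection_eq (ha' _ x hx)]
  set y : nestAtom N i := (nestAtom N i).orthogonalProjectionOnto x with hy
  have hyx : (nestAtom N i).starProjection x = y := rfl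
  have h1 : (nestAtom N i).starProjection (a' x) = (nestAtom N i).starProjection (a' y) := by
    have hx' : x = (N i).starProjection x + y := by
      rw [← hyx, ← hN.starProjection_succ, Submodule.starProjection_eq_self_iff.2 hx]
    conv_lhs => rw [hx']
    rw [map_add, map_add, atom_starProjection_eq_zero
      (ha' i _ (Submodule.starProjection_apply_mem _ _)), zero_add]
  have h2 : (nestAtom N i).starProjection (a' y) =
      (((nestAtom N i).orthogonalProjectionOnto (a y) + (δ : ℂ) • u i y : nestAtom N i) : H) := by
    have : a' y = a y + (δ : ℂ) • ((u i y : nestAtom N i) : H) := by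
      rw [← hDu]; rfl
    rw [this, map_add, map_smul, Submodule.starProjection_eq_self_iff.2 (u i y).2]
    rfl
  rw [h1, h2, hyx]
  set w : nestAtom N i := (nestAtom N i).orthogonalProjectionOnto (a y) + (δ : ℂ) • u i y with hw
  have h3 : δ * ‖y‖ ^ 2 ≤ (inner ℂ (u i y) w).re := by
    rw [hw, inner_add_right, inner_smul_right, inner_self_eq_norm_sq_to_K, Complex.add_re,
      (u i).norm_map]
    have h4 : 0 ≤ (inner ℂ (u i y) ((nestAtom N i).orthogonalProjectionOnto (a y))).re := hu i y
    have h5 : ((δ : ℂ) * ((‖y‖ : ℂ)) ^ 2).re = δ * ‖y‖ ^ 2 := by norm_cast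
    have h6 : ((δ : ℂ) * ((RCLike.ofReal ‖y‖ : ℂ)) ^ 2).re = δ * ‖y‖ ^ 2 := h5
    linarith
  have h4 : (inner ℂ (u i y) w).re ≤ ‖y‖ * ‖w‖ := by
    rw [← (u i).norm_map y]
    exact re_inner_le_norm (𝕜 := ℂ) (u i y) w
  change δ * ‖y‖ ≤ ‖w‖
  rcases (norm_nonneg y).eq_or_lt with h0 | h0
  · rw [← h0, mul_zero]
    exact norm_nonneg _
  · refine le_of_mul_le_mul_left ?_ h0
    nlinarith

omit [CompleteSpace H] in
/-- Lower bounds on the atomic diagonal blocks give a lower bound on the diagonal blocks over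
`p` consecutive atoms. -/
theorem exists_lower_bound {a : H →L[ℂ] H} {δ : ℝ} (hδ : 0 < δ)
    (haδ : ∀ i, ∀ x ∈ N (i + 1),
      δ * ‖x - (N i).starProjection x‖ ≤ ‖a x - (N i).starProjection (a x)‖) (p : ℕ) :
    ∃ c > 0, ∀ m, ∀ x ∈ N (m + p),
      c * ‖x - (N m).starProjection x‖ ≤ ‖a x - (N m).starProjection (a x)‖ := by
  induction p with
  | zero =>
    refine ⟨1, one_pos, fun m x hx => ?_⟩
    have hx' : (N m).starProjection x = x := Submodule.starProjection_eq_self_iff.2 hx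
    simp [hx']
  | succ p ih =>
    obtain ⟨c, hc, hac⟩ := ih
    refine ⟨c / (1 + (c + ‖a‖) / δ), by positivity, fun m x hx => ?_⟩
    set P := (N m).starProjection with hP
    set y := (N (m + p)).starProjection x with hy
    have hym : y ∈ N (m + p) := Submodule.starProjection_apply_mem _ _
    have hle : N m ≤ N (m + p) := hN.strictMono.monotone (Nat.le_add_right m p)
    set t := ‖a x - P (a x)‖ with ht
    have h1 : δ * ‖x - y‖ ≤ t := (haδ (m + p) x hx).trans
      (Submodule.norm_sub_starProjection_le _ _ (hle (Submodule.starProjection_apply_mem _ _)))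
    have h2 : c * ‖y - P y‖ ≤ ‖a y - P (a y)‖ := hac m y hym
    have h3 : ‖a y - P (a y)‖ ≤ t + ‖a‖ * ‖x - y‖ := by
      have h4 : ‖a y - P (a y)‖ ≤ ‖a y - P (a x)‖ :=
        Submodule.norm_sub_starProjection_le _ _ (Submodule.starProjection_apply_mem _ _)
      have h5 : a y - P (a x) = (a x - P (a x)) - a (x - y) := by rw [map_sub]; abel
      have h6 := norm_sub_le (a x - P (a x)) (a (x - y))
      rw [← h5] at h6
      linarith [a.le_opNorm (x - y)]
    have h4 : ‖x - P x‖ ≤ ‖x - y‖ + ‖y - P y‖ := by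
      have h5 : ‖x - P x‖ ≤ ‖x - P y‖ :=
        Submodule.norm_sub_starProjection_le _ _ (Submodule.starProjection_apply_mem _ _)
      exact h5.trans (norm_sub_le_norm_sub_add_norm_sub _ _ _)
    have h5 : ‖x - y‖ ≤ t / δ := by rwa [le_div_iff₀ hδ, mul_comm]
    rw [div_mul_eq_mul_div, div_le_iff₀ (by positivity)]
    calc c * ‖x - P x‖ ≤ c * (‖x - y‖ + ‖y - P y‖) := by gcongr
      _ ≤ t + (c + ‖a‖) * ‖x - y‖ := by linarith
      _ ≤ t + (c + ‖a‖) * (t / δ) := by gcongr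
      _ = t * (1 + (c + ‖a‖) / δ) := by ring

end IsOmegaNest

namespace IsOmegaNest

variable {k : ℕ → ℕ}

theorem exists_between (hk : StrictMono k) (hk0 : k 0 = 0) (m : ℕ) :
    ∃ i, k i ≤ m ∧ m ≤ k (i + 1) := by
  induction m with
  | zero => exact ⟨0, hk0.le, Nat.zero_le _⟩
  | succ m ih =>
    obtain ⟨i, h1, h2⟩ := ih
    rcases h2.lt_or_eq with h | h
    · exact ⟨i, by omega, h⟩
    · have := hk (Nat.lt_add_one (i + 1))
      exact ⟨i + 1, by omega, by omega⟩

variable [CompleteSpace H] (hN : IsOmegaNest N) (hM : IsOmegaNest fun i => N (k i))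
include hN

theorem diagHom_mem_iff (hk : StrictMono k) (hk0 : k 0 = 0)
    (x : nestSubring fun i => N (k i)) :
    x.1 ∈ nestSubring N ↔ (hM.diagHom x).1 ∈ nestSubring N := by
  have key : ∀ (T : nestSubring fun i => N (k i)) (i m : ℕ), k i ≤ m → m ≤ k (i + 1) →
      ∀ v ∈ N m, (T.1 v ∈ N m ↔
        hM.diagPart T.1 ((nestAtom (fun i => N (k i)) i).starProjection v) ∈ N m) := by
    intro T i m h1 h2 v hv
    have hle1 : N (k i) ≤ N m := hN.strictMono.monotone h1
    have hle2 : N m ≤ N (k (i + 1)) := hN.strictMono.monotone h2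
    have hw : (nestAtom (fun i => N (k i)) i).starProjection v ∈
      nestAtom (fun i => N (k i)) i := Submodule.starProjection_apply_mem _ _
    set w := (nestAtom (fun i => N (k i)) i).starProjection v with hwdef
    have hv' : v = (N (k i)).starProjection v + w := by
      rw [hwdef, ← hM.starProjection_succ i, Submodule.starProjection_eq_self_iff.2 (hle2 hv)]
    have hTw : T.1 w ∈ N (k (i + 1)) := T.2 (i + 1) _ hw.1
    have hTw' : T.1 w = (N (k i)).starProjection (T.1 w) + hM.diagPart T.1 w := by
      rw [hM.diagPart_apply _ hw, ← hM.starProjection_succ i,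
        Submodule.starProjection_eq_self_iff.2 hTw]
    conv_lhs => rw [hv', map_add, hTw']
    rw [Submodule.add_mem_iff_right _
        (hle1 (T.2 i _ (Submodule.starProjection_apply_mem _ _))),
      Submodule.add_mem_iff_right _ (hle1 (Submodule.starProjection_apply_mem _ _))]
  have hΔ : ∀ v, hM.diagPart (hM.diagHom x).1 v = hM.diagPart x.1 v := fun v =>
    congrArg (fun T : nestSubring fun i => N (k i) => T.1 v) (hM.diagHom_diagHom x)
  refine forall_congr' fun m => forall₂_congr fun v hv => ?_
  obtain ⟨i, h1, h2⟩ := exists_between hk hk0 m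
  rw [key x i m h1 h2 v hv, key (hM.diagHom x) i m h1 h2 v hv, hΔ]

theorem hasInvertiblePerturbations (hk : StrictMono k) (hk0 : k 0 = 0) {l : ℕ}
    (hl : ∀ i, k (i + 1) - k i ≤ l) :
    HasInvertiblePerturbations hM.diagHom
      ((nestSubring N).comap (nestSubring fun i => N (k i)).subtype : Set _) := by
  intro a ha ε hε
  obtain ⟨a', ha', haa', hlow⟩ := hN.exists_perturbation (a := a.1) ha (half_pos hε)
  obtain ⟨c, hc, hac⟩ := hN.exists_lower_bound (half_pos hε) hlow l
  set b : nestSubring fun i => N (k i) := ⟨a', nestSubring_le_comp k ha'⟩ with hb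
  have hbd : ∀ x, c * ‖x‖ ≤ ‖(hM.diagHom b).1 x‖ := hM.le_norm_diagPart b.2 hc
    fun i x hx => hac (k i) x (hN.strictMono.monotone (by have := hl i; omega) hx)
  obtain ⟨g, hdg, hgd⟩ := hM.exists_inverse_of_bounded_below (hM.diagHom b).2 hc hbd
  have hgN : g ∈ nestSubring N :=
    mem_seqNestAlg_of_mul_eq_one ((hN.diagHom_mem_iff hM hk hk0 b).1 ha') hgd
  set g' : nestSubring fun i => N (k i) := ⟨g, nestSubring_le_comp k hgN⟩
  have hdg' : hM.diagHom b * g' = 1 := Subtype.ext hdg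
  have hgd' : g' * hM.diagHom b = 1 := Subtype.ext hgd
  refine ⟨b, ha', ?_, g', hgN, ?_, hdg', hgd'⟩
  · exact lt_of_le_of_lt haa' (half_lt_self hε)
  · have h1 : hM.diagHom g' * hM.diagHom b = 1 := by
      have := congrArg hM.diagHom hgd'
      rwa [map_mul, hM.diagHom_diagHom, map_one] at this
    exact left_inv_eq_right_inv h1 hdg'

end IsOmegaNest

end NestAlgebra

/-- **Corollary (finite index subnests).**  Let `𝒩` be a nest of order type `ω`
with finite-rank atoms, and let `𝓜 = {N_{k(i)}}` be a subnest of finite index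
(`k` strictly increasing, `k 0 = 0`, gaps bounded by `l`).  Then for every
`n ≥ 1`, `Rg_n(T(𝓜))` is dense in `T(𝓜)^n` iff `Rg_n(T(𝒩))` is dense in
`T(𝒩)^n`; hence `rtsr(T(𝓜)) = rtsr(T(𝒩))`. -/
theorem rtsr_finite_index_subnest
    {H : Type*} [NormedAddCommGroup H] [InnerProductSpace ℂ H]
    [CompleteSpace H] [TopologicalSpace.SeparableSpace H]
    (hinf : ¬ FiniteDimensional ℂ H)
    {N : ℕ → Submodule ℂ H} (hN : IsOmegaNest N)
    (k : ℕ → ℕ) (hk : StrictMono k) (hk0 : k 0 = 0)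
    (l : ℕ) (hl : ∀ i, k (i + 1) - k i ≤ l)
    (n : ℕ) (hn : 1 ≤ n) :
    RgDenseIn (seqNestAlg fun i => N (k i)) n ↔ RgDenseIn (seqNestAlg N) n := by
  have := hN.finiteDim
  have hM := hN.comp hk hk0
  have : CompleteSpace (nestSubring fun i => N (k i)) :=
    (isClosed_nestSubring (N := fun i => N (k i))).completeSpace_coe
  have hT := hN.diagHom_mem_iff hM hk hk0
  have hunivcomap : ((nestSubring fun i => N (k i)).comap
      (nestSubring fun i => N (k i)).subtype : Set (nestSubring fun i => N (k i))) = Set.univ :=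
    Set.eq_univ_of_forall fun x => x.2
  have huniv : RgDenseIn (Set.univ : Set (nestSubring fun i => N (k i))) n ↔
      RgDenseIn (seqNestAlg fun i => N (k i)) n := by
    rw [← hunivcomap]
    exact rgDenseIn_comap_subtype_iff le_rfl n
  have hsub : RgDenseIn ((nestSubring N).comap (nestSubring fun i => N (k i)).subtype :
      Set (nestSubring fun i => N (k i))) n ↔ RgDenseIn (seqNestAlg N) n :=
    rgDenseIn_comap_subtype_iff (T := nestSubring N) (nestSubring_le_comp k) n
  rw [← huniv, ← hsub]
  constructor
  · exact RgDenseIn.subring_of_univ hT hM.diagHom_diagHom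
      (fun x => hM.norm_diagPart_le x.1) (hN.hasInvertiblePerturbations hM hk hk0 hl) hn
  · refine RgDenseIn.univ_of_subring hT hM.diagHom_diagHom ?_ hn
    rw [← hunivcomap]
    exact hM.hasInvertiblePerturbations (k := id) hM strictMono_id rfl (l := 1)
      fun i => by simp
end

section
/- Let (N_k)_{k≥0} give a nest 𝒩 of order type ω with finite-rank atoms on an infinite-dimensional separable complex Hilbert space H, and let k : ℕ → ℕ be any strictly increasing sequence, determining the infinite subnest 𝓜 with nest algebra T(𝓜) = {T ∈ B(H) : T(N_{k(i)}) ⊆ N_{k(i)} for all i ≥ 0}. Then for every n ≥ 1, if Rg_n(T(𝒩)) is dense in T(𝒩)^n, then Rg_n(T(𝓜)) is dense in T(𝓜)^n; that is, rtsr(T(𝓜)) ≤ rtsr(T(𝒩)). -/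
open Module Submodule

/-- Between two nested finite-dimensional subspaces there is one of every intermediate dimension. -/
theorem Submodule.exists_le_le_finrank_eq {𝕜 V : Type*} [DivisionRing 𝕜] [AddCommGroup V]
    [Module 𝕜 V] {L P : Submodule 𝕜 V} [FiniteDimensional 𝕜 P] (hLP : L ≤ P) {d : ℕ}
    (hLd : finrank 𝕜 L ≤ d) (hdP : d ≤ finrank 𝕜 P) :
    ∃ L' : Submodule 𝕜 V, L ≤ L' ∧ L' ≤ P ∧ finrank 𝕜 L' = d := by
  induction d, hLd using Nat.le_induction with
  | base => exact ⟨L, le_rfl, hLP, rfl⟩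
  | succ d hd ih =>
    obtain ⟨L', hL, hP, hL'⟩ := ih (by omega)
    have : FiniteDimensional 𝕜 L' := finiteDimensional_of_le hP
    have hnot : ¬ P ≤ L' := fun hle => by
      have := Submodule.finrank_mono hle
      omega
    obtain ⟨x, hxP, hxL⟩ := SetLike.not_le_iff_exists.1 hnot
    refine ⟨L' ⊔ span 𝕜 {x}, hL.trans le_sup_left,
      sup_le hP ((span_singleton_le_iff_mem _ _).2 hxP), ?_⟩
    have hx0 : x ≠ 0 := fun h0 => hxL (h0 ▸ L'.zero_mem)
    have hdisj : Disjoint L' (span 𝕜 {x}) := (disjoint_span_singleton' hx0).2 hxL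
    have hsum := Submodule.finrank_sup_add_finrank_inf_eq L' (span 𝕜 {x})
    rw [hdisj.eq_bot, finrank_bot, finrank_span_singleton hx0] at hsum
    omega

/-- An increasing sequence of finite-dimensional subspaces contains an increasing sequence of
subspaces with any prescribed increasing sequence of smaller dimensions. -/
theorem Submodule.exists_monotone_le_finrank_eq {𝕜 V : Type*} [DivisionRing 𝕜] [AddCommGroup V]
    [Module 𝕜 V] {P : ℕ → Submodule 𝕜 V} (hfin : ∀ k, FiniteDimensional 𝕜 (P k))
    (hP : Monotone P) {d : ℕ → ℕ} (hd : Monotone d) (hdP : ∀ k, d k ≤ finrank 𝕜 (P k)) :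
    ∃ L : ℕ → Submodule 𝕜 V, Monotone L ∧ (∀ k, L k ≤ P k) ∧ ∀ k, finrank 𝕜 (L k) = d k := by
  have step : ∀ k (L : {L : Submodule 𝕜 V // L ≤ P k ∧ finrank 𝕜 L = d k}),
      ∃ L' : {L : Submodule 𝕜 V // L ≤ P (k + 1) ∧ finrank 𝕜 L = d (k + 1)}, L.1 ≤ L'.1 := by
    rintro k ⟨L, hL, hLd⟩
    obtain ⟨L', h1, h2, h3⟩ := exists_le_le_finrank_eq (hL.trans (hP k.le_succ))
      (hLd.trans_le (hd k.le_succ)) (hdP (k + 1))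
    exact ⟨⟨L', h2, h3⟩, h1⟩
  choose f hf using step
  obtain ⟨L₀, -, h2, h3⟩ := exists_le_le_finrank_eq (bot_le : ⊥ ≤ P 0)
    (by simp : finrank 𝕜 (⊥ : Submodule 𝕜 V) ≤ d 0) (hdP 0)
  let L : ∀ k, {L : Submodule 𝕜 V // L ≤ P k ∧ finrank 𝕜 L = d k} :=
    fun k => Nat.rec ⟨L₀, h2, h3⟩ f k
  exact ⟨fun k => (L k).1, monotone_nat_of_le_succ fun k => hf k (L k), fun k => (L k).2.1,
    fun k => (L k).2.2⟩

/-- A linear map from `A` into `M` pulls `S ≤ M` back to a subspace of codimension at most that of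
`S` in `M`. -/
theorem Submodule.finrank_add_finrank_le_finrank_inf_comap {𝕜 V W : Type*} [DivisionRing 𝕜]
    [AddCommGroup V] [Module 𝕜 V] [AddCommGroup W] [Module 𝕜 W] {A : Submodule 𝕜 V}
    {S M : Submodule 𝕜 W} [FiniteDimensional 𝕜 A] [FiniteDimensional 𝕜 M] (hSM : S ≤ M)
    (f : V →ₗ[𝕜] W) (hf : ∀ x ∈ A, f x ∈ M) :
    finrank 𝕜 A + finrank 𝕜 S ≤ finrank 𝕜 (A ⊓ S.comap f : Submodule 𝕜 V) + finrank 𝕜 M := by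
  let q : A →ₗ[𝕜] M ⧸ S.comap M.subtype := (S.comap M.subtype).mkQ ∘ₗ f.restrict hf
  have hrank := q.finrank_range_add_finrank_ker
  have hquot := (S.comap M.subtype).finrank_quotient_add_finrank
  have hrange : finrank 𝕜 q.range ≤ finrank 𝕜 (M ⧸ S.comap M.subtype) :=
    Submodule.finrank_le _
  have hS : finrank 𝕜 (S.comap M.subtype) = finrank 𝕜 S :=
    (Submodule.comapSubtypeEquivOfLe hSM).finrank_eq
  have hmem : ∀ x : A, x ∈ q.ker ↔ f x ∈ S := fun x => by
    simp only [q, LinearMap.mem_ker, LinearMap.comp_apply, mkQ_apply, Quotient.mk_eq_zero]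
    rfl
  have hker : q.ker.map A.subtype = A ⊓ S.comap f := by
    ext x
    constructor
    · rintro ⟨y, hy, rfl⟩
      exact ⟨y.2, (hmem y).1 hy⟩
    · rintro ⟨hx, hxS⟩
      exact ⟨⟨x, hx⟩, (hmem _).2 hxS, rfl⟩
  have hkerrank : finrank 𝕜 q.ker = finrank 𝕜 (A ⊓ S.comap f : Submodule 𝕜 V) := by
    rw [← hker]
    exact (Submodule.equivMapOfInjective _ (subtype_injective _) _).finrank_eq
  omega

section Unitary

variable {K : Type*} [NormedAddCommGroup K] [InnerProductSpace ℂ K] [CompleteSpace K]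

/-- A Hilbert basis adapted to an increasing sequence of finite-dimensional subspaces with dense
union, indexed by the atoms of the sequence. -/
theorem exists_hilbertBasis_adapted {E : ℕ → Submodule ℂ K}
    (hfin : ∀ k, FiniteDimensional ℂ (E k)) (hE : Monotone E) (h0 : E 0 = ⊥)
    (hdense : (⨆ k, E k)ᗮ = ⊥) {g : ℕ → ℕ}
    (hg : ∀ k, finrank ℂ (E k) + g k = finrank ℂ (E (k + 1))) :
    ∃ b : HilbertBasis (Σ k, Fin (g k)) ℂ K, ∀ k, E k = span ℂ (b '' {s | s.1 < k}) := by
  let G : ℕ → Submodule ℂ K := fun k => (E k)ᗮ ⊓ E (k + 1)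
  have hG : ∀ k, finrank ℂ (G k) = g k := fun k =>
    finrank_add_inf_finrank_orthogonal' (hE k.le_succ) (hg k)
  have hGfin : ∀ k, FiniteDimensional ℂ (G k) := fun k =>
    finiteDimensional_of_le (inf_le_right : G k ≤ E (k + 1))
  have hlt : ∀ i j, i < j → G i ⟂ G j := fun i j hij =>
    (Submodule.isOrtho_orthogonal_right (E j)).mono
      (inf_le_right.trans (hE hij)) inf_le_left
  have hfam : OrthogonalFamily ℂ (fun k => G k) fun k => (G k).subtypeₗᵢ := by
    refine OrthogonalFamily.of_pairwise fun i j hij => ?_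
    rcases lt_or_gt_of_ne hij with h | h
    exacts [hlt i j h, (hlt j i h).symm]
  let v : ∀ k, OrthonormalBasis (Fin (g k)) ℂ (G k) := fun k =>
    (stdOrthonormalBasis ℂ (G k)).reindex (finCongr (hG k))
  let w : (Σ k, Fin (g k)) → K := fun a => (v a.1 a.2 : K)
  have hw : Orthonormal ℂ w :=
    hfam.orthonormal_sigma_orthonormal fun k => (v k).orthonormal
  have hspanG : ∀ k, G k = span ℂ (w '' {s | s.1 = k}) := fun k => by
    have h1 : span ℂ (Set.range (v k)) = ⊤ := by
      simpa using (v k).toBasis.span_eq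
    have h2 := congrArg (Submodule.map (G k).subtype) h1
    rw [Submodule.map_top, Submodule.range_subtype, Submodule.map_span, ← Set.range_comp] at h2
    rw [← h2]
    congr 1
    ext x
    constructor
    · rintro ⟨i, rfl⟩
      exact ⟨⟨k, i⟩, rfl, rfl⟩
    · rintro ⟨⟨_, i⟩, rfl, rfl⟩
      exact ⟨i, rfl⟩
  have hspan : ∀ k, E k = span ℂ (w '' {s | s.1 < k}) := fun k => by
    induction k with
    | zero => simp [h0]
    | succ k ih =>
      have : {s : Σ k, Fin (g k) | s.1 < k + 1} = {s | s.1 < k} ∪ {s | s.1 = k} := by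
        ext s
        simp only [Set.mem_ofPred_eq, Set.mem_union]
        omega
      rw [this, Set.image_union, span_union, ← ih, ← hspanG]
      exact (sup_orthogonal_inf_of_hasOrthogonalProjection (hE k.le_succ)).symm
  have hbot : (span ℂ (Set.range w))ᗮ = ⊥ := by
    rw [eq_bot_iff, ← hdense]
    refine orthogonal_le (iSup_le fun k => ?_)
    rw [hspan k]
    exact span_mono (Set.image_subset_range _ _)
  refine ⟨HilbertBasis.mkOfOrthogonalEqBot hw hbot, fun k => ?_⟩
  rw [HilbertBasis.coe_mkOfOrthogonalEqBot]
  exact hspan k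

/-- Two increasing sequences of finite-dimensional subspaces with dense unions and the same
dimensions are unitarily equivalent. -/
theorem exists_linearIsometryEquiv_map_eq {E F : ℕ → Submodule ℂ K}
    (hEfin : ∀ k, FiniteDimensional ℂ (E k)) (hFfin : ∀ k, FiniteDimensional ℂ (F k))
    (hE : Monotone E) (hF : Monotone F) (hE0 : E 0 = ⊥)
    (hEd : (⨆ k, E k)ᗮ = ⊥) (hFd : (⨆ k, F k)ᗮ = ⊥)
    (hEF : ∀ k, finrank ℂ (F k) = finrank ℂ (E k)) :
    ∃ U : K ≃ₗᵢ[ℂ] K, ∀ k x, x ∈ E k ↔ U x ∈ F k := by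
  have hF0 : F 0 = ⊥ := by
    rw [← Submodule.finrank_eq_zero (R := ℂ), hEF, hE0, finrank_bot]
  have hg : ∀ k, finrank ℂ (E k) + (finrank ℂ (E (k + 1)) - finrank ℂ (E k)) =
      finrank ℂ (E (k + 1)) := fun k =>
    Nat.add_sub_cancel' (Submodule.finrank_mono (hE k.le_succ))
  obtain ⟨b, hb⟩ := exists_hilbertBasis_adapted hEfin hE hE0 hEd hg
  obtain ⟨c, hc⟩ := exists_hilbertBasis_adapted hFfin hF hF0 hFd
    (by simpa only [hEF] using hg)
  let U : K ≃ₗᵢ[ℂ] K := b.repr.trans c.repr.symm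
  have hU : ∀ s, U (b s) = c s := fun s => by
    simp [U, b.repr_self, c.repr_symm_single]
  have hmap : ∀ k, (E k).map U.toLinearEquiv.toLinearMap = F k := fun k => by
    rw [hb, hc, Submodule.map_span, Set.image_image]
    congr 1
    exact Set.image_congr fun s _ => hU s
  refine ⟨U, fun k x => ?_⟩
  rw [← hmap k]
  refine ⟨Submodule.mem_map_of_mem, ?_⟩
  rintro ⟨y, hy, hyx⟩
  rwa [← U.injective hyx]

end Unitary

section Amplification

variable {H : Type*} [NormedAddCommGroup H] [InnerProductSpace ℂ H]

/-- The `n`-fold orthogonal direct sum `S ⊕ ⋯ ⊕ S` of a subspace `S`. -/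
def Submodule.ampliation (n : ℕ) (S : Submodule ℂ H) :
    Submodule ℂ (PiLp 2 fun _ : Fin n => H) where
  carrier := {x | ∀ i, x i ∈ S}
  add_mem' hx hy i := S.add_mem (hx i) (hy i)
  zero_mem' _ := S.zero_mem
  smul_mem' c _ hx i := S.smul_mem c (hx i)

theorem Submodule.mem_ampliation {n : ℕ} {S : Submodule ℂ H} {x : PiLp 2 fun _ : Fin n => H} :
    x ∈ S.ampliation n ↔ ∀ i, x i ∈ S := Iff.rfl

theorem Submodule.ampliation_mono (n : ℕ) : Monotone (ampliation (H := H) n) :=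
  fun _ _ h _ hx i => h (hx i)

/-- The direct sum of `n` copies of `S`, as a space of functions. -/
def Submodule.ampliationEquiv (n : ℕ) (S : Submodule ℂ H) :
    S.ampliation n ≃ₗ[ℂ] (Fin n → S) where
  toFun x i := ⟨x.1 i, x.2 i⟩
  invFun f := ⟨WithLp.toLp 2 fun i => (f i : H), fun i => (f i).2⟩
  left_inv _ := rfl
  right_inv _ := rfl
  map_add' _ _ := rfl
  map_smul' _ _ := rfl

theorem Submodule.finrank_ampliation (n : ℕ) (S : Submodule ℂ H) [FiniteDimensional ℂ S] :
    finrank ℂ (S.ampliation n) = n * finrank ℂ S := by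
  rw [(S.ampliationEquiv n).finrank_eq, finrank_pi_fintype]
  simp

instance (n : ℕ) (S : Submodule ℂ H) [FiniteDimensional ℂ S] :
    FiniteDimensional ℂ (S.ampliation n) :=
  Module.Finite.equiv (S.ampliationEquiv n).symm

/-- The inclusion of `H` as the `i`-th summand of the direct sum of `n` copies of `H`. -/
noncomputable def inclCLM (n : ℕ) (i : Fin n) : H →L[ℂ] PiLp 2 fun _ : Fin n => H :=
  LinearMap.mkContinuous
    { toFun := fun x => PiLp.single 2 i x
      map_add' := fun _ _ => PiLp.single_add ..
      map_smul' := fun c x => by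
        ext j
        by_cases h : j = i
        · subst h; simp
        · simp [h] } 1
    fun x => by simp

theorem inclCLM_apply {n : ℕ} (i : Fin n) (x : H) : inclCLM n i x = PiLp.single 2 i x := rfl

theorem norm_inclCLM_le {n : ℕ} (i : Fin n) : ‖inclCLM (H := H) n i‖ ≤ 1 :=
  LinearMap.mkContinuous_norm_le _ zero_le_one _

theorem sum_inclCLM_proj {n : ℕ} (x : PiLp 2 fun _ : Fin n => H) :
    ∑ i, inclCLM n i (x i) = x := by
  ext j
  simp only [inclCLM_apply, WithLp.ofLp_sum, Finset.sum_apply]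
  rw [Finset.sum_eq_single j]
  · simp
  · intro i _ hi
    simp [hi.symm]
  · simp

theorem inclCLM_mem {n : ℕ} {S : Submodule ℂ H} (i : Fin n) {x : H} (hx : x ∈ S) :
    inclCLM n i x ∈ S.ampliation n := by
  intro j
  rw [inclCLM_apply]
  by_cases h : j = i
  · subst h; simpa using hx
  · simp [h]

theorem iSup_ampliation_orthogonal [CompleteSpace H] {n : ℕ} {M : ℕ → Submodule ℂ H}
    (hM : (⨆ k, M k)ᗮ = ⊥) : (⨆ k, (M k).ampliation n)ᗮ = ⊥ := by
  rw [eq_bot_iff]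
  intro x hx
  rw [mem_bot]
  ext i
  have : x i ∈ (⨆ k, M k)ᗮ := by
    rw [← iInf_orthogonal, mem_iInf] at hx ⊢
    intro k y hy
    have := hx k _ (inclCLM_mem i hy)
    rw [PiLp.inner_apply, Finset.sum_eq_single i] at this
    · simpa [inclCLM_apply] using this
    · intro j _ hj
      simp [inclCLM_apply, hj]
    · simp
  rw [hM, mem_bot] at this
  simpa using this

/-- The row operator `x ↦ ∑ i, a i (x i)`. -/
noncomputable def rowCLM {n : ℕ} (a : Fin n → H →L[ℂ] H) : (PiLp 2 fun _ : Fin n => H) →L[ℂ] H :=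
  ∑ i, (a i).comp (PiLp.proj 2 (fun _ : Fin n => H) i)

theorem rowCLM_apply {n : ℕ} (a : Fin n → H →L[ℂ] H) (x : PiLp 2 fun _ : Fin n => H) :
    rowCLM a x = ∑ i, a i (x i) := by
  simp [rowCLM]

theorem rowCLM_mem {n : ℕ} {a : Fin n → H →L[ℂ] H} {S : Submodule ℂ H}
    (ha : ∀ i, ∀ x ∈ S, a i x ∈ S) {x : PiLp 2 fun _ : Fin n => H} (hx : x ∈ S.ampliation n) :
    rowCLM a x ∈ S := by
  rw [rowCLM_apply]
  exact S.sum_mem fun i _ => ha i _ (hx i)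

theorem norm_rowCLM_le {n : ℕ} (a : Fin n → H →L[ℂ] H) : ‖rowCLM a‖ ≤ ∑ i, ‖a i‖ := by
  refine ContinuousLinearMap.opNorm_le_bound _ (Finset.sum_nonneg fun i _ => norm_nonneg (a i))
    fun x => ?_
  rw [rowCLM_apply, Finset.sum_mul]
  exact norm_sum_le_of_le _ fun i _ =>
    (a i).le_opNorm_of_le (PiLp.norm_apply_le x i)

theorem rowCLM_inclCLM {n : ℕ} (a : Fin n → H →L[ℂ] H) (i : Fin n) (x : H) :
    rowCLM a (inclCLM n i x) = a i x := by
  rw [rowCLM_apply, Finset.sum_eq_single i]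
  · simp [inclCLM_apply]
  · intro j _ hj
    simp [inclCLM_apply, hj]
  · simp

/-- If `f` maps the direct sum of `n ≥ 1` copies of `M` into `M`, the preimage of `S ≤ M` has at
least the dimension of the direct sum of `n` copies of `S`. -/
theorem le_finrank_ampliation_inf_comap {n : ℕ} (hn : 1 ≤ n) {S M : Submodule ℂ H}
    [FiniteDimensional ℂ M] (hSM : S ≤ M) (f : (PiLp 2 fun _ : Fin n => H) →ₗ[ℂ] H)
    (hf : ∀ x ∈ M.ampliation n, f x ∈ M) :
    n * finrank ℂ S ≤ finrank ℂ (M.ampliation n ⊓ S.comap f : Submodule ℂ _) := by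
  have hrank := finrank_add_finrank_le_finrank_inf_comap hSM f hf
  rw [finrank_ampliation] at hrank
  have hle : finrank ℂ S ≤ finrank ℂ M := Submodule.finrank_mono hSM
  have harith : ∀ s m p : ℕ, s ≤ m → n * m + s ≤ p + m → n * s ≤ p := fun s m p hsm hp => by
    nlinarith
  exact harith _ _ _ hle hrank

/-- A row of operators in the nest algebra of a subnest is brought into the larger nest's algebra
by a unitary which is block diagonal for the subnest. -/
theorem exists_unitary_rowCLM_mem [CompleteSpace H] {N : ℕ → Submodule ℂ H} (hN : IsOmegaNest N)
    {k : ℕ → ℕ} (hk : StrictMono k) {n : ℕ} (hn : 1 ≤ n) {a : Fin n → H →L[ℂ] H}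
    (ha : ∀ i, a i ∈ seqNestAlg fun i => N (k i)) :
    ∃ U : (PiLp 2 fun _ : Fin n => H) ≃ₗᵢ[ℂ] (PiLp 2 fun _ : Fin n => H),
      (∀ j, ∀ x ∈ (N j).ampliation n, rowCLM a (U x) ∈ N j) ∧
      ∀ i x, x ∈ (N (k i)).ampliation n ↔ U x ∈ (N (k i)).ampliation n := by
  have hfin := hN.finiteDim
  have hmono := hN.strictMono.monotone
  have hex : ∀ j, ∃ i, j ≤ k i := fun j => ⟨j, hk.le_apply⟩
  classical
  let m : ℕ → ℕ := fun j => Nat.find (hex j)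
  have hm : ∀ j, j ≤ k (m j) := fun j => Nat.find_spec (hex j)
  have hm_mono : Monotone m := fun j l hjl => Nat.find_min' (hex j) (hjl.trans (hm l))
  have hmk : ∀ i, m (k i) = i := fun i =>
    le_antisymm (Nat.find_min' (hex (k i)) le_rfl) (hk.le_iff_le.1 (hm (k i)))
  let P : ℕ → Submodule ℂ (PiLp 2 fun _ : Fin n => H) := fun j =>
    (N (k (m j))).ampliation n ⊓ (N j).comap (rowCLM a).toLinearMap
  have hPfin : ∀ j, FiniteDimensional ℂ (P j) := fun j =>
    finiteDimensional_of_le (inf_le_left : P j ≤ (N (k (m j))).ampliation n)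
  have hPmono : Monotone P := fun j l hjl =>
    inf_le_inf (ampliation_mono n (hmono (hk.monotone (hm_mono hjl))))
      (comap_mono (hmono hjl))
  obtain ⟨L, hL, hLP, hLd⟩ := exists_monotone_le_finrank_eq hPfin hPmono
    (d := fun j => n * finrank ℂ (N j))
    (fun j l hjl => Nat.mul_le_mul_left n (Submodule.finrank_mono (hmono hjl)))
    (fun j => le_finrank_ampliation_inf_comap hn (hmono (hm j)) _
      fun x hx => rowCLM_mem (fun i y hy => ha i (m j) y hy) hx)
  have hLk : ∀ i, L (k i) = (N (k i)).ampliation n := fun i => by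
    refine Submodule.eq_of_le_of_finrank_eq ?_ (by rw [hLd, finrank_ampliation])
    have := (hLP (k i)).trans inf_le_left
    rwa [hmk] at this
  have hNd : (⨆ j, N j)ᗮ = ⊥ := by
    rw [← topologicalClosure_eq_top_iff, ← dense_iff_topologicalClosure_eq_top,
      coe_iSup_of_directed N hmono.directed_le]
    exact hN.dense
  have hle : (⨆ j, (N j).ampliation n) ≤ ⨆ j, L j := iSup_le fun j =>
    (ampliation_mono n (hmono hk.le_apply)).trans ((hLk j).ge.trans (le_iSup L (k j)))
  have hEd := iSup_ampliation_orthogonal (n := n) hNd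
  obtain ⟨U, hU⟩ := exists_linearIsometryEquiv_map_eq (E := fun j => (N j).ampliation n) (F := L)
    (fun j => inferInstance) (fun j => finiteDimensional_of_le (hLP j))
    ((ampliation_mono n).comp hmono) hL
    (by
      rw [eq_bot_iff]
      intro x hx
      rw [mem_bot]
      ext i
      have := hx i
      rw [hN.bot, mem_bot] at this
      simpa using this)
    hEd (eq_bot_iff.2 ((orthogonal_le hle).trans hEd.le))
    fun j => by rw [hLd, finrank_ampliation]
  refine ⟨U, fun j x hx => (hLP j ((hU j x).1 hx)).2, fun i x => ?_⟩
  rw [hU (k i) x, hLk]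

end Amplification

/-- **Corollary (subnests).**  Let `𝒩` be a nest of order type `ω` with
finite-rank atoms and `𝓜 = {N_{k(i)}}` an infinite subnest (`k` strictly
increasing).  Then for every `n ≥ 1`, density of `Rg_n(T(𝒩))` in `T(𝒩)^n`
implies density of `Rg_n(T(𝓜))` in `T(𝓜)^n`; that is,
`rtsr(T(𝓜)) ≤ rtsr(T(𝒩))`. -/
theorem rtsr_subnest_le
    {H : Type*} [NormedAddCommGroup H] [InnerProductSpace ℂ H]
    [CompleteSpace H] [TopologicalSpace.SeparableSpace H]
    (hinf : ¬ FiniteDimensional ℂ H)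
    {N : ℕ → Submodule ℂ H} (hN : IsOmegaNest N)
    (k : ℕ → ℕ) (hk : StrictMono k)
    (n : ℕ) (hn : 1 ≤ n)
    (h : RgDenseIn (seqNestAlg N) n) :
    RgDenseIn (seqNestAlg fun i => N (k i)) n := by
  intro a ha ε hε
  obtain ⟨U, hUN, hUk⟩ := exists_unitary_rowCLM_mem hN hk hn ha
  let V : (PiLp 2 fun _ : Fin n => H) →L[ℂ] (PiLp 2 fun _ : Fin n => H) :=
    U.toContinuousLinearEquiv.toContinuousLinearMap
  let V' : (PiLp 2 fun _ : Fin n => H) →L[ℂ] (PiLp 2 fun _ : Fin n => H) :=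
    U.symm.toContinuousLinearEquiv.toContinuousLinearMap
  have hn0 : (0 : ℝ) < n := by exact_mod_cast hn
  obtain ⟨b, c, hb, hc, hab, hbc⟩ := h (fun i => (rowCLM a).comp (V.comp (inclCLM n i)))
    (fun i j x hx => hUN j _ (inclCLM_mem i hx)) (ε / n) (div_pos hε hn0)
  have hV' : ‖V'‖ ≤ 1 := ContinuousLinearMap.opNorm_le_bound _ zero_le_one fun x => by
    simp [V']
  refine ⟨fun i => (rowCLM b).comp (V'.comp (inclCLM n i)),
    fun i => (PiLp.proj 2 (fun _ : Fin n => H) i).comp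
      (V.comp (∑ j, (inclCLM n j).comp (c j))), ?_, ?_, ?_, ?_⟩
  · intro i l x hx
    refine rowCLM_mem (fun j y hy => hb j (k l) y hy) ((hUk l _).2 ?_)
    simpa [V'] using inclCLM_mem i hx
  · intro i l x hx
    refine (hUk l _).1 ?_ i
    have hsum : (∑ j, (inclCLM n j).comp (c j)) x = ∑ j, inclCLM n j (c j x) := by simp
    change (∑ j, (inclCLM n j).comp (c j)) x ∈ _
    rw [hsum]
    exact Submodule.sum_mem _ fun j _ => inclCLM_mem j (hc j (k l) x hx)
  · intro i
    let d : Fin n → H →L[ℂ] H := fun j => (rowCLM a).comp (V.comp (inclCLM n j)) - b j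
    have hd : a i - (rowCLM b).comp (V'.comp (inclCLM n i)) =
        (rowCLM d).comp (V'.comp (inclCLM n i)) := by
      ext x
      have key : ∀ y, rowCLM d y = rowCLM a (V y) - rowCLM b y := fun y => by
        conv_rhs => rw [← sum_inclCLM_proj y]
        simp [rowCLM_apply d, d, rowCLM_inclCLM]
      have hVV : V (V' (inclCLM n i x)) = inclCLM n i x := by simp [V, V']
      simp [key, hVV, rowCLM_inclCLM]
    change ‖a i - (rowCLM b).comp (V'.comp (inclCLM n i))‖ < ε
    have hsum : ∑ j, ‖d j‖ < ε := by
      have : Nonempty (Fin n) := ⟨⟨0, hn⟩⟩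
      calc ∑ j, ‖d j‖ < ∑ _j : Fin n, ε / n :=
            Finset.sum_lt_sum_of_nonempty Finset.univ_nonempty fun j _ => hab j
        _ = ε := by simp [mul_div_cancel₀ _ hn0.ne']
    rw [hd]
    refine lt_of_le_of_lt ?_ hsum
    calc ‖(rowCLM d).comp (V'.comp (inclCLM n i))‖ ≤ ‖rowCLM d‖ * ‖V'.comp (inclCLM n i)‖ :=
          ContinuousLinearMap.opNorm_comp_le _ _
      _ ≤ ‖rowCLM d‖ := mul_le_of_le_one_right (norm_nonneg (rowCLM d)) <|
          (ContinuousLinearMap.opNorm_comp_le _ _).trans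
            (mul_le_one₀ hV' (norm_nonneg _) (norm_inclCLM_le i))
      _ ≤ ∑ j, ‖d j‖ := norm_rowCLM_le d
  · ext x
    have hx := DFunLike.congr_fun hbc x
    let y : PiLp 2 fun _ : Fin n => H := V (∑ j, inclCLM n j (c j x))
    have hy : ∑ i, rowCLM b (V' (inclCLM n i (y i))) = x := by
      rw [← map_sum, ← map_sum, sum_inclCLM_proj]
      have : V' y = ∑ j, inclCLM n j (c j x) := by simp [V', y, V]
      rw [this, map_sum]
      simpa [rowCLM_inclCLM] using hx
    simpa [y] using hy
end

section
/- Let 𝒩 be a nest on a separable complex Hilbert space H. Suppose that for every positive integer q there is a chain N_0 ⊊ N_1 ⊊ ⋯ ⊊ N_q of elements of 𝒩 such that the Hilbert-space dimensions (as cardinals, possibly infinite) satisfy dim(N_j ⊖ N_{j−1}) ≥ dim(N_{j+1} ⊖ N_j) for all 1 ≤ j < q. Then rtsr(T(𝒩)) = ∞: for every n ≥ 1, the set Rg_n(T(𝒩)) is not dense in T(𝒩)^n. -/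
/-- A *nest* on a Hilbert space `H`: a family of closed subspaces, totally
ordered by inclusion, containing `{0}` and `H`, closed under arbitrary
intersections and under closed linear spans of subfamilies. -/
structure IsNest {H : Type*} [NormedAddCommGroup H] [InnerProductSpace ℂ H]
    (𝒩 : Set (Submodule ℂ H)) : Prop where
  closed : ∀ N ∈ 𝒩, IsClosed (N : Set H)
  chain : IsChain (· ≤ ·) 𝒩
  bot_mem : (⊥ : Submodule ℂ H) ∈ 𝒩
  top_mem : (⊤ : Submodule ℂ H) ∈ 𝒩
  sInf_mem : ∀ S ⊆ 𝒩, S.Nonempty → sInf S ∈ 𝒩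
  closure_sSup_mem : ∀ S ⊆ 𝒩, S.Nonempty → (sSup S).topologicalClosure ∈ 𝒩

/-- The nest algebra `T(𝒩)` of all bounded operators leaving each element of
the nest invariant. -/
def nestAlg {H : Type*} [NormedAddCommGroup H] [InnerProductSpace ℂ H]
    (𝒩 : Set (Submodule ℂ H)) : Set (H →L[ℂ] H) :=
  {T | ∀ N ∈ 𝒩, ∀ x ∈ N, T x ∈ N}

open scoped InnerProductSpace

section Shift

variable {H : Type*} [NormedAddCommGroup H] [InnerProductSpace ℂ H] [CompleteSpace H]

/-- Two orthonormal families, the second one doubly indexed, give a row of partial isometries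
`A i` with orthogonal ranges, `A i` sending `v s` to `w (i, s)`. -/
theorem exists_row_of_orthonormal {ι S : Type*} [DecidableEq ι] {v : S → H} {w : ι × S → H}
    (hv : Orthonormal ℂ v) (hw : Orthonormal ℂ w) :
    ∃ A : ι → H →L[ℂ] H,
      (∀ (i : ι) (x : H) (N : Submodule ℂ H), IsClosed (N : Set H) →
        (∀ s, ⟪v s, x⟫_ℂ = 0 ∨ w (i, s) ∈ N) → A i x ∈ N) ∧
      (∀ x ∈ (Submodule.span ℂ (Set.range v)).topologicalClosure, ∀ (i j : ι) (y : H),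
        ⟪A i x, A j y⟫_ℂ = if i = j then ⟪x, y⟫_ℂ else 0) := by
  classical
  let V := hv.orthogonalFamily.linearIsometry
  have hwi : ∀ i, Orthonormal ℂ fun s => w (i, s) := fun i =>
    hw.comp (fun s => (i, s)) fun s t h => (Prod.mk.inj h).2
  let W := fun i => (hwi i).orthogonalFamily.linearIsometry
  let A : ι → H →L[ℂ] H := fun i =>
    (W i).toContinuousLinearMap ∘L V.toContinuousLinearMap.adjoint
  have hcoord : ∀ x s, (V.toContinuousLinearMap.adjoint x : ∀ _ : S, ℂ) s = ⟪v s, x⟫_ℂ := by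
    intro x s
    have h1 := lp.inner_single_left (𝕜 := ℂ) (G := fun _ : S => ℂ) s (1 : ℂ)
      (V.toContinuousLinearMap.adjoint x)
    rw [ContinuousLinearMap.adjoint_inner_right] at h1
    have h2 : V (lp.single 2 s (1 : ℂ)) = v s := by
      simp [V]
    simpa [h2] using h1.symm
  have hmem : ∀ (i : ι) (x : H) (N : Submodule ℂ H), IsClosed (N : Set H) →
      (∀ s, ⟪v s, x⟫_ℂ = 0 ∨ w (i, s) ∈ N) → A i x ∈ N := by
    intro i x N hN h
    refine hN.mem_of_tendsto
      ((hwi i).orthogonalFamily.hasSum_linearIsometry (V.toContinuousLinearMap.adjoint x))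
      (Filter.Eventually.of_forall fun F => N.sum_mem fun s _ => ?_)
    rw [LinearIsometry.toSpanSingleton_apply, hcoord]
    rcases h s with h | h
    · simp [h]
    · exact N.smul_mem _ h
  refine ⟨A, hmem, fun x hx i j y => ?_⟩
  split_ifs with hij
  · subst hij
    have hx' : x ∈ V.toLinearMap.range := by
      rw [hv.orthogonalFamily.range_linearIsometry]
      rw [Submodule.span_range_eq_iSup] at hx
      refine Submodule.topologicalClosure_mono (iSup_mono fun s => ?_) hx
      rw [Submodule.span_singleton_le_iff_mem]
      exact ⟨1, by simp⟩
    obtain ⟨ξ, rfl⟩ := hx'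
    have h1 : V.toContinuousLinearMap.adjoint (V ξ) = ξ := by
      refine ext_inner_right ℂ fun η => ?_
      rw [ContinuousLinearMap.adjoint_inner_left]
      exact V.inner_map_map ξ η
    calc ⟪A i (V ξ), A i y⟫_ℂ
        = ⟪V.toContinuousLinearMap.adjoint (V ξ), V.toContinuousLinearMap.adjoint y⟫_ℂ :=
          (W i).inner_map_map _ _
      _ = ⟪V ξ, y⟫_ℂ := by
          rw [h1, ContinuousLinearMap.adjoint_inner_right]; rfl
  · have hcl : ∀ z : H, IsClosed ((ℂ ∙ z)ᗮ : Set H) := fun z => Submodule.isClosed_orthogonal _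
    rw [← Submodule.mem_orthogonal_singleton_iff_inner_left]
    refine hmem i x _ (hcl _) fun s => Or.inr ?_
    rw [Submodule.mem_orthogonal_singleton_iff_inner_right]
    rw [← Submodule.mem_orthogonal_singleton_iff_inner_left]
    refine hmem j y _ (hcl _) fun t => Or.inr ?_
    rw [Submodule.mem_orthogonal_singleton_iff_inner_left]
    exact hw.2 fun h => hij (Prod.mk.inj h).1.symm

end Shift

section Growth

variable {H : Type*} [NormedAddCommGroup H] [InnerProductSpace ℂ H]

theorem starProjection_orthogonal_map {M : Submodule ℂ H} [M.HasOrthogonalProjection]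
    {B : H →L[ℂ] H} (hB : ∀ z ∈ M, B z ∈ M) (y : H) :
    Mᗮ.starProjection (B (Mᗮ.starProjection y)) = Mᗮ.starProjection (B y) := by
  have h : y = M.starProjection y + Mᗮ.starProjection y :=
    (M.starProjection_add_starProjection_orthogonal y).symm
  have h0 : Mᗮ.starProjection (B (M.starProjection y)) = 0 := by
    rw [Submodule.starProjection_apply_eq_zero_iff]
    exact M.le_orthogonal_orthogonal (hB _ (M.starProjection_apply_mem y))
  conv_rhs => rw [h, map_add, map_add, h0, zero_add]

/-- Growth of a right inverse `C` along a decreasing chain `M`, when the row `B` is a small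
perturbation of a row `A` of shifts along the chain. -/
theorem growth_of_right_inverse {n m : ℕ} {M : ℕ → Submodule ℂ H}
    [∀ k, (M k).HasOrthogonalProjection] (hM : Antitone M) {A B C : Fin n → H →L[ℂ] H}
    (hA : ∀ k j, ∀ z ∈ M k, A j z ∈ M k) (hB : ∀ k j, ∀ z ∈ M k, B j z ∈ M k)
    (hC : ∀ j, ∀ z ∈ M 0, C j z ∈ M 0)
    (hshift : ∀ k < m, ∀ v ∈ M 0 ⊓ (M k)ᗮ, ∀ i, A i v ∈ (M (k + 1))ᗮ ∧
      ∀ j y, ⟪A i v, A j y⟫_ℂ = if i = j then ⟪v, y⟫_ℂ else 0)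
    (hBC : ∑ i, B i * C i = 1) (hAB : ∑ i, ‖A i - B i‖ ≤ 1 / 4)
    {x : H} (hx0 : x ∈ M 0) (hx1 : x ∈ (M 1)ᗮ) (hxA : ∀ j y, ⟪x, A j y⟫_ℂ = 0)
    (k : ℕ) (hk : k + 1 ≤ m) :
    (3 ^ (k + 1) + 1) * ‖x‖ ≤ ‖fun j => (M (k + 1))ᗮ.starProjection (C j x)‖ := by
  set F : ℕ → ℝ := fun k => ‖fun j => (M k)ᗮ.starProjection (C j x)‖ with hF
  have hy0 : ∀ j, C j x ∈ M 0 := fun j => hC j x hx0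
  have hsum : ∑ j, B j (C j x) = x := by
    simpa using congrArg (fun T : H →L[ℂ] H => T x) hBC
  have hpert : ∀ k, ‖(M k)ᗮ.starProjection (∑ j, (A j - B j) (C j x))‖ ≤ F k / 4 := by
    intro k
    have h1 : (M k)ᗮ.starProjection (∑ j, (A j - B j) (C j x)) =
        ∑ j, (M k)ᗮ.starProjection ((A j - B j) ((M k)ᗮ.starProjection (C j x))) := by
      rw [map_sum]
      refine Finset.sum_congr rfl fun j _ => (starProjection_orthogonal_map ?_ _).symm
      intro z hz
      exact (M k).sub_mem (hA k j z hz) (hB k j z hz)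
    rw [h1]
    calc ‖∑ j, (M k)ᗮ.starProjection ((A j - B j) ((M k)ᗮ.starProjection (C j x)))‖
        ≤ ∑ j, ‖A j - B j‖ * F k := by
          refine norm_sum_le_of_le _ fun j _ => ?_
          refine (Submodule.norm_starProjection_apply_le _ _).trans ?_
          refine ((A j - B j).le_opNorm _).trans ?_
          gcongr
          exact norm_le_pi_norm (fun j => (M k)ᗮ.starProjection (C j x)) j
      _ ≤ 1 / 4 * F k := by
          rw [← Finset.sum_mul]
          gcongr
      _ = F k / 4 := by ring
  have hsplit : ∑ j, A j (C j x) = x + ∑ j, (A j - B j) (C j x) := by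
    simp only [sub_apply, Finset.sum_sub_distrib, hsum]
    abel
  have hxQ : ∀ k, 1 ≤ k → (M k)ᗮ.starProjection x = x := fun k hk =>
    Submodule.starProjection_eq_self_iff.2 (Submodule.orthogonal_le (hM hk) hx1)
  have hstep : ∀ k < m, F k ≤ ‖x‖ + F (k + 1) / 4 := by
    intro k hk
    have h1 : ‖(M (k + 1))ᗮ.starProjection (∑ j, A j (C j x))‖ ≤ ‖x‖ + F (k + 1) / 4 := by
      rw [hsplit, map_add, hxQ _ (by omega)]
      exact (norm_add_le _ _).trans (by gcongr; exact hpert _)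
    refine (pi_norm_le_iff_of_nonneg ((norm_nonneg _).trans h1)).2 fun i => ?_
    refine le_trans ?_ h1
    set v := (M k)ᗮ.starProjection (C i x) with hv
    have hvM : v ∈ M 0 ⊓ (M k)ᗮ := by
      refine ⟨?_, Submodule.starProjection_apply_mem _ _⟩
      rw [hv, Submodule.starProjection_orthogonal_val]
      exact (M 0).sub_mem (hy0 i) (hM (Nat.zero_le k) (Submodule.starProjection_apply_mem _ _))
    obtain ⟨h2, h3⟩ := hshift k hk v hvM i
    have hvv : ‖A i v‖ = ‖v‖ := by
      have := h3 i v
      rw [if_pos rfl, inner_self_eq_norm_sq_to_K, inner_self_eq_norm_sq_to_K] at this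
      have h4 : ‖A i v‖ ^ 2 = ‖v‖ ^ 2 := by exact_mod_cast this
      exact (sq_eq_sq₀ (norm_nonneg _) (norm_nonneg _)).1 h4
    have h5 : ⟪A i v, (M (k + 1))ᗮ.starProjection (∑ j, A j (C j x))⟫_ℂ = ⟪v, v⟫_ℂ := by
      rw [← Submodule.inner_starProjection_left_eq_right,
        Submodule.starProjection_eq_self_iff.2 h2, inner_sum]
      simp only [h3, Finset.sum_ite_eq, Finset.mem_univ, if_true]
      conv_rhs => rw [hv, ← Submodule.inner_starProjection_left_eq_right,
        Submodule.starProjection_eq_self_iff.2 (Submodule.starProjection_apply_mem _ _)]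
    have h6 := norm_inner_le_norm (𝕜 := ℂ) (A i v)
      ((M (k + 1))ᗮ.starProjection (∑ j, A j (C j x)))
    rw [h5, inner_self_eq_norm_sq_to_K, hvv] at h6
    have h7 : ‖v‖ * ‖v‖ ≤ ‖v‖ * ‖(M (k + 1))ᗮ.starProjection (∑ j, A j (C j x))‖ := by
      simpa [sq] using h6
    rcases (norm_nonneg v).eq_or_lt with h0 | h0
    · rw [← h0]; exact norm_nonneg _
    · exact le_of_mul_le_mul_left h7 h0
  have hbase : ‖x‖ ≤ F 1 / 4 := by
    have h1 : ⟪x, (M 1)ᗮ.starProjection (∑ j, (A j - B j) (C j x))⟫_ℂ = -⟪x, x⟫_ℂ := by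
      rw [← Submodule.inner_starProjection_left_eq_right, hxQ 1 le_rfl,
        ← sub_eq_of_eq_add' hsplit, inner_sub_right, inner_sum]
      simp [hxA]
    have h2 := norm_inner_le_norm (𝕜 := ℂ) x
      ((M 1)ᗮ.starProjection (∑ j, (A j - B j) (C j x)))
    rw [h1, norm_neg, inner_self_eq_norm_sq_to_K] at h2
    have h3 : ‖x‖ * ‖x‖ ≤ ‖x‖ * ‖(M 1)ᗮ.starProjection (∑ j, (A j - B j) (C j x))‖ := by
      simpa [sq] using h2
    rcases (norm_nonneg x).eq_or_lt with h0 | h0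
    · rw [← h0]; positivity
    · exact (le_of_mul_le_mul_left h3 h0).trans (hpert 1)
  have hxn := norm_nonneg x
  change _ ≤ F (k + 1)
  induction k with
  | zero => norm_num; linarith
  | succ k ih =>
    have h1 := ih (by omega)
    have h2 := hstep (k + 1) (by omega)
    have h3 : (1 : ℝ) ≤ 3 ^ (k + 1) := one_le_pow₀ (by norm_num)
    have h4 : 0 ≤ (3 ^ (k + 1) - 1 : ℝ) * ‖x‖ := mul_nonneg (by linarith) hxn
    rw [pow_succ]
    nlinarith

end Growth

section Dimension

universe u

theorem Orthonormal.countable_of_separableSpace {E ι : Type*} [NormedAddCommGroup E]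
    [InnerProductSpace ℂ E] [TopologicalSpace.SeparableSpace E] {v : ι → E}
    (hv : Orthonormal ℂ v) : Countable ι := by
  refine Pairwise.countable_of_isOpen_disjoint (s := fun i => Metric.ball (v i) (1 / 2)) ?_
    (fun i => Metric.isOpen_ball) fun i => ⟨v i, Metric.mem_ball_self (by norm_num)⟩
  intro i j hij
  refine Metric.ball_disjoint_ball ?_
  have h : ‖v i - v j‖ ^ 2 = 2 := by
    rw [@norm_sub_sq ℂ, hv.1, hv.1, hv.2 hij]
    norm_num
  rw [dist_eq_norm]
  nlinarith [norm_nonneg (v i - v j)]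

theorem HilbertBasis.nonempty_embedding_of_rank_le {E E' ι ι' : Type u}
    [NormedAddCommGroup E] [InnerProductSpace ℂ E] [TopologicalSpace.SeparableSpace E]
    [NormedAddCommGroup E'] [InnerProductSpace ℂ E']
    (b : HilbertBasis ι ℂ E) (b' : HilbertBasis ι' ℂ E')
    (h : Module.rank ℂ E ≤ Module.rank ℂ E') : Nonempty (ι ↪ ι') := by
  have hι := b.orthonormal.countable_of_separableSpace
  rw [← Cardinal.le_def]
  rcases finite_or_infinite ι' with hfin | hinf
  · have := Fintype.ofFinite ι'
    have h1 := rank_eq_card_basis b'.toOrthonormalBasis.toBasis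
    have h2 := b.orthonormal.linearIndependent.cardinal_le_rank
    rw [Cardinal.mk_fintype ι', ← h1]
    exact h2.trans h
  · exact (Cardinal.mk_le_aleph0_iff.2 hι).trans (Cardinal.aleph0_le_mk_iff.2 hinf)

end Dimension

section Chains

variable {H : Type*} [NormedAddCommGroup H] [InnerProductSpace ℂ H]

/-- A strictly increasing chain `c 0 < ⋯ < c q` in `𝒩` whose consecutive intervals have weakly
decreasing dimension. -/
structure IsDecrChain (𝒩 : Set (Submodule ℂ H)) (q : ℕ) (c : ℕ → Submodule ℂ H) : Prop where
  mem : ∀ j ≤ q, c j ∈ 𝒩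
  lt_succ : ∀ j < q, c j < c (j + 1)
  rank_le : ∀ j, j + 2 ≤ q → Module.rank ℂ ↥(c (j + 2) ⊓ (c (j + 1))ᗮ) ≤
    Module.rank ℂ ↥(c (j + 1) ⊓ (c j)ᗮ)

variable {𝒩 : Set (Submodule ℂ H)}

theorem IsDecrChain.le {q : ℕ} {c : ℕ → Submodule ℂ H} (hc : IsDecrChain 𝒩 q c) {j k : ℕ}
    (hjk : j ≤ k) (hk : k ≤ q) : c j ≤ c k := by
  induction k, hjk using Nat.le_induction with
  | base => exact le_rfl
  | succ k _ ih => exact (ih (by omega)).trans (hc.lt_succ k (by omega)).le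

theorem IsDecrChain.shift {q : ℕ} {c : ℕ → Submodule ℂ H} (hc : IsDecrChain 𝒩 q c) {a l : ℕ}
    (h : a + l ≤ q) : IsDecrChain 𝒩 l fun j => c (a + j) where
  mem j hj := hc.mem _ (by omega)
  lt_succ j hj := hc.lt_succ (a + j) (by omega)
  rank_le j hj := hc.rank_le (a + j) (by omega)

/-- The interval from `M` to `N` contains chains with decreasing dimensions of every length. -/
def HasLongChains (𝒩 : Set (Submodule ℂ H)) (M N : Submodule ℂ H) : Prop :=
  ∀ q, ∃ c, IsDecrChain 𝒩 q c ∧ M ≤ c 0 ∧ c q ≤ N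

theorem HasLongChains.split (h𝒩 : IsChain (· ≤ ·) 𝒩) {L M N : Submodule ℂ H}
    (h : HasLongChains 𝒩 M N) (hL : L ∈ 𝒩) : HasLongChains 𝒩 M L ∨ HasLongChains 𝒩 L N := by
  by_contra hcon
  simp only [HasLongChains, not_or, not_forall, not_exists] at hcon
  obtain ⟨⟨q₁, h₁⟩, q₂, h₂⟩ := hcon
  obtain ⟨c, hc, hM, hN⟩ := h (q₁ + q₂)
  rcases h𝒩.total (hc.mem q₁ (by omega)) hL with hle | hle
  · exact h₁ _ ⟨hc.shift (a := 0) (by omega), by simpa using hM, by simpa using hle⟩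
  · exact h₂ _ ⟨hc.shift (a := q₁) (by omega), by simpa using hle, by simpa using hN⟩

theorem HasLongChains.exists_chain_and_rest (h𝒩 : IsChain (· ≤ ·) 𝒩) {M N : Submodule ℂ H}
    (h : HasLongChains 𝒩 M N) (q : ℕ) :
    ∃ (c : ℕ → Submodule ℂ H) (M' N' : Submodule ℂ H), IsDecrChain 𝒩 q c ∧ M ≤ c 0 ∧ c q ≤ N ∧
      M ≤ M' ∧ N' ≤ N ∧ HasLongChains 𝒩 M' N' ∧ (c q ≤ M' ∨ N' ≤ c 0) := by
  obtain ⟨c, hc, hM, hN⟩ := h (q + q)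
  have h0 : c 0 ≤ c q := hc.le (by omega) (by omega)
  have h1 : c q ≤ c (q + q) := hc.le (by omega) (by omega)
  rcases h.split h𝒩 (hc.mem q (by omega)) with h' | h'
  · exact ⟨_, M, c q, hc.shift (a := q) le_rfl, hM.trans h0, hN, le_rfl, h1.trans hN, h',
      Or.inr le_rfl⟩
  · exact ⟨c, c q, N, by simpa using hc.shift (a := 0) (l := q) (by omega), hM, h1.trans hN,
      hM.trans h0, le_rfl, h', Or.inl le_rfl⟩

theorem HasLongChains.exists_disjoint_chains (h𝒩 : IsChain (· ≤ ·) 𝒩) {M N : Submodule ℂ H}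
    (h : HasLongChains 𝒩 M N) (m : ℕ → ℕ) :
    ∃ c : ℕ → ℕ → Submodule ℂ H, (∀ p, IsDecrChain 𝒩 (m p) (c p)) ∧
      ∀ p p', p < p' → c p (m p) ≤ c p' 0 ∨ c p' (m p') ≤ c p 0 := by
  choose c M' N' hc hM hN hMM hNN hlong hdisj using
    fun (s : {s : Submodule ℂ H × Submodule ℂ H // HasLongChains 𝒩 s.1 s.2}) (q : ℕ) =>
      s.2.exists_chain_and_rest h𝒩 q
  let st : ℕ → {s : Submodule ℂ H × Submodule ℂ H // HasLongChains 𝒩 s.1 s.2} := fun p =>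
    Nat.rec ⟨(M, N), h⟩ (fun p s => ⟨(M' s (m p), N' s (m p)), hlong s (m p)⟩) p
  have hmono : Monotone fun p => (st p).1.1 := monotone_nat_of_le_succ fun p => hMM (st p) (m p)
  have hanti : Antitone fun p => (st p).1.2 := antitone_nat_of_succ_le fun p => hNN (st p) (m p)
  refine ⟨fun p => c (st p) (m p), fun p => hc _ _, fun p p' hpp => ?_⟩
  rcases hdisj (st p) (m p) with h1 | h1
  · exact Or.inl (h1.trans ((hmono (Nat.succ_le_of_lt hpp)).trans (hM (st p') (m p'))))
  · exact Or.inr ((hN (st p') (m p')).trans ((hanti (Nat.succ_le_of_lt hpp)).trans h1))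

end Chains

section ShiftRow

theorem mul_add_fin_inj {n r r' : ℕ} {i i' : Fin n} (h : n * r + i + 1 = n * r' + i' + 1) :
    r = r' ∧ i = i' := by
  have hn : 0 < n := i.pos
  have h1 : (i + n * r) / n = (i' + n * r') / n := by congr 1; omega
  rw [Nat.add_mul_div_left _ _ hn, Nat.add_mul_div_left _ _ hn, Nat.div_eq_of_lt i.2,
    Nat.div_eq_of_lt i'.2, zero_add, zero_add] at h1
  subst h1
  exact ⟨rfl, Fin.ext (by omega)⟩

variable {H : Type*} [NormedAddCommGroup H] [InnerProductSpace ℂ H]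

theorem inf_orthogonal_le_iSup {d : ℕ → Submodule ℂ H} [∀ r, (d r).HasOrthogonalProjection]
    (hd : Antitone d) (L : ℕ) :
    d 0 ⊓ (d L)ᗮ ≤ ⨆ r : Fin L, d r ⊓ (d (r + 1))ᗮ := by
  induction L with
  | zero => rw [Submodule.inf_orthogonal_eq_bot]; exact bot_le
  | succ L ih =>
    rintro x ⟨hx0, hxL⟩
    have hmono : (⨆ r : Fin L, d r ⊓ (d (r + 1))ᗮ) ≤
        ⨆ r : Fin (L + 1), d r ⊓ (d (r + 1))ᗮ :=
      iSup_le fun r => le_iSup_of_le r.castSucc le_rfl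
    have hP := (d L).starProjection_apply_mem x
    have hQ := (d L).sub_starProjection_mem_orthogonal x
    have h1 : x - (d L).starProjection x ∈ d 0 ⊓ (d L)ᗮ :=
      ⟨(d 0).sub_mem hx0 (hd (Nat.zero_le L) hP), hQ⟩
    have h2 : (d L).starProjection x ∈ d L ⊓ (d (L + 1))ᗮ := by
      refine ⟨hP, ?_⟩
      have := (d (L + 1))ᗮ.sub_mem hxL (Submodule.orthogonal_le (hd L.le_succ) hQ)
      rwa [sub_sub_cancel] at this
    rw [← sub_add_cancel x ((d L).starProjection x)]
    exact Submodule.add_mem _ (hmono (ih h1))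
      (Submodule.mem_iSup_of_mem (Fin.last L) h2)

variable [CompleteSpace H] [TopologicalSpace.SeparableSpace H] {𝒩 : Set (Submodule ℂ H)}

/-- For mutually disjoint decreasing chains `d p` in a nest, with weakly increasing dimensions of
the successive differences, there is a row of operators in the nest algebra acting on each chain
as a row of shifts, the differences being arranged as the nodes of an `n`-ary heap. -/
theorem exists_heap_shift {n : ℕ} (h𝒩 : IsNest 𝒩) {q : ℕ → ℕ}
    {d : ℕ → ℕ → Submodule ℂ H} (hd : ∀ p r, d p r ∈ 𝒩) (hanti : ∀ p, Antitone (d p))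
    (hrank : ∀ p r, r + 1 < q p → Module.rank ℂ ↥(d p r ⊓ (d p (r + 1))ᗮ) ≤
      Module.rank ℂ ↥(d p (r + 1) ⊓ (d p (r + 2))ᗮ))
    (hdisj : ∀ p p', p < p' → (∀ r r', d p r ≤ d p' r') ∨ ∀ r r', d p' r' ≤ d p r) :
    ∃ A : Fin n → H →L[ℂ] H, (∀ i, A i ∈ nestAlg 𝒩) ∧
      (∀ p, ∀ x ∈ d p 0 ⊓ (d p 1)ᗮ, ∀ j y, ⟪x, A j y⟫_ℂ = 0) ∧
      ∀ p L, n * L < q p → ∀ v ∈ d p 0 ⊓ (d p L)ᗮ, ∀ i, A i v ∈ (d p (n * L + 1))ᗮ ∧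
        ∀ j y, ⟪A i v, A j y⟫_ℂ = if i = j then ⟪v, y⟫_ℂ else 0 := by
  have hcl : ∀ p r, IsClosed (d p r : Set H) := fun p r => h𝒩.closed _ (hd p r)
  have : ∀ p r, CompleteSpace (d p r) := fun p r => (hcl p r).completeSpace_coe
  let E : ℕ × ℕ → Submodule ℂ H := fun t => d t.1 t.2 ⊓ (d t.1 (t.2 + 1))ᗮ
  have : ∀ t, CompleteSpace (E t) := fun t =>
    ((hcl t.1 t.2).inter (Submodule.isClosed_orthogonal _)).completeSpace_coe
  have hsep : ∀ {p r p' r' : ℕ}, d p' r' ≤ d p (r + 1) → E (p, r) ⟂ E (p', r') := fun h =>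
    (Submodule.isOrtho_iff_le.2 (inf_le_right.trans
      (Submodule.orthogonal_le (inf_le_left.trans h))))
  have hpair : Pairwise fun s t => E s ⟂ E t := by
    rintro ⟨p, r⟩ ⟨p', r'⟩ hne
    rcases lt_trichotomy p p' with hp | rfl | hp
    · rcases hdisj p p' hp with h | h
      · exact (hsep (h _ _)).symm
      · exact hsep (h _ _)
    · rcases lt_trichotomy r r' with hr | rfl | hr
      · exact hsep (hanti p hr)
      · exact absurd rfl hne
      · exact (hsep (hanti p hr)).symm
    · rcases hdisj p' p hp with h | h
      · exact hsep (h _ _)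
      · exact (hsep (h _ _)).symm
  have hE : OrthogonalFamily ℂ (fun t => E t) fun t => (E t).subtypeₗᵢ :=
    OrthogonalFamily.of_pairwise hpair
  choose w b _ using fun t => exists_hilbertBasis ℂ (E t)
  have hmono : ∀ p r r', r ≤ r' → r' < q p →
      Module.rank ℂ (E (p, r)) ≤ Module.rank ℂ (E (p, r')) := by
    intro p r r' hr
    induction r', hr using Nat.le_induction with
    | base => exact fun _ => le_rfl
    | succ k _ ih => exact fun hk => (ih (by omega)).trans (hrank p k hk)
  let T := {t : ℕ × ℕ // n * t.2 + n < q t.1}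
  have hemb : ∀ (t : T) (i : Fin n),
      Nonempty (w t.1 ↪ w (t.1.1, n * t.1.2 + i + 1)) := by
    rintro ⟨⟨p, r⟩, ht⟩ i
    refine (b _).nonempty_embedding_of_rank_le (b _) (hmono p _ _ ?_ ?_)
    · have := Nat.le_mul_of_pos_left r i.pos
      simp only
      omega
    · have := i.2
      simp only at ht ⊢
      omega
  let f := fun t i => (hemb t i).some
  let e : (Σ t, w t) → H := fun a => b a.1 a.2
  have he : Orthonormal ℂ e := hE.orthonormal_sigma_orthonormal fun t => (b t).orthonormal
  have heE : ∀ t a, e ⟨t, a⟩ ∈ E t := fun t a => (b t a).2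
  let v : (Σ t : T, w t.1) → H := fun s => e ⟨s.1.1, s.2⟩
  let u : Fin n × (Σ t : T, w t.1) → H := fun s =>
    e ⟨(s.2.1.1.1, n * s.2.1.1.2 + s.1 + 1), f s.2.1 s.1 s.2.2⟩
  have hv : Orthonormal ℂ v := by
    refine he.comp (fun s : Σ t : T, w t.1 => (⟨s.1.1, s.2⟩ : Σ t, w t)) ?_
    rintro ⟨⟨t, ht⟩, a⟩ ⟨⟨t', ht'⟩, a'⟩ h
    simp only [Sigma.mk.injEq] at h
    obtain ⟨rfl, h⟩ := h
    obtain rfl := eq_of_heq h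
    rfl
  have hu : Orthonormal ℂ u := by
    refine he.comp (fun s : Fin n × (Σ t : T, w t.1) =>
      (⟨(s.2.1.1.1, n * s.2.1.1.2 + s.1 + 1), f s.2.1 s.1 s.2.2⟩ : Σ t, w t)) ?_
    rintro ⟨i, ⟨⟨⟨p, r⟩, ht⟩, a⟩⟩ ⟨i', ⟨⟨⟨p', r'⟩, ht'⟩, a'⟩⟩ h
    simp only [Sigma.mk.injEq, Prod.mk.injEq] at h
    obtain ⟨⟨rfl, hr⟩, h⟩ := h
    obtain ⟨rfl, rfl⟩ := mul_add_fin_inj hr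
    obtain rfl := (f _ _).injective (eq_of_heq h)
    rfl
  obtain ⟨A, hAmem, hAinner⟩ := exists_row_of_orthonormal hv hu
  have hspan : ∀ t : T, E t.1 ≤ (Submodule.span ℂ (Set.range v)).topologicalClosure := by
    intro t x hx
    have h := (b t.1).hasSum_repr ⟨x, hx⟩
    have h' := h.mapL (E t.1).subtypeL
    refine (Submodule.isClosed_topologicalClosure _).mem_of_tendsto h'
      (Filter.Eventually.of_forall fun F => Submodule.sum_mem _ fun a _ => ?_)
    refine Submodule.le_topologicalClosure _ ?_
    rw [map_smul]
    exact Submodule.smul_mem _ _ (Submodule.subset_span ⟨⟨t, a⟩, rfl⟩)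
  refine ⟨A, fun i N hN x hx => ?_, fun p x hx j y => ?_, fun p L hL z hz i => ?_⟩
  · refine hAmem i x N (h𝒩.closed N hN) ?_
    rintro ⟨⟨⟨p, r⟩, ht⟩, a⟩
    rcases h𝒩.chain.total hN (hd p (r + 1)) with h | h
    · exact Or.inl (Submodule.inner_left_of_mem_orthogonal (h hx) (heE (p, r) a).2)
    · refine Or.inr (h (hanti p ?_ (heE (p, n * r + i + 1) _).1))
      have := Nat.le_mul_of_pos_left r i.pos
      omega
  · rw [← Submodule.mem_orthogonal_singleton_iff_inner_right]
    refine hAmem j y _ (Submodule.isClosed_orthogonal _) ?_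
    rintro ⟨⟨⟨p', r⟩, ht⟩, a⟩
    refine Or.inr (Submodule.mem_orthogonal_singleton_iff_inner_right.2 ?_)
    have hne : (p, 0) ≠ (p', n * r + j + 1) := by simp
    exact (hpair hne).inner_eq hx (heE _ _)
  · have hT : ∀ r < L, n * r + n < q p := fun r hr => by
      have := Nat.mul_le_mul_left n (Nat.succ_le_of_lt hr)
      rw [Nat.mul_succ] at this
      omega
    have hz' := inf_orthogonal_le_iSup (hanti p) L hz
    refine ⟨?_, ?_⟩
    · suffices h : (⨆ r : Fin L, E (p, r)) ≤
          (d p (n * L + 1))ᗮ.comap (A i : H →ₗ[ℂ] H) from h hz'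
      refine iSup_le fun r x hx => ?_
      refine hAmem i x _ (Submodule.isClosed_orthogonal _) ?_
      rintro ⟨⟨⟨p', r'⟩, ht⟩, a⟩
      by_cases hne : (p', r') = (p, (r : ℕ))
      · obtain ⟨rfl, rfl⟩ := Prod.mk.inj hne
        refine Or.inr (Submodule.orthogonal_le (hanti p' ?_) (heE (p', n * r + i + 1) _).2)
        have := Nat.mul_le_mul_left n (Nat.succ_le_of_lt r.2)
        rw [Nat.mul_succ] at this
        have := i.2
        omega
      · exact Or.inl ((hpair hne).inner_eq (heE _ _) hx)
    · refine fun j y => hAinner z ?_ i j y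
      exact iSup_le (fun r : Fin L => hspan ⟨(p, r), hT r r.2⟩) hz'

end ShiftRow

section HeapLevel

/-- The index of the first node at depth `k` of an `n`-ary heap. -/
def heapLevel (n : ℕ) : ℕ → ℕ
  | 0 => 0
  | k + 1 => n * heapLevel n k + 1

theorem heapLevel_monotone {n : ℕ} (hn : 1 ≤ n) : Monotone (heapLevel n) :=
  monotone_nat_of_le_succ fun k =>
    (Nat.le_mul_of_pos_left _ hn).trans (Nat.le_succ (n * heapLevel n k))

end HeapLevel

/-- **Corollary (lower bound).**  Let `𝒩` be a nest on a separable complex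
Hilbert space.  If for every positive integer `q` there is a chain
`N_0 ⊊ N_1 ⊊ ⋯ ⊊ N_q` in `𝒩` whose consecutive intervals have (weakly)
decreasing Hilbert-space dimension, then `rtsr(T(𝒩)) = ∞`: for no `n ≥ 1` is
`Rg_n(T(𝒩))` dense in `T(𝒩)^n`. -/
theorem rtsr_nestAlgebra_eq_infty_of_decreasing_chains
    {H : Type*} [NormedAddCommGroup H] [InnerProductSpace ℂ H]
    [CompleteSpace H] [TopologicalSpace.SeparableSpace H]
    {𝒩 : Set (Submodule ℂ H)} (h𝒩 : IsNest 𝒩)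
    (hchains : ∀ q : ℕ, 1 ≤ q → ∃ Nc : ℕ → Submodule ℂ H,
      (∀ j ≤ q, Nc j ∈ 𝒩) ∧ (∀ j < q, Nc j < Nc (j + 1)) ∧
      (∀ j, 1 ≤ j → j + 1 ≤ q →
        Module.rank ℂ ↥(Nc (j + 1) ⊓ (Nc j)ᗮ) ≤
          Module.rank ℂ ↥(Nc j ⊓ (Nc (j - 1))ᗮ))) :
    ∀ n : ℕ, 1 ≤ n → ¬ RgDenseIn (nestAlg 𝒩) n := by
  intro n hn hdense
  have hlong : HasLongChains 𝒩 ⊥ ⊤ := by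
    intro q
    obtain ⟨c, hc, hlt, hrank⟩ := hchains (q + 1) (by omega)
    refine ⟨c, ⟨fun j hj => hc j (by omega), fun j hj => hlt j (by omega), fun j hj => ?_⟩,
      bot_le, le_top⟩
    exact hrank (j + 1) (by omega) (by omega)
  have hL := heapLevel_monotone hn
  obtain ⟨c, hc, hdisj⟩ := hlong.exists_disjoint_chains h𝒩.chain (heapLevel n)
  let d : ℕ → ℕ → Submodule ℂ H := fun p r => c p (heapLevel n p - r)
  have hd : ∀ p r, d p r ∈ 𝒩 := fun p r => (hc p).mem _ (Nat.sub_le _ _)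
  have hanti : ∀ p, Antitone (d p) := fun p r r' hr =>
    (hc p).le (Nat.sub_le_sub_left hr _) (Nat.sub_le _ _)
  have hrank : ∀ p r, r + 1 < heapLevel n p → Module.rank ℂ ↥(d p r ⊓ (d p (r + 1))ᗮ) ≤
      Module.rank ℂ ↥(d p (r + 1) ⊓ (d p (r + 2))ᗮ) := by
    intro p r hr
    obtain ⟨j, hj⟩ := Nat.exists_eq_add_of_lt hr
    have h0 : d p r = c p (j + 2) := congrArg (c p) (by omega)
    have h1 : d p (r + 1) = c p (j + 1) := congrArg (c p) (by omega)
    have h2 : d p (r + 2) = c p j := congrArg (c p) (by omega)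
    rw [h0, h1, h2]
    exact (hc p).rank_le j (by omega)
  have hle : ∀ p p', c p (heapLevel n p) ≤ c p' 0 → ∀ r r', d p r ≤ d p' r' := by
    intro p p' h r r'
    exact ((hc p).le (Nat.sub_le _ _) le_rfl).trans
      (h.trans ((hc p').le (Nat.zero_le _) (Nat.sub_le _ _)))
  obtain ⟨A, hA, hA0, hAshift⟩ := exists_heap_shift (n := n) h𝒩 hd hanti hrank
    fun p p' hpp => (hdisj p p' hpp).imp (hle p p') fun h r r' => hle p' p h r' r
  obtain ⟨B, C, hB, hC, hAB, hBC⟩ := hdense A hA (1 / (4 * n)) (by positivity)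
  have hsum : ∑ i, ‖A i - B i‖ ≤ 1 / 4 := by
    refine (Finset.sum_le_sum fun i _ => (hAB i).le).trans_eq ?_
    have : (n : ℝ) ≠ 0 := by positivity
    simp only [Finset.sum_const, Finset.card_univ, Fintype.card_fin, nsmul_eq_mul]
    field_simp
  have : ∀ p r, CompleteSpace (d p r) := fun p r =>
    (h𝒩.closed _ (hd p r)).completeSpace_coe
  obtain ⟨k, hk⟩ := pow_unbounded_of_one_lt (∑ i, ‖C i‖) (by norm_num : (1 : ℝ) < 3)
  have hpos : 0 < heapLevel n (k + 1) := Nat.succ_pos _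
  obtain ⟨x, hx, hx_ne⟩ : ∃ x ∈ d (k + 1) 0 ⊓ (d (k + 1) 1)ᗮ, x ≠ 0 := by
    refine Submodule.exists_mem_ne_zero_of_ne_bot fun hbot => ?_
    have hlt : d (k + 1) 1 < d (k + 1) 0 := by
      have := (hc (k + 1)).lt_succ (heapLevel n (k + 1) - 1) (by omega)
      rwa [Nat.sub_add_cancel hpos] at this
    have := Submodule.sup_orthogonal_inf_of_hasOrthogonalProjection hlt.le
    rw [inf_comm, hbot, sup_bot_eq] at this
    exact hlt.ne this
  have hgrowth := growth_of_right_inverse (m := k + 1) (M := fun l => d (k + 1) (heapLevel n l))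
    (fun l l' h => hanti _ (hL h)) (fun l j => hA j _ (hd _ _)) (fun l j => hB j _ (hd _ _))
    (fun j => hC j _ (hd _ _))
    (fun l hl v hv => hAshift (k + 1) (heapLevel n l) (hL (Nat.succ_le_of_lt hl)) v hv)
    hBC hsum hx.1 (by simpa [heapLevel] using hx.2) (hA0 _ x hx) k le_rfl
  have hupper : ‖fun j => (d (k + 1) (heapLevel n (k + 1)))ᗮ.starProjection (C j x)‖ ≤
      (∑ i, ‖C i‖) * ‖x‖ := by
    refine (pi_norm_le_iff_of_nonneg (by positivity)).2 fun j => ?_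
    refine (Submodule.norm_starProjection_apply_le _ _).trans (((C j).le_opNorm x).trans ?_)
    gcongr
    exact Finset.single_le_sum (fun i _ => norm_nonneg (C i)) (Finset.mem_univ j)
  have hfin := le_of_mul_le_mul_right (hgrowth.trans hupper) (norm_pos_iff.2 hx_ne)
  have : (0 : ℝ) < 3 ^ k := by positivity
  rw [pow_succ] at hfin
  linarith
end

section
/- Let (N_k)_{k≥0} give a nest 𝒩 of order type ω with finite-rank atoms of dimensions n_k on an infinite-dimensional separable complex Hilbert space H, and assume the sequence (n_k) is monotone increasing: n_{k+1} ≥ n_k for all k ≥ 1. For each j ≥ 0 let d_j be the number of indices k ≥ 1 with 2^{j−1} < n_k ≤ 2^j. Then: (i) if the quantities d_j are not bounded above by any finite constant, then for every n ≥ 1 the set Rg_n(T(𝒩)) is not dense in T(𝒩)^n (rtsr(T(𝒩)) = ∞); (ii) if there is a constant D with d_j ≤ D for all j ≥ 0, then Rg_2(T(𝒩)) is dense in T(𝒩)^2 while Rg_1(T(𝒩)) is not dense in T(𝒩) (rtsr(T(𝒩)) = 2). -/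
/-- The dimension `n_k = dim N_k − dim N_{k−1}` of the `k`-th atom (`k ≥ 1`). -/
noncomputable def atomDim {H : Type*} [NormedAddCommGroup H] [InnerProductSpace ℂ H]
    (N : ℕ → Submodule ℂ H) (k : ℕ) : ℕ :=
  Module.finrank ℂ ↥(N k) - Module.finrank ℂ ↥(N (k - 1))

/-- Membership of the index `k` in the `j`-th dyadic class:
`k ≥ 1` and `2^{j-1} < n_k ≤ 2^j` (phrased as `2^j < 2·n_k ∧ n_k ≤ 2^j`). -/
def InDyadicClass {H : Type*} [NormedAddCommGroup H] [InnerProductSpace ℂ H]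
    (N : ℕ → Submodule ℂ H) (j k : ℕ) : Prop :=
  1 ≤ k ∧ 2 ^ j < 2 * atomDim N k ∧ atomDim N k ≤ 2 ^ j

open ContinuousLinearMap in
theorem Orthonormal.exists_isometry_lp {ι E : Type*} [DecidableEq ι] [NormedAddCommGroup E]
    [InnerProductSpace ℂ E] [CompleteSpace E] {u : ι → E} (hu : Orthonormal ℂ u) :
    ∃ U : lp (fun _ : ι => ℂ) 2 →L[ℂ] E, ‖U‖ ≤ 1 ∧
      (∀ a, U (lp.single 2 a 1) = u a) ∧
      (∀ a, adjoint U (u a) = lp.single 2 a 1) ∧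
      (∀ x, (∀ a, inner ℂ (u a) x = 0) → adjoint U x = 0) := by
  let U := hu.orthogonalFamily.linearIsometry
  have h1 : ∀ a, U (lp.single 2 a (1 : ℂ)) = u a := by
    intro a
    simp [U, OrthogonalFamily.linearIsometry_apply_single]
  have h2 : ∀ x a, (adjoint U.toContinuousLinearMap x) a = inner ℂ (u a) x := by
    intro x a
    have := adjoint_inner_right U.toContinuousLinearMap (lp.single 2 a (1 : ℂ)) x
    rw [lp.inner_single_left] at this
    simpa [h1] using this
  refine ⟨U.toContinuousLinearMap, U.norm_toContinuousLinearMap_le, h1, ?_, ?_⟩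
  · intro a
    ext b
    rw [h2, orthonormal_iff_ite.mp hu]
    simp [lp.single_apply, Pi.single_apply]
  · intro x hx
    ext b
    rw [h2, hx]; rfl

/-- The partial isometry taking one orthonormal family to another, with its adjoint. -/
theorem exists_partialIsometry {ι E F : Type*} [NormedAddCommGroup E] [InnerProductSpace ℂ E]
    [CompleteSpace E] [NormedAddCommGroup F] [InnerProductSpace ℂ F] [CompleteSpace F]
    {u : ι → E} {v : ι → F} (hu : Orthonormal ℂ u) (hv : Orthonormal ℂ v) :
    ∃ (T : E →L[ℂ] F) (S : F →L[ℂ] E), ‖T‖ ≤ 1 ∧ ‖S‖ ≤ 1 ∧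
      (∀ x y, inner ℂ (S y) x = inner ℂ y (T x)) ∧
      (∀ a, T (u a) = v a) ∧ (∀ a, S (v a) = u a) ∧
      (∀ x, (∀ a, inner ℂ (u a) x = 0) → T x = 0) ∧
      (∀ y, (∀ a, inner ℂ (v a) y = 0) → S y = 0) := by
  classical
  obtain ⟨U, hU, hU1, hU2, hU3⟩ := hu.exists_isometry_lp
  obtain ⟨V, hV, hV1, hV2, hV3⟩ := hv.exists_isometry_lp
  have hT : ‖V ∘L ContinuousLinearMap.adjoint U‖ ≤ 1 := by
    refine (ContinuousLinearMap.opNorm_comp_le _ _).trans ?_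
    rw [LinearIsometryEquiv.norm_map]
    exact mul_le_one₀ hV (norm_nonneg _) hU
  have hS : ‖U ∘L ContinuousLinearMap.adjoint V‖ ≤ 1 := by
    refine (ContinuousLinearMap.opNorm_comp_le _ _).trans ?_
    rw [LinearIsometryEquiv.norm_map]
    exact mul_le_one₀ hU (norm_nonneg _) hV
  refine ⟨V ∘L ContinuousLinearMap.adjoint U, U ∘L ContinuousLinearMap.adjoint V, hT, hS,
    fun x y => ?_, fun a => ?_, fun a => ?_, fun x hx => ?_, fun y hy => ?_⟩
  · rw [ContinuousLinearMap.comp_apply, ContinuousLinearMap.comp_apply,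
      ← ContinuousLinearMap.adjoint_inner_right, ContinuousLinearMap.adjoint_inner_left]
  · simp [hU2, hV1]
  · simp [hV2, hU1]
  · simp [hU3 x hx]
  · simp [hV3 y hy]

theorem StrictMono.exists_le_lt_succ {s : ℕ → ℕ} (hs : StrictMono s) (h0 : s 0 = 0) (a : ℕ) :
    ∃ k, s k ≤ a ∧ a < s (k + 1) := by
  have hex : ∃ k, a < s k := ⟨a + 1, hs.le_apply⟩
  classical
  obtain ⟨k, hk⟩ : ∃ k, Nat.find hex = k + 1 := by
    refine Nat.exists_eq_succ_of_ne_zero fun h => ?_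
    have := Nat.find_spec hex
    rw [h, h0] at this
    omega
  refine ⟨k, ?_, hk ▸ Nat.find_spec hex⟩
  have := Nat.find_min hex (m := k) (by omega)
  omega

/-- An orthonormal sequence whose first `s k` terms span `N k`, and which is total. -/
structure IsAdapted {H : Type*} [NormedAddCommGroup H] [InnerProductSpace ℂ H]
    (N : ℕ → Submodule ℂ H) (s : ℕ → ℕ) (e : ℕ → H) : Prop where
  orth : Orthonormal ℂ e
  total : ∀ x, (∀ a, inner ℂ (e a) x = 0) → x = 0
  span_eq : ∀ k, N k = Submodule.span ℂ (e '' Set.Iio (s k))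
  strictMono : StrictMono s
  zero : s 0 = 0

namespace IsAdapted

variable {H : Type*} [NormedAddCommGroup H] [InnerProductSpace ℂ H]
  {N : ℕ → Submodule ℂ H} {s : ℕ → ℕ} {e : ℕ → H}

theorem inner_eq (h : IsAdapted N s e) (a b : ℕ) :
    inner ℂ (e a) (e b) = if a = b then (1 : ℂ) else 0 :=
  orthonormal_iff_ite.mp h.orth a b

theorem basis_mem (h : IsAdapted N s e) {a k : ℕ} (ha : a < s k) : e a ∈ N k := by
  rw [h.span_eq]
  exact Submodule.subset_span ⟨a, ha, rfl⟩

theorem induction_mem (h : IsAdapted N s e) {k : ℕ} {p : H → Prop} (h0 : p 0)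
    (hadd : ∀ x y, p x → p y → p (x + y)) (hsmul : ∀ (c : ℂ) x, p x → p (c • x))
    (hb : ∀ a < s k, p (e a)) {x : H} (hx : x ∈ N k) : p x := by
  rw [h.span_eq] at hx
  induction hx using Submodule.span_induction with
  | mem x hx => obtain ⟨a, ha, rfl⟩ := hx; exact hb a ha
  | zero => exact h0
  | add x y _ _ hx hy => exact hadd x y hx hy
  | smul c x _ hx => exact hsmul c x hx

theorem mem_iff (h : IsAdapted N s e) {k : ℕ} {x : H} :
    x ∈ N k ↔ ∀ a, s k ≤ a → inner ℂ (e a) x = 0 := by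
  constructor
  · intro hx a ha
    refine h.induction_mem (p := fun x => inner ℂ (e a) x = 0) (by simp) ?_ ?_ ?_ hx
    · intro x y hx hy; rw [inner_add_right, hx, hy, add_zero]
    · intro c x hx; rw [inner_smul_right, hx, mul_zero]
    · intro b hb; rw [h.inner_eq, if_neg (by omega)]
  · intro hx
    have : x - ∑ b ∈ Finset.range (s k), inner ℂ (e b) x • e b = 0 := by
      refine h.total _ fun a => ?_
      rw [inner_sub_right, inner_sum]
      simp only [inner_smul_right, h.inner_eq, mul_ite, mul_one, mul_zero, Finset.sum_ite_eq,
        Finset.mem_range]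
      split_ifs with ha
      · simp
      · rw [hx a (by omega)]; simp
    rw [sub_eq_zero.mp this]
    exact Submodule.sum_mem _ fun b hb =>
      Submodule.smul_mem _ _ (h.basis_mem (Finset.mem_range.mp hb))

theorem dense_span [CompleteSpace H] (h : IsAdapted N s e) :
    Dense (Submodule.span ℂ (Set.range e) : Set H) := by
  rw [Submodule.dense_iff_topologicalClosure_eq_top, Submodule.topologicalClosure_eq_top_iff,
    Submodule.eq_bot_iff]
  intro x hx
  exact h.total x fun a => hx _ (Submodule.subset_span ⟨a, rfl⟩)

theorem clm_ext [CompleteSpace H] {F : Type*} [NormedAddCommGroup F] [NormedSpace ℂ F]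
    (h : IsAdapted N s e) {T S : H →L[ℂ] F} (hT : ∀ a, T (e a) = S (e a)) : T = S :=
  ContinuousLinearMap.ext_on h.dense_span (by rintro _ ⟨a, rfl⟩; exact hT a)

theorem finrank_eq (h : IsAdapted N s e) (k : ℕ) : Module.finrank ℂ (N k) = s k := by
  rw [h.span_eq, Set.image_eq_range]
  exact (finrank_span_eq_card (h.orth.linearIndependent.comp (fun x : Set.Iio (s k) => (x : ℕ))
    Subtype.val_injective)).trans (by simp)

end IsAdapted

theorem exists_orthonormal_ker {E V : Type*} [NormedAddCommGroup E] [InnerProductSpace ℂ E]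
    [AddCommGroup V] [Module ℂ V] [FiniteDimensional ℂ V] {X : Submodule ℂ E}
    [FiniteDimensional ℂ X] (L : X →ₗ[ℂ] V) (S : Finset ℕ)
    (hS : S.card + Module.finrank ℂ V ≤ Module.finrank ℂ X) :
    ∃ v : ℕ → E, (∀ a, ∃ hv : v a ∈ X, L ⟨v a, hv⟩ = 0) ∧
      ∀ a ∈ S, ∀ b ∈ S, inner ℂ (v a) (v b) = if a = b then (1 : ℂ) else 0 := by
  classical
  have h1 : S.card ≤ Module.finrank ℂ L.ker := by
    have := L.finrank_range_add_finrank_ker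
    have := L.range.finrank_le
    omega
  let b := stdOrthonormalBasis ℂ L.ker
  let f : S ≃ Fin S.card := S.equivFin
  refine ⟨fun a => if ha : a ∈ S then ((b (Fin.castLE h1 (f ⟨a, ha⟩)) : X) : E) else 0, ?_, ?_⟩
  · intro a
    by_cases ha : a ∈ S
    · simp only [ha, dite_true]
      exact ⟨(b _ : X).2, (b (Fin.castLE h1 (f ⟨a, ha⟩))).2⟩
    · simp only [ha, dite_false]
      exact ⟨zero_mem _, L.map_zero⟩
  · intro a ha c hc
    simp only [ha, hc, dite_true]
    have := orthonormal_iff_ite.mp b.orthonormal (Fin.castLE h1 (f ⟨a, ha⟩))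
      (Fin.castLE h1 (f ⟨c, hc⟩))
    rw [← Submodule.coe_inner, ← Submodule.coe_inner, this]
    simp

/-- `T` maps each member of the filtration `M` into the corresponding member of `N`. -/
def Triangular {E F : Type*} [NormedAddCommGroup E] [NormedSpace ℂ E] [NormedAddCommGroup F]
    [NormedSpace ℂ F] (M : ℕ → Submodule ℂ E) (N : ℕ → Submodule ℂ F) (T : E →L[ℂ] F) : Prop :=
  ∀ k, ∀ x ∈ M k, T x ∈ N k

theorem card_residue_le {m i s t : ℕ} (ht : t ≤ m * (t - s)) :
    ((Finset.range t).filter (fun b => b % m < i + 1)).card +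
        ((Finset.Ico s t).filter (fun b => b % m = i)).card ≤
      ((Finset.range s).filter (fun b => b % m < i)).card + 2 * (t - s) := by
  have h1 : ((Finset.range t).filter (fun b => b % m = i)).card ≤ t - s := by
    rw [← Finset.card_range (t - s)]
    refine Finset.card_le_card_of_injOn (fun b => b / m) ?_ ?_
    · intro b hb
      simp only [Finset.coe_filter, Finset.mem_range, Set.mem_ofPred_eq] at hb
      simpa using Nat.div_lt_of_lt_mul (by omega : b < m * (t - s))
    · intro a ha b hb hab
      simp only [Finset.coe_filter, Finset.mem_range, Set.mem_ofPred_eq] at ha hb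
      rw [← Nat.div_add_mod a m, ← Nat.div_add_mod b m, ha.2, hb.2]
      simp only at hab
      rw [hab]
  have h2 : ((Finset.Ico s t).filter (fun b => b % m < i)).card +
      ((Finset.Ico s t).filter (fun b => b % m = i)).card ≤ t - s := by
    rw [← Finset.card_union_of_disjoint, ← Nat.card_Ico]
    · refine Finset.card_le_card fun b hb => ?_
      simp only [Finset.mem_union, Finset.mem_filter] at hb
      tauto
    · rw [Finset.disjoint_filter]
      intros; omega
  have h3 : ((Finset.range t).filter (fun b => b % m < i + 1)).card ≤
      (((Finset.range s).filter (fun b => b % m < i)).card +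
        ((Finset.Ico s t).filter (fun b => b % m < i)).card) +
        ((Finset.range t).filter (fun b => b % m = i)).card := by
    refine le_trans (Finset.card_le_card ?_) ((Finset.card_union_le _ _).trans
      (Nat.add_le_add_right (Finset.card_union_le _ _) _))
    intro b hb
    simp only [Finset.mem_union, Finset.mem_filter, Finset.mem_range, Finset.mem_Ico] at hb ⊢
    omega
  omega

section Step

variable {E H : Type*} [NormedAddCommGroup E] [InnerProductSpace ℂ E]
  [NormedAddCommGroup H] [InnerProductSpace ℂ H]
  {N : ℕ → Submodule ℂ H} {s : ℕ → ℕ} {e : ℕ → H} {M : ℕ → Submodule ℂ E}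

/-- The operator `C` is supported on the rows in `p`, where it is a right inverse of `B`. -/
structure IsRightInvOn (e : ℕ → H) (p : ℕ → Prop) (B : E →L[ℂ] H) (C : H →L[ℂ] E) : Prop where
  inner_eq : ∀ b, p b → ∀ y, inner ℂ (e b) (B (C y)) = inner ℂ (e b) y
  eq_zero : ∀ y, (∀ b, p b → inner ℂ (e b) y = 0) → C y = 0

theorem IsRightInvOn.finrank_ker_add_card_le (hN : IsAdapted N s e)
    [∀ k, FiniteDimensional ℂ (M k)] {p : ℕ → Prop} [DecidablePred p] {B : E →L[ℂ] H}
    {C : H →L[ℂ] E} (hC : Triangular N M C) (h : IsRightInvOn e p B C) (k : ℕ) :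
    Module.finrank ℂ ↥(M k ⊓ (C ∘L B).ker) + ((Finset.range (s k)).filter p).card ≤
      Module.finrank ℂ (M k) := by
  classical
  obtain ⟨F, hF⟩ : ∃ F, (Finset.range (s k)).filter p = F := ⟨_, rfl⟩
  have hFm : ∀ b ∈ F, b < s k ∧ p b := fun b hb => by simpa [← hF] using hb
  rw [hF]
  let R : M k →ₗ[ℂ] (F → ℂ) := LinearMap.pi fun b : F =>
    ((innerSL ℂ (e b)) ∘L B).toLinearMap ∘ₗ (M k).subtype
  have hR : ∀ x b, R x b = inner ℂ (e b) (B x) := fun x b => rfl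
  have hsurj : Function.Surjective R := by
    intro c
    have hmem : ∑ b : F, c b • e b ∈ N k := Submodule.sum_mem _ fun b _ =>
      Submodule.smul_mem _ _ (hN.basis_mem (hFm b b.2).1)
    refine ⟨⟨C (∑ b : F, c b • e b), hC k _ hmem⟩, ?_⟩
    ext a
    rw [hR, h.inner_eq _ (hFm a a.2).2, inner_sum]
    simp only [inner_smul_right, hN.inner_eq]
    simp
  have h1 := R.finrank_range_add_finrank_ker
  rw [LinearMap.range_eq_top.mpr hsurj, finrank_top, Module.finrank_fintype_fun_eq_card,
    Fintype.card_coe] at h1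
  have h2 : Module.finrank ℂ ↥(M k ⊓ (C ∘L B).ker) ≤ Module.finrank ℂ R.ker := by
    rw [← (Submodule.comapSubtypeEquivOfLe
      (inf_le_left : M k ⊓ (C ∘L B).ker ≤ M k)).finrank_eq]
    refine Submodule.finrank_mono fun x hx => ?_
    have hx2 : C (B x) = 0 := by simpa using hx
    ext b
    rw [hR, ← h.inner_eq _ (hFm b b.2).2, hx2]
    simp
  omega

theorem IsRightInvOn.exists_orthonormal (hN : IsAdapted N s e)
    [∀ k, FiniteDimensional ℂ (M k)] (hM : Monotone M)
    (hfr : ∀ k, Module.finrank ℂ (M k) = 2 * s k)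
    {m i : ℕ} (hm : ∀ k, s (k + 1) ≤ m * (s (k + 1) - s k)) {B : E →L[ℂ] H} {C : H →L[ℂ] E}
    (hB : Triangular M N B) (hC : Triangular N M C)
    (h : IsRightInvOn e (fun a => a % m < i) B C) :
    ∃ u : {a : ℕ // a % m = i} → E, Orthonormal ℂ u ∧
      (∀ a, ∀ b, b % m < i + 1 → inner ℂ (e b) (B (u a)) = 0) ∧
      (∀ a : {a : ℕ // a % m = i}, ∀ k, (a : ℕ) < s k → u a ∈ M k) ∧
      (∀ a : {a : ℕ // a % m = i}, ∀ k, s k ≤ (a : ℕ) → ∀ x ∈ M k, C (B x) = 0 →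
        inner ℂ (u a) x = 0) := by
  classical
  have key : ∀ k, ∃ v : ℕ → E, (∀ a, v a ∈ M (k + 1) ∧
      (∀ b, b % m < i + 1 → inner ℂ (e b) (B (v a)) = 0) ∧
      (∀ x ∈ M k, C (B x) = 0 → inner ℂ (v a) x = 0)) ∧
      ∀ a ∈ (Finset.Ico (s k) (s (k + 1))).filter (fun b => b % m = i),
      ∀ b ∈ (Finset.Ico (s k) (s (k + 1))).filter (fun b => b % m = i),
        inner ℂ (v a) (v b) = if a = b then (1 : ℂ) else 0 := by
    intro k
    have h1 := h.finrank_ker_add_card_le hN hC k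
    have h2 := card_residue_le (i := i) (hm k)
    have h3 := hN.strictMono (Nat.lt_add_one k)
    obtain ⟨F, hF⟩ : ∃ F, (Finset.range (s (k + 1))).filter (fun b => b % m < i + 1) = F :=
      ⟨_, rfl⟩
    have hFm : ∀ b, b < s (k + 1) → b % m < i + 1 → b ∈ F := fun b hb hb' => by
      simpa [← hF, hb] using Nat.le_of_lt_succ hb'
    obtain ⟨W, hW⟩ : ∃ W, M k ⊓ (C ∘L B).ker = W := ⟨_, rfl⟩
    rw [hF] at h2
    rw [hW] at h1
    have : FiniteDimensional ℂ W := hW ▸ Submodule.finiteDimensional_inf_left _ _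
    let L : M (k + 1) →ₗ[ℂ] (F → ℂ) × W :=
      (LinearMap.pi fun b : F => ((innerSL ℂ (e b)) ∘L B).toLinearMap ∘ₗ (M (k + 1)).subtype).prod
        (W.orthogonalProjectionOnto.toLinearMap ∘ₗ (M (k + 1)).subtype)
    have hcard : ((Finset.Ico (s k) (s (k + 1))).filter (fun b => b % m = i)).card +
        Module.finrank ℂ ((F → ℂ) × W) ≤ Module.finrank ℂ (M (k + 1)) := by
      rw [Module.finrank_prod, Module.finrank_fintype_fun_eq_card, Fintype.card_coe, hfr]
      rw [hfr] at h1
      omega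
    obtain ⟨v, hv1, hv2⟩ := exists_orthonormal_ker L _ hcard
    refine ⟨v, fun a => ?_, hv2⟩
    obtain ⟨hva, hLa⟩ := hv1 a
    have hL1 : (L ⟨v a, hva⟩).1 = 0 := by rw [hLa]; rfl
    have hL2 : W.orthogonalProjectionOnto (v a) = 0 := by
      have : (L ⟨v a, hva⟩).2 = 0 := by rw [hLa]; rfl
      exact this
    refine ⟨hva, fun b hb => ?_, fun x hx hx2 => ?_⟩
    · by_cases hbs : b < s (k + 1)
      · exact congrFun hL1 ⟨b, hFm b hbs hb⟩
      · exact hN.mem_iff.mp (hB _ _ hva) b (by omega)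
    · have : v a ∈ Wᗮ := by
        rwa [← Submodule.orthogonalProjectionOnto_eq_zero_iff]
      exact Submodule.inner_left_of_mem_orthogonal (K := W)
        (hW ▸ ⟨hx, by simpa using hx2⟩) this
  choose v hv hvo using key
  choose κ hκ1 hκ2 using hN.strictMono.exists_le_lt_succ hN.zero
  have hmem : ∀ (a : {a : ℕ // a % m = i}) k, (a : ℕ) < s k → v (κ a) a ∈ M k := by
    intro a k hak
    have : κ a < k := hN.strictMono.lt_iff_lt.mp ((hκ1 a).trans_lt hak)
    exact hM (Nat.succ_le_of_lt this) (hv (κ a) a).1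
  have hker : ∀ (a : {a : ℕ // a % m = i}), C (B (v (κ a) a)) = 0 := fun a =>
    h.eq_zero _ fun b hb => (hv (κ a) a).2.1 b (by omega)
  have hperp : ∀ (a : {a : ℕ // a % m = i}) k, s k ≤ (a : ℕ) → ∀ x ∈ M k, C (B x) = 0 →
      inner ℂ (v (κ a) a) x = 0 := by
    intro a k hak x hx hx2
    have : k < κ a + 1 := hN.strictMono.lt_iff_lt.mp (hak.trans_lt (hκ2 a))
    exact (hv (κ a) a).2.2 x (hM (Nat.le_of_lt_succ this) hx) hx2
  refine ⟨fun a => v (κ a) a, ?_, fun a b hb => (hv (κ a) a).2.1 b hb, hmem, hperp⟩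
  rw [orthonormal_iff_ite]
  intro a b
  rcases lt_trichotomy (κ a) (κ b) with hab | hab | hab
  · have hlt : (a : ℕ) < b := (hκ2 a).trans_le
      ((hN.strictMono.monotone (Nat.succ_le_of_lt hab)).trans (hκ1 b))
    rw [if_neg (fun hh => by rw [hh] at hlt; omega), ← inner_conj_symm,
      hperp b (κ a + 1) ((hN.strictMono.monotone (Nat.succ_le_of_lt hab)).trans (hκ1 b)) _
        (hmem a _ (hκ2 a)) (hker a), map_zero]
  · have ha : (a : ℕ) ∈ (Finset.Ico (s (κ a)) (s (κ a + 1))).filter (fun b => b % m = i) := by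
      simp [hκ1, hκ2, a.2]
    have hb : (b : ℕ) ∈ (Finset.Ico (s (κ a)) (s (κ a + 1))).filter (fun b => b % m = i) := by
      rw [hab]; simp [hκ1, hκ2, b.2]
    have := hvo (κ a) a ha b hb
    rw [← hab, this]
    simp [Subtype.ext_iff]
  · have hlt : (b : ℕ) < a := (hκ2 b).trans_le
      ((hN.strictMono.monotone (Nat.succ_le_of_lt hab)).trans (hκ1 a))
    rw [if_neg (fun hh => by rw [hh] at hlt; omega),
      hperp a (κ b + 1) ((hN.strictMono.monotone (Nat.succ_le_of_lt hab)).trans (hκ1 a)) _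
        (hmem b _ (hκ2 b)) (hker b)]

theorem IsRightInvOn.exists_succ [CompleteSpace E] [CompleteSpace H] (hN : IsAdapted N s e)
    [∀ k, FiniteDimensional ℂ (M k)] (hM : Monotone M)
    (hfr : ∀ k, Module.finrank ℂ (M k) = 2 * s k)
    {m i : ℕ} (hm : ∀ k, s (k + 1) ≤ m * (s (k + 1) - s k)) {B : E →L[ℂ] H} {C : H →L[ℂ] E}
    (hB : Triangular M N B) (hC : Triangular N M C)
    (h : IsRightInvOn e (fun a => a % m < i) B C) {ε : ℝ} (hε : 0 < ε) :
    ∃ (B' : E →L[ℂ] H) (C' : H →L[ℂ] E), Triangular M N B' ∧ Triangular N M C' ∧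
      ‖B' - B‖ < ε ∧ IsRightInvOn e (fun a => a % m < i + 1) B' C' := by
  obtain ⟨u, hu, hBu, huM, hperp⟩ := h.exists_orthonormal hN hM hfr hm hB hC
  have hJ : Orthonormal ℂ (fun a : {a : ℕ // a % m = i} => e a) :=
    hN.orth.comp _ Subtype.val_injective
  obtain ⟨W, S, hW, -, hadj, hWu, hSe, -, hS0⟩ := exists_partialIsometry hu hJ
  have hSe0 : ∀ b, b % m ≠ i → S (e b) = 0 := fun b hb => hS0 _ fun a => by
    rw [hN.inner_eq, if_neg]
    intro hab
    exact hb (hab ▸ a.2)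
  let Q : E →L[ℂ] E := 1 - C ∘L B
  have hQ : ∀ x, Q x = x - C (B x) := fun x => rfl
  have hBS : ∀ b, b % m < i + 1 → ∀ z, inner ℂ (e b) (B (S z)) = 0 := by
    intro b hb z
    have : (innerSL ℂ (e b)) ∘L B ∘L S = 0 := hN.clm_ext fun a => by
      change inner ℂ (e b) (B (S (e a))) = 0
      by_cases ha : a % m = i
      · rw [hSe ⟨a, ha⟩, hBu _ b hb]
      · rw [hSe0 a ha, map_zero, inner_zero_right]
    exact DFunLike.congr_fun this z
  have hQS : ∀ z, Q (S z) = S z := fun z => by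
    rw [hQ, h.eq_zero _ fun b hb => hBS b (by omega) z, sub_zero]
  have hCBQ : ∀ x, C (B (Q x)) = 0 := fun x => h.eq_zero _ fun b hb => by
    rw [hQ, map_sub, inner_sub_right, h.inner_eq b hb, sub_self]
  have hQM : Triangular M M Q := fun k x hx =>
    (M k).sub_mem hx (hC k _ (hB k x hx))
  have hWQ : Triangular M N (W ∘L Q) := fun k x hx => hN.mem_iff.mpr fun a ha => by
    rw [ContinuousLinearMap.comp_apply, ← hadj]
    by_cases hai : a % m = i
    · rw [hSe ⟨a, hai⟩, hperp ⟨a, hai⟩ k ha _ (hQM k x hx) (hCBQ x)]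
    · rw [hSe0 a hai, inner_zero_left]
  have hST : Triangular N M S := fun k x hx => by
    refine hN.induction_mem (p := fun x => S x ∈ M k) (by simp) ?_ ?_ ?_ hx
    · intro x y hx hy; rw [map_add]; exact add_mem hx hy
    · intro c x hx; rw [map_smul]; exact (M k).smul_mem c hx
    · intro a ha
      by_cases hai : a % m = i
      · rw [hSe ⟨a, hai⟩]; exact huM ⟨a, hai⟩ k ha
      · rw [hSe0 a hai]; exact zero_mem _
  obtain ⟨δ, hδ, hδε⟩ : ∃ δ : ℝ, 0 < δ ∧ δ * ‖W ∘L Q‖ < ε := by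
    refine ⟨ε / (‖W ∘L Q‖ + 1), by positivity, ?_⟩
    rw [div_mul_eq_mul_div, div_lt_iff₀ (by positivity)]
    nlinarith [norm_nonneg (W ∘L Q)]
  have hδ0 : (δ : ℂ) ≠ 0 := by exact_mod_cast hδ.ne'
  let B' : E →L[ℂ] H := B + (δ : ℂ) • (W ∘L Q)
  have hB' : ∀ x, B' x = B x + (δ : ℂ) • W (Q x) := fun x => rfl
  let C' : H →L[ℂ] E := C + (δ : ℂ)⁻¹ • (S ∘L (1 - B' ∘L C))
  have hC' : ∀ y, C' y = C y + (δ : ℂ)⁻¹ • S (y - B' (C y)) := fun y => rfl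
  have hB'M : Triangular M N B' := fun k x hx =>
    (N k).add_mem (hB k x hx) ((N k).smul_mem _ (hWQ k x hx))
  refine ⟨B', C', hB'M, fun k x hx => ?_, ?_, ⟨fun b hb y => ?_, fun y hy => ?_⟩⟩
  · exact (M k).add_mem (hC k x hx) ((M k).smul_mem _
      (hST k _ ((N k).sub_mem hx (hB'M k _ (hC k x hx)))))
  · rw [show B' - B = (δ : ℂ) • (W ∘L Q) by simp [B'], norm_smul]
    simpa [abs_of_pos hδ] using hδε
  · have hB'S : ∀ z, inner ℂ (e b) (B' (S z)) = δ * inner ℂ (S (e b)) (S z) := fun z => by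
      rw [hB', hQS, inner_add_right, hBS b hb, inner_smul_right, hadj, zero_add]
    rw [hC', map_add, map_smul, inner_add_right, inner_smul_right, hB'S,
      inv_mul_cancel_left₀ hδ0]
    by_cases hbi : b % m = i
    · have hSS : ∀ z, inner ℂ (S (e b)) (S z) = inner ℂ (e b) z := fun z => by
        rw [← inner_conj_symm, hadj, hSe ⟨b, hbi⟩, hWu, inner_conj_symm]
      rw [hSS, inner_sub_right, add_sub_cancel]
    · rw [hSe0 b hbi, inner_zero_left, add_zero, hB', inner_add_right, inner_smul_right, ← hadj,
        hSe0 b hbi, inner_zero_left, mul_zero, add_zero, h.inner_eq b (by omega)]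
  · have hCy : C y = 0 := h.eq_zero _ fun b hb => hy b (by omega)
    rw [hC', hCy, map_zero, sub_zero, zero_add, hS0 y fun a => hy a (by rw [a.2]; omega),
      smul_zero]

theorem exists_rightInv [CompleteSpace E] [CompleteSpace H] (hN : IsAdapted N s e)
    [∀ k, FiniteDimensional ℂ (M k)] (hM : Monotone M)
    (hfr : ∀ k, Module.finrank ℂ (M k) = 2 * s k)
    {m : ℕ} (hm : ∀ k, s (k + 1) ≤ m * (s (k + 1) - s k)) {A : E →L[ℂ] H}
    (hA : Triangular M N A) {ε : ℝ} (hε : 0 < ε) :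
    ∃ (B : E →L[ℂ] H) (C : H →L[ℂ] E), Triangular M N B ∧ Triangular N M C ∧
      ‖B - A‖ < ε ∧ B ∘L C = 1 := by
  have key : ∀ i, ∃ (B : E →L[ℂ] H) (C : H →L[ℂ] E), Triangular M N B ∧ Triangular N M C ∧
      ‖B - A‖ < ε ∧ IsRightInvOn e (fun a => a % m < i) B C := by
    intro i
    induction i with
    | zero =>
      exact ⟨A, 0, hA, fun k x _ => zero_mem _, by simpa using hε,
        ⟨fun b hb => by simp at hb, fun y _ => rfl⟩⟩
    | succ i ih =>
      obtain ⟨B, C, hB, hC, hBA, h⟩ := ih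
      obtain ⟨B', C', hB', hC', hBB, h'⟩ := h.exists_succ hN hM hfr hm hB hC (sub_pos.mpr hBA)
      refine ⟨B', C', hB', hC', ?_, h'⟩
      have := norm_sub_le_norm_sub_add_norm_sub B' B A
      linarith
  have hm0 : 0 < m := by
    rcases Nat.eq_zero_or_pos m with rfl | h
    · have h1 := hm 0
      have h2 := hN.strictMono (Nat.lt_add_one 0)
      simp at h1 h2
      omega
    · exact h
  obtain ⟨B, C, hB, hC, hBA, h⟩ := key m
  refine ⟨B, C, hB, hC, hBA, ?_⟩
  ext y
  change B (C y) = y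
  rw [← sub_eq_zero]
  refine hN.total _ fun a => ?_
  rw [inner_sub_right, h.inner_eq a (Nat.mod_lt _ hm0), sub_self]

end Step

theorem IsOmegaNest.exists_isAdapted {H : Type*} [NormedAddCommGroup H] [InnerProductSpace ℂ H]
    [CompleteSpace H] {N : ℕ → Submodule ℂ H} (hN : IsOmegaNest N) :
    ∃ e, IsAdapted N (fun k => Module.finrank ℂ (N k)) e := by
  classical
  have hfd := hN.finiteDim
  obtain ⟨s, hs⟩ : ∃ s : ℕ → ℕ, ∀ k, s k = Module.finrank ℂ (N k) := ⟨_, fun _ => rfl⟩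
  simp only [← hs]
  have hmono : StrictMono s := strictMono_nat_of_lt_succ fun k => by
    rw [hs, hs]
    exact Submodule.finrank_lt_finrank_of_lt (hN.strictMono (Nat.lt_add_one k))
  have hzero : s 0 = 0 := by rw [hs, hN.bot, finrank_bot]
  have key : ∀ k, ∃ v : ℕ → H, (∀ a, v a ∈ (N k)ᗮ ∧ v a ∈ N (k + 1)) ∧
      ∀ a ∈ Finset.Ico (s k) (s (k + 1)), ∀ b ∈ Finset.Ico (s k) (s (k + 1)),
        inner ℂ (v a) (v b) = if a = b then (1 : ℂ) else 0 := by
    intro k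
    have h1 := Submodule.finrank_add_inf_finrank_orthogonal
      (hN.strictMono.monotone (Nat.le_add_right k 1))
    rw [← hs, ← hs] at h1
    have : FiniteDimensional ℂ ↥((N k)ᗮ ⊓ N (k + 1)) := Submodule.finiteDimensional_inf_right _ _
    obtain ⟨v, hv1, hv2⟩ := exists_orthonormal_ker
      (0 : ↥((N k)ᗮ ⊓ N (k + 1)) →ₗ[ℂ] (Fin 0 → ℂ)) (Finset.Ico (s k) (s (k + 1))) (by
        rw [Nat.card_Ico, Module.finrank_fin_fun]
        omega)
    exact ⟨v, fun a => (hv1 a).1, hv2⟩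
  choose v hv hvo using key
  choose κ hκ1 hκ2 using hmono.exists_le_lt_succ hzero
  have hmem : ∀ a k, a < s k → v (κ a) a ∈ N k := fun a k hak =>
    hN.strictMono.monotone (Nat.succ_le_of_lt (hmono.lt_iff_lt.mp ((hκ1 a).trans_lt hak)))
      (hv (κ a) a).2
  have hlt : ∀ a b, κ a < κ b → inner ℂ (v (κ a) a) (v (κ b) b) = 0 := fun a b hab =>
    (hv (κ b) b).1 _ (hmem a _ ((hκ2 a).trans_le (hmono.monotone (Nat.succ_le_of_lt hab))))
  have horth : Orthonormal ℂ (fun a => v (κ a) a) := by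
    rw [orthonormal_iff_ite]
    intro a b
    rcases lt_trichotomy (κ a) (κ b) with hab | hab | hab
    · rw [hlt a b hab, if_neg (by rintro rfl; omega)]
    · have := hvo (κ a) a (Finset.mem_Ico.mpr ⟨hκ1 a, hκ2 a⟩) b
        (hab ▸ Finset.mem_Ico.mpr ⟨hκ1 b, hκ2 b⟩)
      rw [← hab, this]
    · rw [← inner_conj_symm, hlt b a hab, map_zero, if_neg (by rintro rfl; omega)]
  have hspan : ∀ k, N k = Submodule.span ℂ ((fun a => v (κ a) a) '' Set.Iio (s k)) := by
    intro k
    symm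
    apply Submodule.eq_of_le_of_finrank_eq
    · rw [Submodule.span_le]
      rintro _ ⟨a, ha, rfl⟩
      exact hmem a k ha
    · rw [Set.image_eq_range, ← hs]
      exact (finrank_span_eq_card (horth.linearIndependent.comp
        (fun x : Set.Iio (s k) => (x : ℕ)) Subtype.val_injective)).trans (by simp)
  refine ⟨fun a => v (κ a) a, horth, fun x hx => ?_, hspan, hmono, hzero⟩
  refine hN.dense.eq_zero_of_inner_left ℂ fun y hy => ?_
  obtain ⟨k, hk⟩ := Set.mem_iUnion.mp hy
  rw [SetLike.mem_coe, hspan k] at hk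
  clear hy
  induction hk using Submodule.span_induction with
  | mem y hy =>
    obtain ⟨a, -, rfl⟩ := hy
    exact inner_eq_zero_symm.mp (hx a)
  | zero => exact inner_zero_right _
  | add y z _ _ hy hz => rw [inner_add_right, hy, hz, add_zero]
  | smul c y _ hy => rw [inner_smul_right, hy, mul_zero]

/-- The filtration of the Hilbert space direct sum `H ⊕ ⋯ ⊕ H` induced by a filtration of `H`. -/
def piFiltration {H : Type*} [NormedAddCommGroup H] [InnerProductSpace ℂ H] (n : ℕ)
    (N : ℕ → Submodule ℂ H) (k : ℕ) : Submodule ℂ (PiLp 2 fun _ : Fin n => H) where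
  carrier := {x | ∀ i, x i ∈ N k}
  add_mem' hx hy i := (N k).add_mem (hx i) (hy i)
  zero_mem' _ := (N k).zero_mem
  smul_mem' c _ hx i := (N k).smul_mem c (hx i)

section PiFiltration

variable {H : Type*} [NormedAddCommGroup H] [InnerProductSpace ℂ H] {n : ℕ}
  {N : ℕ → Submodule ℂ H}

theorem piFiltration_mono (hN : Monotone N) : Monotone (piFiltration n N) :=
  fun _ _ h _ hx i => hN h (hx i)

/-- The members of `piFiltration` are powers of the members of the original filtration. -/
def piFiltrationEquiv (n : ℕ) (N : ℕ → Submodule ℂ H) (k : ℕ) :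
    piFiltration n N k ≃ₗ[ℂ] (Fin n → N k) where
  toFun x i := ⟨x.1 i, x.2 i⟩
  map_add' _ _ := rfl
  map_smul' _ _ := rfl
  invFun f := ⟨WithLp.toLp 2 fun i => (f i : H), fun i => (f i).2⟩
  left_inv _ := rfl
  right_inv _ := rfl

theorem finiteDimensional_piFiltration (hN : ∀ k, FiniteDimensional ℂ (N k)) (k : ℕ) :
    FiniteDimensional ℂ (piFiltration n N k) :=
  (piFiltrationEquiv n N k).symm.finiteDimensional

theorem finrank_piFiltration (hN : ∀ k, FiniteDimensional ℂ (N k)) (k : ℕ) :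
    Module.finrank ℂ (piFiltration n N k) = n * Module.finrank ℂ (N k) := by
  rw [(piFiltrationEquiv n N k).finrank_eq, Module.finrank_pi_fintype]
  simp

end PiFiltration

theorem rgDenseIn_two {H : Type*} [NormedAddCommGroup H] [InnerProductSpace ℂ H]
    [CompleteSpace H] {N : ℕ → Submodule ℂ H} {e : ℕ → H} (hN : IsOmegaNest N)
    (he : IsAdapted N (fun k => Module.finrank ℂ (N k)) e) {m : ℕ}
    (hm : ∀ k, Module.finrank ℂ (N (k + 1)) ≤ m * atomDim N (k + 1)) :
    RgDenseIn (seqNestAlg N) 2 := by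
  intro a ha ε hε
  let P : Fin 2 → ((PiLp 2 fun _ : Fin 2 => H) →L[ℂ] H) := fun i => PiLp.proj 2 (fun _ => H) i
  let J : Fin 2 → (H →L[ℂ] (PiLp 2 fun _ : Fin 2 => H)) := fun i =>
    LinearMap.mkContinuous
      { toFun := fun x => WithLp.toLp 2 (Pi.single i x)
        map_add' := fun x y => by rw [Pi.single_add, WithLp.toLp_add]
        map_smul' := fun c x => by rw [Pi.single_smul, WithLp.toLp_smul]; rfl } 1 fun x => by
        rw [one_mul]
        exact (PiLp.norm_single 2 (fun _ : Fin 2 => H) i x).le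
  have hJ : ∀ i x, J i x = WithLp.toLp 2 (Pi.single i x) := fun _ _ => rfl
  have hP : ∀ i x, P i x = x i := fun _ _ => rfl
  have hJn : ∀ i, ‖J i‖ ≤ 1 := fun i => LinearMap.mkContinuous_norm_le _ zero_le_one _
  have hJm : ∀ i k x, x ∈ N k → J i x ∈ piFiltration 2 N k := by
    intro i k x hx j
    rw [hJ, PiLp.toLp_apply, Pi.single_apply]
    split_ifs
    exacts [hx, zero_mem _]
  have hPJ : ∑ i, J i ∘L P i = 1 := by
    ext x j
    fin_cases j <;> simp [hJ, hP]
  have := finiteDimensional_piFiltration (n := 2) hN.finiteDim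
  obtain ⟨B, C, hB, hC, hBA, hBC⟩ := exists_rightInv he (piFiltration_mono hN.strictMono.monotone)
    (finrank_piFiltration hN.finiteDim) hm (A := ∑ i, a i ∘L P i) (fun k x hx => by
      rw [sum_apply]
      exact Submodule.sum_mem _ fun i _ => ha i k _ (hx i)) hε
  refine ⟨fun i => B ∘L J i, fun i => P i ∘L C, fun i k x hx => hB k _ (hJm i k x hx),
    fun i k x hx => hC k x hx i, fun i => ?_, ?_⟩
  · have h1 : a i = (∑ i, a i ∘L P i) ∘L J i := by
      ext x
      fin_cases i <;> simp [hJ, hP]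
    rw [h1, ← ContinuousLinearMap.sub_comp]
    refine (ContinuousLinearMap.opNorm_comp_le _ _).trans_lt ?_
    rw [norm_sub_rev]
    exact (mul_le_of_le_one_right (norm_nonneg _) (hJn i)).trans_lt hBA
  · calc ∑ i, (B ∘L J i) * (P i ∘L C) = B ∘L (∑ i, J i ∘L P i) ∘L C := by
          ext x
          simp
      _ = 1 := by rw [hPJ]; exact hBC

theorem two_mul_le_of_card_dyadic_le {H : Type*} [NormedAddCommGroup H] [InnerProductSpace ℂ H]
    {N : ℕ → Submodule ℂ H} (hpos : ∀ k, 0 < atomDim N (k + 1))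
    (hmono : Monotone fun k => atomDim N (k + 1)) {D : ℕ}
    (hD : ∀ (j : ℕ) (S : Finset ℕ), (∀ k ∈ S, InDyadicClass N j k) → S.card ≤ D) (k : ℕ) :
    2 * atomDim N (k + 1) ≤ atomDim N (k + 2 * D + 1) := by
  by_contra! hlt
  obtain ⟨j, hj⟩ : ∃ j, Nat.clog 2 (atomDim N (k + 2 * D + 1)) = j := ⟨_, rfl⟩
  have h1 : atomDim N (k + 2 * D + 1) ≤ 2 ^ j := hj ▸ Nat.le_pow_clog one_lt_two _
  have h2 : 2 ^ j < 2 * atomDim N (k + 2 * D + 1) := by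
    rcases Nat.eq_zero_or_pos j with rfl | hj0
    · have := (hpos k).trans_le (hmono (show k ≤ k + 2 * D by omega))
      simp only at this
      omega
    · obtain ⟨i, rfl⟩ : ∃ i, j = i + 1 := ⟨j - 1, by omega⟩
      have := (Nat.lt_clog_iff_pow_lt one_lt_two).mp (hj ▸ Nat.lt_add_one i)
      rw [pow_succ]
      omega
  classical
  have hbd : ∀ r ∈ Finset.Icc (k + 1) (k + 2 * D + 1), atomDim N (k + 1) ≤ atomDim N r ∧
      atomDim N r ≤ atomDim N (k + 2 * D + 1) := by
    intro r hr
    rw [Finset.mem_Icc] at hr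
    obtain ⟨r, rfl⟩ : ∃ q, r = q + 1 := ⟨r - 1, by omega⟩
    exact ⟨hmono (by omega), hmono (by omega)⟩
  have h3 := hD j ((Finset.Icc (k + 1) (k + 2 * D + 1)).filter (fun r => 2 ^ j < 2 * atomDim N r))
    fun r hr => by
      rw [Finset.mem_filter] at hr
      have := hbd r hr.1
      have := Finset.mem_Icc.mp hr.1
      exact ⟨by omega, hr.2, by omega⟩
  have h4 := hD (j - 1)
    ((Finset.Icc (k + 1) (k + 2 * D + 1)).filter (fun r => ¬ 2 ^ j < 2 * atomDim N r))
    fun r hr => by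
      rw [Finset.mem_filter] at hr
      have h5 := hbd r hr.1
      have := Finset.mem_Icc.mp hr.1
      have h6 := hpos k
      obtain ⟨i, rfl⟩ : ∃ i, j = i + 1 := ⟨j - 1, by
        rcases Nat.eq_zero_or_pos j with rfl | h
        · have := hr.2; simp at this; omega
        · omega⟩
      have h7 := hr.2
      rw [pow_succ] at h2 h7
      refine ⟨by omega, ?_, ?_⟩ <;> simp only [Nat.add_sub_cancel] <;> omega
  have h5 := Finset.card_filter_add_card_filter_not (s := Finset.Icc (k + 1) (k + 2 * D + 1))
    (fun r => 2 ^ j < 2 * atomDim N r)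
  rw [Nat.card_Icc] at h5
  omega

theorem le_mul_sub_of_two_mul_le {s : ℕ → ℕ} (hs : Monotone s) (h0 : s 0 = 0)
    (hmono : Monotone fun k => s (k + 1) - s k) {D : ℕ} (hD0 : 0 < D)
    (hD : ∀ k, 2 * (s (k + 1) - s k) ≤ s (k + D + 1) - s (k + D)) (k : ℕ) :
    s (k + 1) ≤ 2 * (D + 1) * (s (k + 1) - s k) := by
  have hstep : ∀ r k, s (k + r) ≤ s k + r * (s (k + r + 1) - s (k + r)) := by
    intro r
    induction r with
    | zero => simp
    | succ r ih =>
      intro k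
      have h1 := ih k
      have h2 : s (k + r + 1) - s (k + r) ≤ s (k + (r + 1) + 1) - s (k + (r + 1)) :=
        hmono (Nat.le_add_right _ 1)
      have h3 := hs (show k + r ≤ k + r + 1 by omega)
      have h4 := Nat.mul_le_mul_left r h2
      rw [add_one_mul, ← add_assoc k r 1]
      rw [← add_assoc k r 1] at h2 h4
      omega
  induction k using Nat.strong_induction_on with
  | _ k ih =>
    have h2 := hs (Nat.le_add_right k 1)
    by_cases hk : k ≤ D
    · have h1 := hstep k 0
      rw [zero_add, h0] at h1
      have := Nat.mul_le_mul_right (s (k + 1) - s k) (show k + 1 ≤ 2 * (D + 1) by omega)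
      rw [add_one_mul] at this
      omega
    · obtain ⟨i, rfl⟩ : ∃ i, k = i + D := ⟨k - D, by omega⟩
      have h1 := ih i (by omega)
      have h3 := hstep D i
      have h4 := Nat.mul_le_mul_left (D + 1) (hD i)
      have h5 := hs (Nat.le_add_right i 1)
      rw [mul_comm 2, mul_assoc] at h1 ⊢
      rw [add_one_mul] at h1 h4 ⊢
      rw [add_one_mul] at h4
      simp only [mul_left_comm D 2] at *
      omega

theorem Triangular.mul_eq_one_comm {H : Type*} [NormedAddCommGroup H] [InnerProductSpace ℂ H]
    [CompleteSpace H] {N : ℕ → Submodule ℂ H} {s : ℕ → ℕ} {e : ℕ → H} (he : IsAdapted N s e)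
    [∀ k, FiniteDimensional ℂ (N k)] {B C : H →L[ℂ] H} (hB : Triangular N N B)
    (hC : Triangular N N C) (h : B * C = 1) : C * B = 1 := by
  refine he.clm_ext fun a => ?_
  have ha : e a ∈ N (a + 1) :=
    he.basis_mem ((Nat.lt_add_one a).trans_le he.strictMono.le_apply)
  have h1 : (B : H →ₗ[ℂ] H).restrict (hB (a + 1)) * (C : H →ₗ[ℂ] H).restrict (hC (a + 1)) = 1 := by
    ext x
    exact congr($h (x : H))
  have h2 := _root_.mul_eq_one_comm.mp h1
  exact congr(($h2 ⟨e a, ha⟩ : H))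

theorem not_rgDenseIn_one {H : Type*} [NormedAddCommGroup H] [InnerProductSpace ℂ H]
    [CompleteSpace H] {N : ℕ → Submodule ℂ H} {s : ℕ → ℕ} {e : ℕ → H} (he : IsAdapted N s e)
    [∀ k, FiniteDimensional ℂ (N k)] : ¬ RgDenseIn (seqNestAlg N) 1 := by
  intro hd
  obtain ⟨A, S, -, hS, -, hAe, hSe, hA0, -⟩ := exists_partialIsometry
    (he.orth.comp (fun a => a + 1) (add_left_injective 1)) he.orth
  simp only [Function.comp_apply] at hAe hSe hA0
  have hAz : A (e 0) = 0 := hA0 _ fun a => by rw [he.inner_eq, if_neg (by omega)]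
  have hA : A ∈ seqNestAlg N := by
    intro k x hx
    refine he.induction_mem (p := fun x => A x ∈ N k) (by rw [map_zero]; exact zero_mem _)
      (fun x y hx hy => by rw [map_add]; exact add_mem hx hy)
      (fun c x hx => by rw [map_smul]; exact Submodule.smul_mem _ c hx) (fun a ha => ?_) hx
    rcases a with _ | a
    · rw [hAz]; exact zero_mem _
    · rw [hAe]; exact he.basis_mem (by omega)
  have hAS : A * S = 1 := he.clm_ext fun a => by simp [hSe, hAe]
  obtain ⟨b, c, hb, hc, hab, hbc⟩ := hd (fun _ => A) (fun _ => hA) 1 one_pos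
  simp only [Fin.sum_univ_one] at hbc
  have hcb := Triangular.mul_eq_one_comm he (hb 0) (hc 0) hbc
  have hu : IsUnit (b 0 * S) := by
    have h1 : ‖(A - b 0) * S‖ < 1 :=
      (norm_mul_le _ _).trans_lt ((mul_le_of_le_one_right (norm_nonneg _) hS).trans_lt (hab 0))
    have h2 := isUnit_one_sub_of_norm_lt_one h1
    rwa [sub_mul, hAS, sub_sub_cancel] at h2
  have hcu : IsUnit (c 0) := ⟨⟨c 0, b 0, hcb, hbc⟩, rfl⟩
  obtain ⟨u, hu'⟩ := hcu.mul hu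
  rw [← mul_assoc, hcb, one_mul] at hu'
  rw [← hu'] at hAS
  have hSA : (u : H →L[ℂ] H) * A = 1 := by
    rw [eq_comm, ← Units.mul_inv u, Units.mul_right_inj, Units.inv_eq_of_mul_eq_one_left hAS]
  have h0 : e 0 = 0 := by
    have := congr($hSA (e 0))
    simpa [hAz] using this.symm
  exact he.orth.ne_zero 0 h0

theorem exists_le_mul_atomDim {H : Type*} [NormedAddCommGroup H] [InnerProductSpace ℂ H]
    {N : ℕ → Submodule ℂ H} {e : ℕ → H}
    (he : IsAdapted N (fun k => Module.finrank ℂ (N k)) e)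
    (hmono : Monotone fun k => atomDim N (k + 1)) {D : ℕ}
    (hD : ∀ (j : ℕ) (S : Finset ℕ), (∀ k ∈ S, InDyadicClass N j k) → S.card ≤ D) :
    ∃ m, ∀ k, Module.finrank ℂ (N (k + 1)) ≤ m * atomDim N (k + 1) := by
  have hpos : ∀ k, 0 < atomDim N (k + 1) := fun k =>
    Nat.sub_pos_of_lt (he.strictMono (Nat.lt_add_one k))
  refine ⟨_, le_mul_sub_of_two_mul_le he.strictMono.monotone he.zero hmono
    (Nat.mul_pos two_pos D.succ_pos) fun k =>
      two_mul_le_of_card_dyadic_le hpos hmono (fun j S hS => (hD j S hS).trans D.le_succ) k⟩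

theorem exists_dyadic_block {H : Type*} [NormedAddCommGroup H] [InnerProductSpace ℂ H]
    {N : ℕ → Submodule ℂ H} (hmono : Monotone fun k => atomDim N (k + 1))
    (hD : ∀ D : ℕ, ∃ (j : ℕ) (S : Finset ℕ),
      (∀ k ∈ S, InDyadicClass N j k) ∧ D < S.card) (D M : ℕ) :
    ∃ j K, M + D ≤ K ∧ ∀ r, K ≤ r + D → r < K →
      2 ^ j ≤ 2 * atomDim N (r + 1) ∧ atomDim N (r + 1) ≤ 2 ^ j := by
  obtain ⟨j, S, hS, hc⟩ := hD (D + M)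
  have hne : S.Nonempty := Finset.card_pos.mp (by omega)
  have hp := hS _ (S.min'_mem hne)
  have hq := hS _ (S.max'_mem hne)
  have hle : S.card ≤ S.max' hne + 1 - S.min' hne := by
    rw [← Nat.card_Icc]
    exact Finset.card_le_card fun a ha =>
      Finset.mem_Icc.mpr ⟨S.min'_le a ha, S.le_max' a ha⟩
  obtain ⟨p, hpe⟩ : ∃ p, S.min' hne = p + 1 := ⟨S.min' hne - 1, by have := hp.1; omega⟩
  obtain ⟨q, hqe⟩ : ∃ q, S.max' hne = q + 1 := ⟨S.max' hne - 1, by have := hq.1; omega⟩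
  rw [hpe] at hp hle
  rw [hqe] at hq hle
  refine ⟨j, q + 1, by omega, fun r hr1 hr2 => ?_⟩
  have h1 : atomDim N (p + 1) ≤ atomDim N (r + 1) := hmono (show p ≤ r by omega)
  have h2 : atomDim N (r + 1) ≤ atomDim N (q + 1) := hmono (show r ≤ q by omega)
  exact ⟨by have := hp.2.1; omega, h2.trans hq.2.2⟩

/-- The number of atoms needed at the successive levels of a window. -/
def windowRadius (n : ℕ) : ℕ → ℕ
  | 0 => 1
  | l + 1 => 2 * n * windowRadius n l + 2

theorem windowRadius_mono {n : ℕ} (hn : 1 ≤ n) : Monotone (windowRadius n) := by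
  refine monotone_nat_of_le_succ fun l => ?_
  have := Nat.mul_le_mul_right (windowRadius n l) (show 1 ≤ 2 * n by omega)
  rw [windowRadius]
  omega

/-- A window of `N`: the levels `κ 0 ≥ κ 1 ≥ ⋯ ≥ κ h` below `K`, with room for `n` copies of the
span of level `l` between the levels `l` and `l + 1`. -/
structure IsWindow (s : ℕ → ℕ) (n h M K : ℕ) (κ : ℕ → ℕ) : Prop where
  le : M ≤ κ h
  lt : κ 0 < K
  anti : Antitone κ
  add_le : ∀ l < h, (s K - s (κ 0)) + n * (s K - s (κ l)) ≤ s K - s (κ (l + 1))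

theorem exists_isWindow {H : Type*} [NormedAddCommGroup H] [InnerProductSpace ℂ H]
    {N : ℕ → Submodule ℂ H} (hmono : Monotone fun k => atomDim N (k + 1))
    (hfr : Monotone fun k => Module.finrank ℂ (N k))
    (hD : ∀ D : ℕ, ∃ (j : ℕ) (S : Finset ℕ),
      (∀ k ∈ S, InDyadicClass N j k) ∧ D < S.card) {n : ℕ} (hn : 1 ≤ n) (h M : ℕ) :
    ∃ K κ, IsWindow (fun k => Module.finrank ℂ (N k)) n h M K κ := by
  obtain ⟨j, K, hK, hblock⟩ := exists_dyadic_block hmono hD (windowRadius n h) M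
  have hsum : ∀ r ≤ windowRadius n h,
      r * 2 ^ j ≤ 2 * (Module.finrank ℂ (N K) - Module.finrank ℂ (N (K - r))) ∧
        Module.finrank ℂ (N K) - Module.finrank ℂ (N (K - r)) ≤ r * 2 ^ j := by
    intro r
    induction r with
    | zero => simp
    | succ r ih =>
      intro hr
      have h1 := ih (by omega)
      obtain ⟨q, hq⟩ : ∃ q, K - (r + 1) = q := ⟨_, rfl⟩
      have h2 := hblock q (by omega) (by omega)
      have h3 : Module.finrank ℂ (N q) ≤ Module.finrank ℂ (N (q + 1)) := hfr (Nat.le_add_right q 1)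
      have h4 : Module.finrank ℂ (N (q + 1)) ≤ Module.finrank ℂ (N K) := hfr (by omega)
      rw [show K - r = q + 1 by omega] at h1
      rw [hq, add_one_mul]
      rw [atomDim, Nat.add_sub_cancel] at h2
      omega
  have hrm := windowRadius_mono hn
  have h1r : 1 ≤ windowRadius n h := hrm (Nat.zero_le h)
  refine ⟨K, fun l => K - windowRadius n l, by omega, ?_, fun l l' hl => ?_, fun l hl => ?_⟩
  · simp only [windowRadius]
    omega
  · exact Nat.sub_le_sub_left (hrm hl) K
  · have h0 := hsum _ (hrm (Nat.zero_le h))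
    have h1 := hsum _ (hrm hl.le)
    have h2 := hsum _ (hrm (show l + 1 ≤ h by omega))
    simp only [windowRadius] at h0 h2 ⊢
    have h3 := Nat.mul_le_mul_left n h1.2
    rw [add_mul, mul_assoc, mul_assoc] at h2
    omega

theorem exists_partialIsometry_family {H ι : Type*} [NormedAddCommGroup H] [InnerProductSpace ℂ H]
    [CompleteSpace H] [DecidableEq ι] {e : ℕ → H} (he : Orthonormal ℂ e) (dom : ι → ℕ → Prop)
    (f : ι → ℕ → ℕ) (hf : ∀ i j a b, dom i a → dom j b → f i a = f j b → i = j ∧ a = b) :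
    ∃ A R : ι → H →L[ℂ] H, (∀ i, ‖R i‖ ≤ 1) ∧ (∀ i a, dom i a → A i (e a) = e (f i a)) ∧
      (∀ i a, ¬ dom i a → A i (e a) = 0) ∧
      (∀ i j a, dom i a → R j (e (f i a)) = if i = j then e a else 0) ∧
      ∀ j b, (∀ a, dom j a → f j a ≠ b) → R j (e b) = 0 := by
  have hv : ∀ i, Function.Injective (fun a : {a // dom i a} => f i a) := fun i a b hab =>
    Subtype.ext (hf i i a b a.2 b.2 hab).2
  choose A R _ hR _ hA1 hR1 hA0 hR0 using fun i => exists_partialIsometry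
    (he.comp (fun a : {a // dom i a} => (a : ℕ)) Subtype.val_injective) (he.comp _ (hv i))
  simp only [Function.comp_apply, Subtype.forall] at hA1 hR1 hA0 hR0
  have hR0' : ∀ j b, (∀ a, dom j a → f j a ≠ b) → R j (e b) = 0 := fun j b hb =>
    hR0 j _ fun a ha => by rw [orthonormal_iff_ite.mp he, if_neg (hb a ha)]
  refine ⟨A, R, hR, hA1, fun i a ha => hA0 i _ fun b hb => ?_, fun i j a ha => ?_, hR0'⟩
  · rw [orthonormal_iff_ite.mp he, if_neg (by rintro rfl; exact ha hb)]
  · split_ifs with hij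
    · subst hij; exact hR1 i a ha
    · exact hR0' j _ fun b hb hab => hij (hf j i b a hb ha hab).1.symm

/-- Shifts inside a window: `A i` moves the span of level `l` into level `l + 1` and `R i` moves it
back. -/
structure IsWindowShift {H : Type*} [NormedAddCommGroup H] [InnerProductSpace ℂ H] {n : ℕ}
    (N : ℕ → Submodule ℂ H) (s : ℕ → ℕ) (e : ℕ → H) (A R : Fin n → H →L[ℂ] H) (h K : ℕ)
    (κ : ℕ → ℕ) : Prop where
  lt : κ 0 < K
  anti : Antitone κ
  apply_last : ∀ j, R j (e (s K - 1)) = 0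
  mem : ∀ i a, s (κ 0) ≤ a → a < s K → A i (e a) ∈ N (κ 0)
  shift : ∀ i, ∀ l < h, ∀ a, s (κ (l + 1)) ≤ a → a < s K →
    (A i (e a) = 0 ∧ a < s (κ l)) ∨ ∃ b, A i (e a) = e b ∧
      (∀ j, R j (e b) = if i = j then e a else 0) ∧ (s (κ l) ≤ a → s (κ (l + 1)) ≤ b)

theorem exists_isWindowShift {H : Type*} [NormedAddCommGroup H] [InnerProductSpace ℂ H]
    [CompleteSpace H] {N : ℕ → Submodule ℂ H} {s : ℕ → ℕ} {e : ℕ → H} (he : IsAdapted N s e)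
    {n : ℕ} (hn : 1 ≤ n) (hw : ∀ h M, ∃ K κ, IsWindow s n h M K κ) :
    ∃ A R : Fin n → H →L[ℂ] H, (∀ i, A i ∈ seqNestAlg N) ∧ (∀ i, ‖R i‖ ≤ 1) ∧
      ∀ h, ∃ K κ, IsWindowShift N s e A R h K κ := by
  choose K' κ' hw' using hw
  obtain ⟨m, hm0, hm⟩ : ∃ m : ℕ → ℕ, m 0 = 0 ∧ ∀ h, m (h + 1) = K' h (m h) :=
    ⟨fun h => Nat.rec 0 (fun h M => K' h M) h, rfl, fun _ => rfl⟩
  obtain ⟨κ, hκ⟩ : ∃ κ : ℕ → ℕ → ℕ, ∀ h, IsWindow s n h (m h) (m (h + 1)) (κ h) :=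
    ⟨fun h => κ' h (m h), fun h => hm h ▸ hw' h (m h)⟩
  have hmm : StrictMono m := strictMono_nat_of_lt_succ fun h =>
    ((hκ h).le.trans ((hκ h).anti (Nat.zero_le h))).trans_lt (hκ h).lt
  have hsm := he.strictMono.comp hmm
  choose η hη1 hη2 using hsm.exists_le_lt_succ (by simp [hm0, he.zero])
  simp only [Function.comp_apply] at hη1 hη2
  have hη : ∀ h a, s (m h) ≤ a → a < s (m (h + 1)) → η a = h := by
    intro h a h1 h2
    have h3 := hsm.lt_iff_lt.mp (h1.trans_lt (hη2 a))
    have h4 := hsm.lt_iff_lt.mp ((hη1 a).trans_lt h2)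
    omega
  obtain ⟨g, hg⟩ : ∃ g : Fin n → ℕ → ℕ, ∀ i a, g i a = (s (m (η a + 1)) - s (κ (η a) 0)) +
    n * (s (m (η a + 1)) - 1 - a) + i := ⟨_, fun _ _ => rfl⟩
  obtain ⟨dom, hdom⟩ : ∃ dom : Fin n → ℕ → Prop, ∀ i a, dom i a ↔
    s (κ (η a) (η a)) ≤ a ∧ g i a + s (κ (η a) (η a)) < s (m (η a + 1)) := ⟨_, fun _ _ => Iff.rfl⟩
  have hle : ∀ h, s (m h) ≤ s (κ h h) := fun h => he.strictMono.monotone (hκ h).le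
  have hlt : ∀ h, s (κ h 0) < s (m (h + 1)) := fun h => he.strictMono (hκ h).lt
  have hηf : ∀ i a, dom i a → η (s (m (η a + 1)) - 1 - g i a) = η a := by
    intro i a ha
    have h1 := ((hdom i a).mp ha).2
    have h2 := hle (η a)
    exact hη _ _ (by omega) (by omega)
  obtain ⟨A, R, hR, hA1, hA0, hR1, hR0⟩ := exists_partialIsometry_family he.orth dom
    (fun i a => s (m (η a + 1)) - 1 - g i a) (by
      intro i j a b ha hb hab
      have h1 := hηf i a ha
      rw [hab, hηf j b hb] at h1
      have h2 := ((hdom i a).mp ha).2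
      have h3 := ((hdom j b).mp hb).2
      have h4 := hη2 a
      have h5 := hη2 b
      have hga := hg i a
      have hgb := hg j b
      rw [h1] at hab h3 h5 hgb
      have hgg : n * (s (m (η a + 1)) - 1 - a) + i = n * (s (m (η a + 1)) - 1 - b) + j := by omega
      have h6 := congrArg (· / n) hgg
      have h7 := congrArg (· % n) hgg
      simp only [Nat.mul_add_div hn, Nat.div_eq_of_lt i.2, Nat.div_eq_of_lt j.2,
        Nat.mul_add_mod, Nat.mod_eq_of_lt i.2, Nat.mod_eq_of_lt j.2] at h6 h7
      exact ⟨Fin.ext h7, by omega⟩)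
  have hglt : ∀ i a, s (m (η a + 1)) - s (κ (η a) 0) ≤ g i a := fun i a => by
    rw [hg]; omega
  have hga : ∀ i a, s (m (η a + 1)) - 1 - a < g i a := fun i a => by
    have h1 := hlt (η a)
    have h2 := Nat.mul_le_mul_right (s (m (η a + 1)) - 1 - a) hn
    rw [hg]; omega
  refine ⟨A, R, fun i k x hx => ?_, hR, fun h => ⟨m (h + 1), κ h, (hκ h).lt, (hκ h).anti,
    fun j => hR0 j _ fun a ha hab => ?_, fun i a ha1 ha2 => ?_, fun i l hl a ha1 ha2 => ?_⟩⟩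
  · refine he.induction_mem (p := fun x => A i x ∈ N k) (by rw [map_zero]; exact zero_mem _)
      (fun x y hx hy => by rw [map_add]; exact add_mem hx hy)
      (fun c x hx => by rw [map_smul]; exact Submodule.smul_mem _ c hx) (fun a ha => ?_) hx
    by_cases hd : dom i a
    · rw [hA1 i a hd]
      have := hga i a
      exact he.basis_mem (by omega)
    · rw [hA0 i a hd]; exact zero_mem _
  · have h0 := hsm (Nat.lt_add_one h)
    simp only [Function.comp_apply] at h0
    have h1 := hηf j a ha
    rw [hab, hη h _ (by omega) (by omega)] at h1
    rw [← h1] at hab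
    have h2 := hglt j a
    have h3 := hlt h
    have h4 := ((hdom j a).mp ha).2
    rw [← h1] at h2 h4
    omega
  · have h1 : s (m h) ≤ a :=
      (hle h).trans ((he.strictMono.monotone ((hκ h).anti (Nat.zero_le h))).trans ha1)
    have h2 := hη h a h1 ha2
    by_cases hd : dom i a
    · rw [hA1 i a hd]
      have h3 := hglt i a
      have h4 := hlt h
      have h5 := ((hdom i a).mp hd).2
      rw [h2] at h3 h5 ⊢
      exact he.basis_mem (by omega)
    · rw [hA0 i a hd]; exact zero_mem _
  · have h0 : s (κ h h) ≤ s (κ h (l + 1)) := he.strictMono.monotone ((hκ h).anti hl)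
    have h1 : s (m h) ≤ a := (hle h).trans (h0.trans ha1)
    have h2 := hη h a h1 ha2
    have h3 : s (κ h l) ≤ a → g i a + s (κ h (l + 1)) < s (m (h + 1)) := by
      intro hla
      have h4 := (hκ h).add_le l hl
      have h5 := Nat.mul_le_mul_left n
        (show s (m (h + 1)) - 1 - a + 1 ≤ s (m (h + 1)) - s (κ h l) by omega)
      have h6 := hlt h
      have h7 := i.2
      rw [mul_add_one] at h5
      rw [hg, h2]
      omega
    by_cases hd : dom i a
    · refine Or.inr ⟨_, hA1 i a hd, fun j => hR1 i j a hd, fun hla => ?_⟩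
      have := h3 hla
      rw [h2]
      omega
    · refine Or.inl ⟨hA0 i a hd, ?_⟩
      by_contra! hla
      have := h3 hla
      refine hd ((hdom i a).mpr ?_)
      rw [h2]
      omega

section Tail

variable {H : Type*} [NormedAddCommGroup H] [InnerProductSpace ℂ H]
  {N : ℕ → Submodule ℂ H} {s : ℕ → ℕ} {e : ℕ → H} [∀ k, FiniteDimensional ℂ (N k)]

variable (N) in
/-- The orthogonal projection onto the orthogonal complement of `N k`. -/
noncomputable def tail (k : ℕ) : H →L[ℂ] H := (N k)ᗮ.starProjection

theorem norm_tail_le (k : ℕ) (x : H) : ‖tail N k x‖ ≤ ‖x‖ :=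
  ((tail N k).le_opNorm x).trans
    (mul_le_of_le_one_left (norm_nonneg x) (N k)ᗮ.starProjection_norm_le)

theorem sub_tail_mem (k : ℕ) (x : H) : x - tail N k x ∈ N k := by
  rw [tail, Submodule.starProjection_orthogonal_val, sub_sub_cancel]
  exact Submodule.starProjection_apply_mem _ _

theorem tail_eq_zero {k : ℕ} {x : H} (hx : x ∈ N k) : tail N k x = 0 := by
  rw [tail, Submodule.starProjection_orthogonal_val, Submodule.starProjection_eq_self_iff.mpr hx,
    sub_self]

theorem tail_comp_tail {k : ℕ} {T : H →L[ℂ] H} (hT : T ∈ seqNestAlg N) (x : H) :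
    tail N k (T (tail N k x)) = tail N k (T x) := by
  rw [eq_comm, ← sub_eq_zero, ← map_sub, ← map_sub]
  exact tail_eq_zero (hT k _ (sub_tail_mem k x))

theorem IsAdapted.tail_eq_self (he : IsAdapted N s e) {k a : ℕ} (ha : s k ≤ a) :
    tail N k (e a) = e a := by
  rw [tail, Submodule.starProjection_eq_self_iff, he.span_eq]
  refine (Submodule.mem_orthogonal _ _).mpr fun y hy => ?_
  rw [← he.span_eq] at hy
  exact inner_eq_zero_symm.mp (he.mem_iff.mp hy a ha)

variable {n : ℕ} {A R B C : Fin n → H →L[ℂ] H} {h K : ℕ} {κ : ℕ → ℕ}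

theorem IsWindowShift.tail_apply_zero (hw : IsWindowShift N s e A R h K κ)
    (he : IsAdapted N s e) (i : Fin n) {w : H} (hwK : w ∈ N K) :
    tail N (κ 0) (A i (tail N (κ 0) w)) = 0 := by
  refine he.induction_mem (p := fun w => tail N (κ 0) (A i (tail N (κ 0) w)) = 0) (by simp)
    (fun x y hx hy => by simp only [map_add, hx, hy, add_zero])
    (fun c x hx => by simp only [map_smul, hx, smul_zero]) (fun a ha => ?_) hwK
  rcases lt_or_ge a (s (κ 0)) with h1 | h1
  · rw [tail_eq_zero (he.basis_mem h1), map_zero, map_zero]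
  · rw [he.tail_eq_self h1]
    exact tail_eq_zero (hw.mem i a h1 ha)

theorem IsWindowShift.tail_apply_succ (hw : IsWindowShift N s e A R h K κ)
    (he : IsAdapted N s e) (i j : Fin n) {l : ℕ} (hl : l < h) {w : H} (hwK : w ∈ N K) :
    tail N (κ l) (R j (tail N (κ (l + 1)) (A i (tail N (κ (l + 1)) w)))) =
      if i = j then tail N (κ l) w else 0 := by
  refine he.induction_mem (p := fun w => tail N (κ l) (R j (tail N (κ (l + 1))
    (A i (tail N (κ (l + 1)) w)))) = if i = j then tail N (κ l) w else 0) (by simp)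
    (fun x y hx hy => ?_) (fun c x hx => ?_) (fun a ha => ?_) hwK
  · simp only [map_add, hx, hy]
    split_ifs <;> simp
  · simp only [map_smul, hx]
    split_ifs <;> simp
  have hanti : s (κ (l + 1)) ≤ s (κ l) := he.strictMono.monotone (hw.anti (Nat.le_add_right l 1))
  rcases lt_or_ge a (s (κ (l + 1))) with h1 | h1
  · rw [tail_eq_zero (he.basis_mem h1), tail_eq_zero (he.basis_mem (h1.trans_le hanti))]
    simp
  rw [he.tail_eq_self h1]
  rcases hw.shift i l hl a h1 ha with ⟨h2, h3⟩ | ⟨b, h2, h3, h4⟩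
  · rw [h2, tail_eq_zero (he.basis_mem h3)]
    simp
  rw [h2]
  rcases lt_or_ge b (s (κ (l + 1))) with h5 | h5
  · have h6 : a < s (κ l) := by
      by_contra! h6
      have := h4 h6
      omega
    rw [tail_eq_zero (he.basis_mem h5), tail_eq_zero (he.basis_mem h6)]
    simp
  · rw [he.tail_eq_self h5, h3]
    split_ifs <;> simp

theorem IsWindowShift.two_pow_le (hw : IsWindowShift N s e A R h K κ)
    (he : IsAdapted N s e) (hn : 1 ≤ n) (hR : ∀ i, ‖R i‖ ≤ 1)
    (hB : ∀ i, B i ∈ seqNestAlg N) (hC : ∀ i, C i ∈ seqNestAlg N)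
    (hAB : ∀ i, ‖A i - B i‖ < 1 / (2 * n)) (hBC : ∑ i, B i * C i = 1) {l : ℕ} (hl : l ≤ h) :
    ∃ i, 2 ^ (l + 1) ≤ ‖tail N (κ l) (C i (e (s K - 1)))‖ := by
  obtain ⟨x, hx⟩ : ∃ x, e (s K - 1) = x := ⟨_, rfl⟩
  have hK : s (κ 0) < s K := he.strictMono hw.lt
  have hxK : x ∈ N K := hx ▸ he.basis_mem (by omega)
  have hn0 : (0 : ℝ) < n := by exact_mod_cast hn
  have hBx : ∑ i, B i (C i x) = x := by simpa using congr($hBC x)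
  have hxt : ∀ l, tail N (κ l) x = x := fun l => by
    have : s (κ l) ≤ s (κ 0) := he.strictMono.monotone (hw.anti (Nat.zero_le l))
    rw [← hx]
    exact he.tail_eq_self (by omega)
  have hsplit : ∀ l, x = ∑ i, tail N (κ l) (A i (tail N (κ l) (C i x))) -
      ∑ i, tail N (κ l) ((A i - B i) (tail N (κ l) (C i x))) := fun l => by
    rw [← Finset.sum_sub_distrib]
    conv_lhs => rw [← hxt l, ← hBx, map_sum]
    refine Finset.sum_congr rfl fun i _ => ?_
    rw [← map_sub, sub_apply, sub_sub_cancel, tail_comp_tail (hB i)]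
  have hbound : ∀ l, ‖∑ i, tail N (κ l) ((A i - B i) (tail N (κ l) (C i x)))‖ ≤
      ∑ i, 1 / (2 * n) * ‖tail N (κ l) (C i x)‖ := fun l =>
    norm_sum_le_of_le _ fun i _ => (norm_tail_le _ _).trans
      ((A i - B i).le_of_opNorm_le (hAB i).le _)
  have hmax : ∀ l (c : ℝ), c ≤ ‖∑ i, tail N (κ l) ((A i - B i) (tail N (κ l) (C i x)))‖ →
      ∃ i, 2 * c ≤ ‖tail N (κ l) (C i x)‖ := by
    intro l c hc
    have : Nonempty (Fin n) := ⟨⟨0, hn⟩⟩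
    obtain ⟨i, -, hi⟩ := Finset.exists_le_of_sum_le (s := Finset.univ)
      (f := fun _ : Fin n => 1 / (2 * (n : ℝ)) * (2 * c))
      (g := fun i => 1 / (2 * (n : ℝ)) * ‖tail N (κ l) (C i x)‖) Finset.univ_nonempty (by
        refine le_trans (le_of_eq ?_) (hc.trans (hbound l))
        rw [Finset.sum_const, Finset.card_univ, Fintype.card_fin, nsmul_eq_mul]
        field_simp)
    exact ⟨i, le_of_mul_le_mul_left hi (by positivity)⟩
  rw [hx]
  induction l with
  | zero =>
    have h1 := hsplit 0
    rw [Finset.sum_eq_zero fun i _ => hw.tail_apply_zero he i (hC i K x hxK), zero_sub] at h1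
    have h2 := congrArg norm h1
    rw [norm_neg, ← hx, he.orth.1, hx] at h2
    obtain ⟨i, hi⟩ := hmax 0 1 h2.le
    exact ⟨i, by simpa using hi⟩
  | succ l ih =>
    obtain ⟨j, hj⟩ := ih (by omega)
    have h1 := congrArg (fun y => tail N (κ l) (R j y)) (hsplit (l + 1))
    simp only [map_sub, map_sum] at h1
    rw [Finset.sum_congr rfl fun i _ => hw.tail_apply_succ he i j hl (hC i K x hxK),
      Finset.sum_ite_eq' Finset.univ j, if_pos (Finset.mem_univ j), ← hx, hw.apply_last j,
      map_zero, hx, eq_comm, sub_eq_zero, ← map_sum, ← map_sum] at h1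
    obtain ⟨i, hi⟩ := hmax (l + 1) (2 ^ (l + 1)) (by
      refine hj.trans ?_
      rw [h1]
      exact (norm_tail_le _ _).trans (((R j).le_of_opNorm_le (hR j) _).trans_eq (one_mul _)))
    exact ⟨i, by rw [pow_succ']; exact hi⟩

end Tail

theorem not_rgDenseIn_of_isWindow {H : Type*} [NormedAddCommGroup H] [InnerProductSpace ℂ H]
    [CompleteSpace H] {N : ℕ → Submodule ℂ H} {s : ℕ → ℕ} {e : ℕ → H} (he : IsAdapted N s e)
    [∀ k, FiniteDimensional ℂ (N k)] {n : ℕ} (hn : 1 ≤ n)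
    (hw : ∀ h M, ∃ K κ, IsWindow s n h M K κ) : ¬ RgDenseIn (seqNestAlg N) n := by
  intro hd
  obtain ⟨A, R, hA, hR, hwin⟩ := exists_isWindowShift he hn hw
  have hn0 : (0 : ℝ) < n := by exact_mod_cast hn
  obtain ⟨B, C, hB, hC, hAB, hBC⟩ := hd A hA (1 / (2 * n)) (by positivity)
  obtain ⟨h, hh⟩ := pow_unbounded_of_one_lt (∑ i, ‖C i‖) (one_lt_two (α := ℝ))
  obtain ⟨K, κ, hs⟩ := hwin h
  obtain ⟨i, hi⟩ := hs.two_pow_le he hn hR hB hC hAB hBC le_rfl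
  have h1 : ‖C i (e (s K - 1))‖ ≤ ‖C i‖ := by
    simpa [he.orth.1] using (C i).le_opNorm (e (s K - 1))
  have h2 := Finset.single_le_sum (f := fun i => ‖C i‖) (fun i _ => norm_nonneg _)
    (Finset.mem_univ i)
  have h3 := norm_tail_le (N := N) (κ h) (C i (e (s K - 1)))
  have h4 : (2 : ℝ) ^ h ≤ 2 ^ (h + 1) := pow_le_pow_right₀ one_le_two (Nat.le_add_right h 1)
  linarith

/-- **Theorem (monotone case).**  Let `𝒩` be a nest of order type `ω` with
finite-rank atoms of monotone increasing dimensions `n_k`, and let `d_j` count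
the atoms with `2^{j−1} < n_k ≤ 2^j`.  (i) If the `d_j` are unbounded, then
`rtsr(T(𝒩)) = ∞`.  (ii) If the `d_j` are bounded, then `rtsr(T(𝒩)) = 2`. -/
theorem rtsr_monotone_nest
    {H : Type*} [NormedAddCommGroup H] [InnerProductSpace ℂ H]
    [CompleteSpace H] [TopologicalSpace.SeparableSpace H]
    (hinf : ¬ FiniteDimensional ℂ H)
    {N : ℕ → Submodule ℂ H} (hN : IsOmegaNest N)
    (hmono : ∀ k, 1 ≤ k → atomDim N k ≤ atomDim N (k + 1)) :
    ((∀ D : ℕ, ∃ (j : ℕ) (S : Finset ℕ),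
        (∀ k ∈ S, InDyadicClass N j k) ∧ D < S.card) →
      ∀ n : ℕ, 1 ≤ n → ¬ RgDenseIn (seqNestAlg N) n) ∧
    ((∃ D : ℕ, ∀ (j : ℕ) (S : Finset ℕ),
        (∀ k ∈ S, InDyadicClass N j k) → S.card ≤ D) →
      (RgDenseIn (seqNestAlg N) 2 ∧ ¬ RgDenseIn (seqNestAlg N) 1)) := by
  obtain ⟨e, he⟩ := hN.exists_isAdapted
  have := hN.finiteDim
  have hm : Monotone fun k => atomDim N (k + 1) :=
    monotone_nat_of_le_succ fun k => hmono (k + 1) (Nat.le_add_left 1 k)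
  refine ⟨fun hD n hn => not_rgDenseIn_of_isWindow he hn
    (exists_isWindow hm he.strictMono.monotone hD hn), fun ⟨D, hD⟩ => ⟨?_, not_rgDenseIn_one he⟩⟩
  obtain ⟨m, hm⟩ := exists_le_mul_atomDim he hm hD
  exact rgDenseIn_two hN he hm
end
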